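/- Let d ≥ 2 and p > 1 with d < 2p/(p−1), and set β₀ = (d(p−1) − 2p)/(p−1)² (so β₀ < 0). Let κ ∈ (0, −β₀] and let β : ℝ^d ∖ {0} → ℝ be locally Hölder continuous with β(x) ≥ (β₀ + κ)/|x|² for all x ≠ 0. Then there exists a function u : (ℝ^d ∖ {0}) × [0,∞) → ℝ, not identically zero, that is continuous, nonnegative, twice continuously differentiable in x and once in t on (ℝ^d ∖ {0}) × (0,∞), satisfies ∂u/∂t = (1/2)Δu + β(x)u − u^p on (ℝ^d ∖ {0}) × (0,∞), and satisfies u(x,0) = 0 for all x ∈ ℝ^d ∖ {0}. -/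

import Mathlib

open Set

/-- The `i`-th partial derivative of a function on `ℝ^d`. -/
noncomputable def pd {d : ℕ} (i : Fin d) (f : EuclideanSpace ℝ (Fin d) → ℝ)
    (x : EuclideanSpace ℝ (Fin d)) : ℝ :=
  fderiv ℝ f x (EuclideanSpace.single i 1)

/-- `f` is locally Hölder continuous on the set `S`. -/
def LocHolderOn {d : ℕ} (f : EuclideanSpace ℝ (Fin d) → ℝ)
    (S : Set (EuclideanSpace ℝ (Fin d))) : Prop :=
  ∀ K : Set (EuclideanSpace ℝ (Fin d)), K ⊆ S → IsCompact K →
    ∃ κ C : ℝ, 0 < κ ∧ κ ≤ 1 ∧ 0 ≤ C ∧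
      ∀ x ∈ K, ∀ y ∈ K, |f x - f y| ≤ C * ‖x - y‖ ^ κ

section

open MeasureTheory Filter Topology Real
open scoped ContDiff Convolution BoundedContinuousFunction

/-- Euclidean space `ℝ^d`. -/
abbrev Euc (d : ℕ) : Type := EuclideanSpace ℝ (Fin d)

/-- The Gaussian kernel of `∂ₜ - Δ/2`, extended by zero to nonpositive times. -/
noncomputable def heatKernel {d : ℕ} (q : Euc d × ℝ) : ℝ :=
  if 0 < q.2 then (2 * π * q.2) ^ (-(d : ℝ) / 2) * exp (-‖q.1‖ ^ 2 / (2 * q.2)) else 0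

lemma heatKernel_of_pos {d : ℕ} {z : Euc d} {r : ℝ} (hr : 0 < r) :
    heatKernel (z, r) = (2 * π * r) ^ (-(d : ℝ) / 2) * exp (-‖z‖ ^ 2 / (2 * r)) := by
  simp [heatKernel, hr]

lemma heatKernel_of_nonpos {d : ℕ} {z : Euc d} {r : ℝ} (hr : r ≤ 0) :
    heatKernel (z, r) = 0 := by
  simp [heatKernel, not_lt.2 hr]

lemma heatKernel_nonneg {d : ℕ} (q : Euc d × ℝ) : 0 ≤ heatKernel q := by
  unfold heatKernel
  split_ifs <;> positivity

/-- A smooth function on the line: `x ^ (-d/2) * exp (-1/x)` for positive `x`. -/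
lemma contDiff_rpow_mul_expNegInvGlue (a : ℝ) (n : ℕ) :
    ContDiff ℝ n (fun x : ℝ => x ^ a * expNegInvGlue x) := by
  obtain ⟨m, hm⟩ := exists_nat_ge ((n : ℝ) - a)
  have h1 : ContDiff ℝ n (fun x : ℝ => x ^ (a + m)) :=
    contDiff_rpow_const_of_le (by linarith)
  have h2 : ContDiff ℝ n (fun x : ℝ => (Polynomial.X ^ m : Polynomial ℝ).eval x⁻¹
      * expNegInvGlue x) :=
    expNegInvGlue.contDiff_polynomial_eval_inv_mul (n := n) _
  have h3 := h1.mul h2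
  refine contDiff_iff_contDiffAt.2 fun y => (h3.contDiffAt (x := y)).congr_of_eventuallyEq
    (Eventually.of_forall fun x => ?_)
  rcases le_or_gt x 0 with hx | hx
  · simp [expNegInvGlue.zero_of_nonpos hx]
  · simp only []
    rw [rpow_add hx, rpow_natCast]
    simp only [Polynomial.eval_pow, Polynomial.eval_X]
    have : x ^ m ≠ 0 := by positivity
    rw [inv_pow]
    field_simp

lemma heatKernel_eq_glue {d : ℕ} {z : Euc d} (hz : z ≠ 0) (r : ℝ) :
    heatKernel (z, r) = (π * ‖z‖ ^ 2) ^ (-(d : ℝ) / 2) *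
      ((2 * r / ‖z‖ ^ 2) ^ (-(d : ℝ) / 2) * expNegInvGlue (2 * r / ‖z‖ ^ 2)) := by
  have hz' : 0 < ‖z‖ := norm_pos_iff.2 hz
  rcases le_or_gt r 0 with hr | hr
  · rw [heatKernel_of_nonpos hr, expNegInvGlue.zero_of_nonpos]
    · simp
    · exact div_nonpos_of_nonpos_of_nonneg (by linarith) (by positivity)
  · rw [heatKernel_of_pos hr, ← mul_assoc, ← mul_rpow (by positivity) (by positivity)]
    have h : 0 < 2 * r / ‖z‖ ^ 2 := by positivity
    simp only [expNegInvGlue, not_le.2 h, if_false]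
    congr 2
    · field_simp
    · field_simp

lemma contDiffAt_heatKernel {d : ℕ} {q : Euc d × ℝ} (hq : q ≠ 0) :
    ContDiffAt ℝ ∞ (heatKernel (d := d)) q := by
  obtain ⟨z, r⟩ := q
  rw [contDiffAt_infty]
  intro n
  by_cases hz : z = 0
  · have hr : r ≠ 0 := by
      rintro rfl
      exact hq (by simp [hz])
    rcases lt_or_gt_of_ne hr with hr | hr
    · have : heatKernel (d := d) =ᶠ[𝓝 (z, r)] fun _ => 0 := by
        filter_upwards [(isOpen_lt continuous_snd continuous_const).mem_nhds
          (show (z, r) ∈ {q : Euc d × ℝ | q.2 < 0} from hr)] with q hq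
        exact heatKernel_of_nonpos (z := q.1) (r := q.2) (le_of_lt hq)
      exact contDiffAt_const.congr_of_eventuallyEq this
    · have : heatKernel (d := d) =ᶠ[𝓝 (z, r)] fun q =>
          (2 * π * q.2) ^ (-(d : ℝ) / 2) * exp (-‖q.1‖ ^ 2 / (2 * q.2)) := by
        filter_upwards [(isOpen_lt continuous_const continuous_snd).mem_nhds
          (show (z, r) ∈ {q : Euc d × ℝ | 0 < q.2} from hr)] with q hq
        exact heatKernel_of_pos (z := q.1) (r := q.2) hq
      refine ContDiffAt.congr_of_eventuallyEq ?_ this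
      refine ContDiffAt.mul (ContDiffAt.rpow_const_of_ne (by fun_prop) (by positivity)) ?_
      refine ContDiffAt.exp (ContDiffAt.div ?_ (by fun_prop) (by positivity))
      exact ((contDiff_norm_sq ℝ).comp contDiff_fst).neg.contDiffAt
  · have hz' : 0 < ‖z‖ := norm_pos_iff.2 hz
    have : heatKernel (d := d) =ᶠ[𝓝 (z, r)] fun q => (π * ‖q.1‖ ^ 2) ^ (-(d : ℝ) / 2) *
      ((fun x : ℝ => x ^ (-(d : ℝ) / 2) * expNegInvGlue x) (2 * q.2 / ‖q.1‖ ^ 2)) := by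
      filter_upwards [(isOpen_ne_fun continuous_fst continuous_const).mem_nhds
          (show (z, r) ∈ {q : Euc d × ℝ | q.1 ≠ 0} from hz)] with q hq
      exact heatKernel_eq_glue (z := q.1) hq q.2
    refine ContDiffAt.congr_of_eventuallyEq ?_ this
    have hn : ContDiffAt ℝ n (fun q : Euc d × ℝ => ‖q.1‖ ^ 2) (z, r) :=
      ((contDiff_norm_sq ℝ).comp contDiff_fst).contDiffAt
    refine ContDiffAt.mul (ContDiffAt.rpow_const_of_ne (contDiffAt_const.mul hn)
      (by positivity)) ?_
    exact ((contDiff_rpow_mul_expNegInvGlue _ n).contDiffAt).comp (z, r)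
      (ContDiffAt.div (by fun_prop) hn (by positivity))

lemma hasFDerivAt_heatKernel_space {d : ℕ} (z : Euc d) {r : ℝ} (hr : 0 < r) :
    HasFDerivAt (fun z : Euc d => heatKernel (z, r))
      ((-(heatKernel (z, r) / r)) • innerSL ℝ z) z := by
  have h1 : (fun z : Euc d => heatKernel (z, r)) =
      fun z => (2 * π * r) ^ (-(d : ℝ) / 2) * exp (-‖z‖ ^ 2 / (2 * r)) :=
    funext fun z => heatKernel_of_pos hr
  rw [h1, heatKernel_of_pos hr]
  have h0 : HasFDerivAt (fun z : Euc d => -‖z‖ ^ 2 / (2 * r))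
      ((2 * r)⁻¹ • -((2 : ℕ) • (innerSL ℝ z : Euc d →L[ℝ] ℝ))) z := by
    have := ((hasStrictFDerivAt_norm_sq z).hasFDerivAt.neg).const_mul (2 * r)⁻¹
    refine this.congr_of_eventuallyEq (Eventually.of_forall fun y => ?_)
    simp [div_eq_inv_mul]
  have h2 := h0.exp.const_mul ((2 * π * r) ^ (-(d : ℝ) / 2))
  refine h2.congr_fderiv ?_
  ext v
  simp only [smul_apply, neg_apply, smul_eq_mul, nsmul_eq_mul,
    innerSL_apply_apply]
  push_cast
  field_simp

lemma pd_eq_of_hasFDerivAt {d : ℕ} {i : Fin d} {f : Euc d → ℝ} {x : Euc d}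
    {f' : Euc d →L[ℝ] ℝ} (h : HasFDerivAt f f' x) :
    pd i f x = f' (EuclideanSpace.single i 1) := by
  rw [pd, h.fderiv]

lemma pd_heatKernel {d : ℕ} (i : Fin d) {r : ℝ} (hr : 0 < r) :
    pd i (fun z : Euc d => heatKernel (z, r)) = fun z => -(z i / r) * heatKernel (z, r) := by
  funext z
  rw [pd_eq_of_hasFDerivAt (hasFDerivAt_heatKernel_space z hr)]
  simp [EuclideanSpace.inner_single_right]
  ring

lemma pd_pd_heatKernel {d : ℕ} (i j : Fin d) {r : ℝ} (hr : 0 < r) (z : Euc d) :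
    pd j (pd i (fun z : Euc d => heatKernel (z, r))) z =
      (z i * z j / r ^ 2 - (if i = j then 1 else 0) / r) * heatKernel (z, r) := by
  rw [pd_heatKernel i hr]
  have h1 : HasFDerivAt (fun z : Euc d => -(z i / r))
      (-((r⁻¹) • (EuclideanSpace.proj i : Euc d →L[ℝ] ℝ))) z := by
    have := (((EuclideanSpace.proj i : Euc d →L[ℝ] ℝ).hasFDerivAt (x := z)).const_mul r⁻¹).neg
    refine this.congr_of_eventuallyEq (Eventually.of_forall fun y => ?_)
    simp [div_eq_inv_mul]
  have h2 : HasFDerivAt (fun z : Euc d => -(z i / r) * heatKernel (z, r)) _ z :=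
    h1.mul (hasFDerivAt_heatKernel_space z hr)
  rw [pd_eq_of_hasFDerivAt h2]
  simp only [add_apply, smul_apply, neg_apply, smul_eq_mul, innerSL_apply_apply,
    EuclideanSpace.inner_single_right]
  split_ifs with hij <;> simp [hij] <;> field_simp
  ring

lemma hasDerivAt_heatKernel_time {d : ℕ} (z : Euc d) {r : ℝ} (hr : 0 < r) :
    HasDerivAt (fun s => heatKernel (z, s))
      ((‖z‖ ^ 2 / (2 * r ^ 2) - d / (2 * r)) * heatKernel (z, r)) r := by
  have h1 : (fun s => heatKernel (z, s)) =ᶠ[𝓝 r]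
      fun s => (2 * π * s) ^ (-(d : ℝ) / 2) * exp (-‖z‖ ^ 2 / (2 * s)) := by
    filter_upwards [lt_mem_nhds hr] with s hs using heatKernel_of_pos hs
  refine HasDerivAt.congr_of_eventuallyEq ?_ h1
  have h2 : HasDerivAt (fun s : ℝ => 2 * π * s) (2 * π) r := by
    simpa using (hasDerivAt_id r).const_mul (2 * π)
  have h3 := h2.rpow_const (p := -(d : ℝ) / 2) (Or.inl (by positivity))
  have h4 : HasDerivAt (fun s : ℝ => -‖z‖ ^ 2 / (2 * s)) (‖z‖ ^ 2 / (2 * r ^ 2)) r := by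
    have h5 : HasDerivAt (fun s : ℝ => 2 * s) 2 r := by
      simpa using (hasDerivAt_id r).const_mul 2
    have := (hasDerivAt_const r (-‖z‖ ^ 2)).div h5 (by positivity)
    refine this.congr_deriv ?_
    field_simp
    ring
  refine (h3.mul h4.exp).congr_deriv ?_
  rw [heatKernel_of_pos hr, rpow_sub_one (by positivity)]
  field_simp
  ring

lemma sum_pd_pd_heatKernel {d : ℕ} {r : ℝ} (hr : 0 < r) (z : Euc d) :
    ∑ i, pd i (pd i (fun z : Euc d => heatKernel (z, r))) z =
      (‖z‖ ^ 2 / r ^ 2 - d / r) * heatKernel (z, r) := by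
  simp only [pd_pd_heatKernel _ _ hr, if_true]
  rw [← Finset.sum_mul, Finset.sum_sub_distrib, EuclideanSpace.norm_sq_eq]
  simp only [Finset.sum_const, Finset.card_univ, Fintype.card_fin, Finset.sum_div]
  simp [pow_two, div_eq_mul_inv]

/-- The heat operator `∂ₜ - Δ/2` on space-time functions. -/
noncomputable def heatOp {d : ℕ} (S : Euc d × ℝ → ℝ) (q : Euc d × ℝ) : ℝ :=
  deriv (fun s => S (q.1, s)) q.2 - 1 / 2 * ∑ i, pd i (pd i (fun y => S (y, q.2))) q.1

lemma heatOp_heatKernel_of_pos {d : ℕ} {r : ℝ} (hr : 0 < r) (z : Euc d) :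
    heatOp heatKernel (z, r) = 0 := by
  simp only [heatOp]
  rw [sum_pd_pd_heatKernel hr, (hasDerivAt_heatKernel_time z hr).deriv]
  field_simp
  ring

lemma integral_heatKernel {d : ℕ} {r : ℝ} (hr : 0 < r) :
    ∫ z : Euc d, heatKernel (z, r) = 1 := by
  simp only [heatKernel_of_pos hr]
  rw [integral_const_mul]
  have h := GaussianFourier.integral_rexp_neg_mul_sq_norm (V := Euc d) (b := 1 / (2 * r))
    (by positivity)
  have h' : ∀ z : Euc d, -‖z‖ ^ 2 / (2 * r) = -(1 / (2 * r)) * ‖z‖ ^ 2 := fun z => by ring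
  simp only [h', h, finrank_euclideanSpace, Fintype.card_fin]
  rw [show π / (1 / (2 * r)) = 2 * π * r by field_simp, ← rpow_add (by positivity)]
  rw [show -(d : ℝ) / 2 + d / 2 = 0 by ring, rpow_zero]

lemma integrable_heatKernel {d : ℕ} {r : ℝ} (hr : 0 < r) :
    Integrable (fun z : Euc d => heatKernel (z, r)) := by
  by_contra h
  have := integral_heatKernel (d := d) hr
  rw [integral_undef h] at this
  exact zero_ne_one this

lemma measurable_heatKernel {d : ℕ} : Measurable (heatKernel (d := d)) := by
  unfold heatKernel
  refine Measurable.ite (measurableSet_lt measurable_const measurable_snd) ?_ measurable_const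
  fun_prop

lemma rpow_le_mul_exp (a : ℝ) (ha : 0 ≤ a) :
    ∃ C : ℝ, 0 ≤ C ∧ ∀ y : ℝ, 0 ≤ y → y ^ a ≤ C * exp (y ^ 2 / 4) := by
  obtain ⟨N, hN⟩ := exists_nat_ge a
  refine ⟨1 + 4 ^ N * N.factorial, by positivity, fun y hy => ?_⟩
  have h1 : y ^ a ≤ 1 + (y ^ 2) ^ N := by
    rcases le_or_gt y 1 with h | h
    · have := rpow_le_one hy h ha
      have : 0 ≤ (y ^ 2) ^ N := by positivity
      linarith
    · have h2 : y ^ a ≤ y ^ ((2 * N : ℕ) : ℝ) :=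
        rpow_le_rpow_of_exponent_le h.le (by push_cast; linarith [Nat.cast_nonneg (α := ℝ) N])
      rw [rpow_natCast, pow_mul] at h2
      linarith
  have h3 := Real.pow_div_factorial_le_exp (y ^ 2 / 4) (by positivity) N
  rw [div_pow, div_div, div_le_iff₀ (by positivity)] at h3
  have h4 : 1 ≤ exp (y ^ 2 / 4) := one_le_exp (by positivity)
  linarith

lemma norm_rpow_mul_heatKernel_le {d : ℕ} (a : ℝ) (ha : 0 ≤ a) :
    ∃ C : ℝ, 0 ≤ C ∧ ∀ (z : Euc d) (r : ℝ), 0 < r →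
      ‖z‖ ^ a * heatKernel (z, r) ≤ C * (r ^ (a / 2) * heatKernel (z, 2 * r)) := by
  obtain ⟨C, hC, h⟩ := rpow_le_mul_exp a ha
  refine ⟨C * (2 : ℝ) ^ ((d : ℝ) / 2), by positivity, fun z r hr => ?_⟩
  have h1 := h (‖z‖ / √r) (by positivity)
  rw [div_rpow (by positivity) (by positivity), div_le_iff₀ (by positivity), div_pow,
    sq_sqrt hr.le, sqrt_eq_rpow, ← rpow_mul hr.le] at h1
  have h2 : heatKernel (z, r) = (2 : ℝ) ^ ((d : ℝ) / 2) * exp (-(‖z‖ ^ 2 / r / 4)) *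
      heatKernel (z, 2 * r) := by
    rw [heatKernel_of_pos hr, heatKernel_of_pos (by positivity : 0 < 2 * r)]
    rw [show 2 * π * (2 * r) = 2 * (2 * π * r) by ring,
      mul_rpow (x := 2) (by positivity) (by positivity)]
    have e1 : exp (-‖z‖ ^ 2 / (2 * r)) =
        exp (-(‖z‖ ^ 2 / r / 4)) * exp (-‖z‖ ^ 2 / (2 * (2 * r))) := by
      rw [← exp_add]
      congr 1
      field_simp
      ring
    have e2 : (2 : ℝ) ^ ((d : ℝ) / 2) * 2 ^ (-(d : ℝ) / 2) = 1 := by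
      rw [← rpow_add (by norm_num), show (d : ℝ) / 2 + -d / 2 = 0 by ring, rpow_zero]
    rw [e1]
    linear_combination (-(2 * π * r) ^ (-(d : ℝ) / 2) * (exp (-(‖z‖ ^ 2 / r / 4)) *
      exp (-‖z‖ ^ 2 / (2 * (2 * r))))) * e2
  have h3 : ‖z‖ ^ a * exp (-(‖z‖ ^ 2 / r / 4)) ≤ C * r ^ (a / 2) := by
    calc ‖z‖ ^ a * exp (-(‖z‖ ^ 2 / r / 4))
        ≤ C * exp (‖z‖ ^ 2 / r / 4) * r ^ (1 / 2 * a) * exp (-(‖z‖ ^ 2 / r / 4)) := by gcongr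
      _ = C * r ^ (1 / 2 * a) * (exp (‖z‖ ^ 2 / r / 4) * exp (-(‖z‖ ^ 2 / r / 4))) := by ring
      _ = C * r ^ (a / 2) := by
          rw [← exp_add, add_neg_cancel, exp_zero, mul_one]
          congr 2
          ring
  have h4 := heatKernel_nonneg (z, 2 * r)
  calc ‖z‖ ^ a * heatKernel (z, r)
      = (2 : ℝ) ^ ((d : ℝ) / 2) * heatKernel (z, 2 * r) *
        (‖z‖ ^ a * exp (-(‖z‖ ^ 2 / r / 4))) := by rw [h2]; ring
    _ ≤ (2 : ℝ) ^ ((d : ℝ) / 2) * heatKernel (z, 2 * r) * (C * r ^ (a / 2)) := by gcongr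
    _ = _ := by ring

/-- The dominating functions `r ^ (-γ) p_{2r}(z)` on bounded time intervals. -/
noncomputable def gaussDom {d : ℕ} (γ T : ℝ) (q : Euc d × ℝ) : ℝ :=
  (Ioo 0 T).indicator (fun r => r ^ (-γ)) q.2 * heatKernel (q.1, 2 * q.2)

lemma gaussDom_nonneg {d : ℕ} (γ T : ℝ) (q : Euc d × ℝ) : 0 ≤ gaussDom γ T q := by
  refine mul_nonneg (indicator_nonneg (fun r hr => rpow_nonneg hr.1.le _) _) (heatKernel_nonneg _)

lemma integrable_gaussDom {d : ℕ} {γ : ℝ} (hγ : γ < 1) (T : ℝ) :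
    Integrable (gaussDom (d := d) γ T) := by
  have hm : Measurable (gaussDom (d := d) γ T) := by
    unfold gaussDom
    refine Measurable.mul ?_ ?_
    · exact (Measurable.indicator (by fun_prop) measurableSet_Ioo).comp measurable_snd
    · exact measurable_heatKernel.comp (by fun_prop)
  rw [Measure.volume_eq_prod, integrable_prod_iff' hm.aestronglyMeasurable]
  constructor
  · refine Eventually.of_forall fun r => ?_
    simp only [gaussDom]
    refine Integrable.const_mul ?_ _
    rcases le_or_gt r 0 with hr | hr
    · simp [heatKernel_of_nonpos (show 2 * r ≤ 0 by linarith)]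
    · exact integrable_heatKernel (by linarith)
  · have h1 : (fun r => ∫ z : Euc d, ‖gaussDom γ T (z, r)‖) =
        (Ioo 0 T).indicator (fun r => r ^ (-γ)) := by
      funext r
      simp_rw [Real.norm_of_nonneg (gaussDom_nonneg _ _ _)]
      simp only [gaussDom]
      rw [integral_const_mul]
      by_cases hr : r ∈ Ioo 0 T
      · rw [integral_heatKernel (by linarith [hr.1]), mul_one]
      · simp [hr]
    rw [h1, integrable_indicator_iff measurableSet_Ioo]
    rcases le_or_gt T 0 with hT | hT
    · simp [Ioo_eq_empty (not_lt.2 hT)]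
    · have := intervalIntegral.intervalIntegrable_rpow' (a := 0) (b := T) (r := -γ) (by linarith)
      rw [intervalIntegrable_iff_integrableOn_Ioo_of_le hT.le] at this
      exact this

instance isAddHaarMeasure_spaceTime (d : ℕ) :
    (volume : Measure (Euc d × ℝ)).IsAddHaarMeasure :=
  inferInstanceAs ((volume : Measure (Euc d)).prod (volume : Measure ℝ)).IsAddHaarMeasure

/-- Convolution over space-time of a kernel with a function. -/
noncomputable def cv {d : ℕ} (K f : Euc d × ℝ → ℝ) (q : Euc d × ℝ) : ℝ :=
  ∫ y, K y * f (q - y)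

lemma integrable_mul_comp_sub {d : ℕ} {K f : Euc d × ℝ → ℝ} {B : ℝ} (hK : Integrable K)
    (hf : Measurable f) (hB : ∀ y, |f y| ≤ B) (q : Euc d × ℝ) :
    Integrable fun y => K y * f (q - y) := by
  refine hK.mul_bdd (c := B) ?_ (Eventually.of_forall fun y => hB _)
  exact (hf.comp (measurable_const.sub measurable_id)).aestronglyMeasurable

lemma abs_cv_le {d : ℕ} {K f : Euc d × ℝ → ℝ} {B : ℝ} (hK : Integrable K)
    (hB : ∀ y, |f y| ≤ B) (q : Euc d × ℝ) :
    |cv K f q| ≤ B * ∫ y, |K y| := by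
  rw [mul_comm, ← integral_mul_const, ← Real.norm_eq_abs, cv]
  refine norm_integral_le_of_norm_le (hK.abs.mul_const B) (Eventually.of_forall fun y => ?_)
  rw [norm_mul]
  exact mul_le_mul_of_nonneg_left (hB _) (abs_nonneg _)

lemma cv_sub_left {d : ℕ} {K L f : Euc d × ℝ → ℝ} {B : ℝ} (hK : Integrable K)
    (hL : Integrable L) (hf : Measurable f) (hB : ∀ y, |f y| ≤ B) (q : Euc d × ℝ) :
    cv (fun y => K y - L y) f q = cv K f q - cv L f q := by
  simp only [cv, sub_mul]
  exact integral_sub (integrable_mul_comp_sub hK hf hB q) (integrable_mul_comp_sub hL hf hB q)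

lemma cv_const_mul {d : ℕ} (a : ℝ) (K f : Euc d × ℝ → ℝ) (q : Euc d × ℝ) :
    cv (fun y => a * K y) f q = a * cv K f q := by
  simp only [cv, mul_assoc]
  exact integral_const_mul _ _

lemma cv_eq_integral_sub {d : ℕ} (K f : Euc d × ℝ → ℝ) (q : Euc d × ℝ) :
    cv K f q = ∫ y, K (q - y) * f y := by
  rw [cv, ← integral_sub_left_eq_self _ volume q]
  simp

lemma exists_integral_translate_lt {d : ℕ} {K : Euc d × ℝ → ℝ} (hK : Integrable K) {ε : ℝ}
    (hε : 0 < ε) : ∃ δ > 0, ∀ q q' : Euc d × ℝ, dist q q' < δ →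
      ∫ y, |K (q - y) - K (q' - y)| < ε := by
  obtain ⟨g, hgc, hg, hgcont, hgi⟩ :=
    hK.exists_hasCompactSupport_integral_sub_le (ε := ε / 4) (by positivity)
  obtain ⟨ρ, hρ⟩ := hgc.isCompact.isBounded.subset_closedBall 0
  set V : ℝ := (volume (Metric.closedBall (0 : Euc d × ℝ) (|ρ| + 1))).toReal with hV
  have hV0 : 0 ≤ V := ENNReal.toReal_nonneg
  have huc := hgc.uniformContinuous_of_continuous hgcont
  rw [Metric.uniformContinuous_iff] at huc
  obtain ⟨δ, hδ, hδ'⟩ := huc (ε / (4 * (V + 1))) (by positivity)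
  refine ⟨min δ 1, by positivity, fun q q' hqq => ?_⟩
  have hI : ∀ h : Euc d × ℝ → ℝ, Integrable h → ∀ q, Integrable fun y => h (q - y) :=
    fun h hh q => hh.comp_sub_left q
  have h1 : ∫ y, |K (q - y) - g (q - y)| ≤ ε / 4 := by
    rw [integral_sub_left_eq_self (fun y => |K y - g y|) volume q]; exact hg
  have h2 : ∫ y, |K (q' - y) - g (q' - y)| ≤ ε / 4 := by
    rw [integral_sub_left_eq_self (fun y => |K y - g y|) volume q']; exact hg
  have h3 : ∫ y, |g (q - y) - g (q' - y)| ≤ ε / 4 := by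
    have e : ∫ y, |g (q - y) - g (q' - y)| = ∫ y, |g y - g (y + (q' - q))| := by
      rw [← integral_sub_left_eq_self (fun y => |g y - g (y + (q' - q))|) volume q]
      congr 1; funext y; congr 3; abel
    rw [e]
    have hb : ∀ y, |g y - g (y + (q' - q))| ≤
        (Metric.closedBall (0 : Euc d × ℝ) (|ρ| + 1)).indicator
          (fun _ => ε / (4 * (V + 1))) y := by
      intro y
      by_cases hy : y ∈ Metric.closedBall (0 : Euc d × ℝ) (|ρ| + 1)
      · rw [indicator_of_mem hy]
        refine le_of_lt (hδ' ?_)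
        rw [dist_eq_norm] at hqq ⊢
        rw [show y - (y + (q' - q)) = q - q' by abel]
        exact hqq.trans_le (min_le_left _ _)
      · rw [indicator_of_notMem hy]
        have hy1 : |ρ| + 1 < ‖y‖ := by simpa using hy
        have hz : ∀ z, |ρ| < ‖z‖ → g z = 0 := fun z hz => by
          refine image_eq_zero_of_notMem_tsupport fun hm => ?_
          have := hρ hm
          rw [mem_closedBall_zero_iff] at this
          linarith [le_abs_self ρ]
        rw [hz y (by linarith), hz (y + (q' - q))]
        · simp
        · have : ‖y‖ ≤ ‖y + (q' - q)‖ + ‖q - q'‖ := by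
            have := norm_add_le (y + (q' - q)) (q - q')
            rwa [show y + (q' - q) + (q - q') = y by abel] at this
          rw [dist_eq_norm] at hqq
          linarith [hqq.trans_le (min_le_right δ 1)]
    calc _ ≤ ∫ y, (Metric.closedBall (0 : Euc d × ℝ) (|ρ| + 1)).indicator
          (fun _ => ε / (4 * (V + 1))) y := by
          refine integral_mono_of_nonneg (Eventually.of_forall fun y => abs_nonneg _) ?_
            (Eventually.of_forall hb)
          exact (integrable_indicator_iff Metric.isClosed_closedBall.measurableSet).2
            (integrableOn_const (measure_closedBall_lt_top.ne))
      _ = V * (ε / (4 * (V + 1))) := by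
          rw [integral_indicator Metric.isClosed_closedBall.measurableSet, setIntegral_const]
          rfl
      _ ≤ ε / 4 := by
          rw [mul_div_assoc', div_le_div_iff₀ (by positivity) (by positivity)]
          nlinarith
  have hKg : ∀ q, Integrable fun y => |K (q - y) - g (q - y)| := fun q =>
    ((hI K hK q).sub (hI g hgi q)).abs
  have hgg : Integrable fun y => |g (q - y) - g (q' - y)| :=
    ((hI g hgi q).sub (hI g hgi q')).abs
  calc ∫ y, |K (q - y) - K (q' - y)|
      ≤ ∫ y, (|K (q - y) - g (q - y)| + |g (q - y) - g (q' - y)| +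
          |K (q' - y) - g (q' - y)|) := by
        refine integral_mono_of_nonneg (Eventually.of_forall fun y => abs_nonneg _)
          (((hKg q).add hgg).add (hKg q')) (Eventually.of_forall fun y => ?_)
        have := abs_sub_le (K (q - y)) (g (q - y)) (K (q' - y))
        have h' := abs_sub_le (g (q - y)) (g (q' - y)) (K (q' - y))
        rw [abs_sub_comm (g (q' - y))] at h'
        simp only
        linarith
    _ = _ + _ + _ := by
        have e1 := integral_add ((hKg q).add hgg) (hKg q')
        have e2 := integral_add (hKg q) hgg
        simp only [Pi.add_apply] at e1
        rw [e1, e2]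
    _ < ε := by linarith

/-- Convolutions of a fixed integrable kernel with uniformly bounded functions are
uniformly equicontinuous. -/
lemma exists_abs_cv_sub_lt {d : ℕ} {K : Euc d × ℝ → ℝ} (hK : Integrable K) (B : ℝ) {ε : ℝ}
    (hε : 0 < ε) : ∃ δ > 0, ∀ f : Euc d × ℝ → ℝ, Measurable f → (∀ y, |f y| ≤ B) →
      ∀ q q' : Euc d × ℝ, dist q q' < δ → |cv K f q - cv K f q'| < ε := by
  obtain ⟨δ, hδ, h⟩ := exists_integral_translate_lt hK (ε := ε / (|B| + 1)) (by positivity)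
  refine ⟨δ, hδ, fun f hf hB q q' hqq => ?_⟩
  have hI : ∀ q, Integrable fun y => K (q - y) * f y := fun q =>
    (hK.comp_sub_left q).mul_bdd hf.aestronglyMeasurable (Eventually.of_forall hB)
  rw [cv_eq_integral_sub, cv_eq_integral_sub, ← integral_sub (hI q) (hI q')]
  have hi := ((hK.comp_sub_left q).sub (hK.comp_sub_left q')).abs
  calc |∫ y, (K (q - y) * f y - K (q' - y) * f y)|
      ≤ ∫ y, |K (q - y) - K (q' - y)| * (|B| + 1) := by
        rw [← Real.norm_eq_abs]
        refine norm_integral_le_of_norm_le (hi.mul_const _) (Eventually.of_forall fun y => ?_)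
        rw [← sub_mul, norm_mul]
        refine mul_le_mul_of_nonneg_left ?_ (abs_nonneg _)
        exact (hB y).trans (by linarith [le_abs_self B])
    _ = (∫ y, |K (q - y) - K (q' - y)|) * (|B| + 1) := integral_mul_const _ _
    _ < ε := by
        have := h q q' hqq
        rwa [lt_div_iff₀ (by positivity)] at this

lemma continuous_cv {d : ℕ} {K f : Euc d × ℝ → ℝ} {B : ℝ} (hK : Integrable K)
    (hf : Measurable f) (hB : ∀ y, |f y| ≤ B) : Continuous (cv K f) := by
  rw [Metric.continuous_iff]
  intro q ε hε
  obtain ⟨δ, hδ, h⟩ := exists_abs_cv_sub_lt hK B hε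
  exact ⟨δ, hδ, fun q' hq' => h f hf hB q' q hq'⟩

lemma locallyIntegrable_of_bdd {d : ℕ} {f : Euc d × ℝ → ℝ} {B : ℝ} (hf : Measurable f)
    (hB : ∀ y, |f y| ≤ B) : LocallyIntegrable f := by
  intro x
  refine ⟨Metric.closedBall x 1, Metric.closedBall_mem_nhds x one_pos, ?_⟩
  refine Measure.integrableOn_of_bounded (M := B) measure_closedBall_lt_top.ne
    hf.aestronglyMeasurable (Eventually.of_forall hB)

lemma cv_eq_convolution {d : ℕ} (K f : Euc d × ℝ → ℝ) :
    cv K f = K ⋆[ContinuousLinearMap.mul ℝ ℝ, volume] f := by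
  funext q; simp [cv, convolution]

lemma contDiff_cv {d : ℕ} {K f : Euc d × ℝ → ℝ} {B : ℝ} {n : ℕ∞} (hK : ContDiff ℝ n K)
    (hKc : HasCompactSupport K) (hf : Measurable f) (hB : ∀ y, |f y| ≤ B) :
    ContDiff ℝ n (cv K f) := by
  rw [cv_eq_convolution]
  exact hKc.contDiff_convolution_left _ hK (locallyIntegrable_of_bdd hf hB)

lemma fderiv_cv_apply {d : ℕ} {K f : Euc d × ℝ → ℝ} {B : ℝ} (hK : ContDiff ℝ 1 K)
    (hKc : HasCompactSupport K) (hf : Measurable f) (hB : ∀ y, |f y| ≤ B) (e q : Euc d × ℝ) :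
    fderiv ℝ (cv K f) q e = cv (fun y => fderiv ℝ K y e) f q := by
  have h := hKc.hasFDerivAt_convolution_left (ContinuousLinearMap.mul ℝ ℝ) hK
    (locallyIntegrable_of_bdd hf hB) q
  rw [cv_eq_convolution, h.fderiv, convolution]
  have hc : Continuous (fderiv ℝ K) := hK.continuous_fderiv one_ne_zero
  have hi : Integrable (fderiv ℝ K) := hc.integrable_of_hasCompactSupport (hKc.fderiv ℝ)
  have hi2 : Integrable fun t => (f (q - t)) • fderiv ℝ K t := by
    refine hi.bdd_smul (φ := fun t => f (q - t)) B ?_ (Eventually.of_forall fun y => hB _)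
    exact (hf.comp (measurable_const.sub measurable_id)).aestronglyMeasurable
  have e1 : (fun t => ((ContinuousLinearMap.precompL (Euc d × ℝ) (ContinuousLinearMap.mul ℝ ℝ))
      (fderiv ℝ K t)) (f (q - t))) = fun t => (f (q - t)) • fderiv ℝ K t := by
    funext t; ext v <;> simp [mul_comm]
  rw [e1, ContinuousLinearMap.integral_apply hi2, cv]
  simp [mul_comm]

/-- The `i`-th space direction in space-time. -/
noncomputable def spaceVec {d : ℕ} (i : Fin d) : Euc d × ℝ := (EuclideanSpace.single i 1, 0)

/-- The time direction in space-time. -/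
def timeVec {d : ℕ} : Euc d × ℝ := (0, 1)

lemma hasFDerivAt_space_slice {d : ℕ} {S : Euc d × ℝ → ℝ} {q : Euc d × ℝ}
    (h : DifferentiableAt ℝ S q) :
    HasFDerivAt (fun y => S (y, q.2))
      ((fderiv ℝ S q).comp (ContinuousLinearMap.inl ℝ (Euc d) ℝ)) q.1 :=
  HasFDerivAt.comp (g := S) q.1 h.hasFDerivAt (hasFDerivAt_prodMk_left q.1 q.2)

lemma pd_space_slice {d : ℕ} {S : Euc d × ℝ → ℝ} {q : Euc d × ℝ}
    (h : DifferentiableAt ℝ S q) (i : Fin d) :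
    pd i (fun y => S (y, q.2)) q.1 = fderiv ℝ S q (spaceVec i) := by
  rw [pd_eq_of_hasFDerivAt (hasFDerivAt_space_slice h)]
  rfl

lemma hasDerivAt_time_slice {d : ℕ} {S : Euc d × ℝ → ℝ} {q : Euc d × ℝ}
    (h : DifferentiableAt ℝ S q) :
    HasDerivAt (fun s => S (q.1, s)) (fderiv ℝ S q timeVec) q.2 := by
  have := (HasFDerivAt.comp (g := S) q.2 h.hasFDerivAt
    (hasFDerivAt_prodMk_right q.1 q.2)).hasDerivAt
  exact this.congr_deriv (by simp [timeVec])

lemma Filter.Eventually.space_slice {d : ℕ} {P : Euc d × ℝ → Prop} {q : Euc d × ℝ}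
    (h : ∀ᶠ y in 𝓝 q, P y) : ∀ᶠ y in 𝓝 q.1, P (y, q.2) :=
  (Continuous.tendsto (f := fun y : Euc d => (y, q.2)) (by fun_prop) q.1).eventually h

lemma Filter.Eventually.time_slice {d : ℕ} {P : Euc d × ℝ → Prop} {q : Euc d × ℝ}
    (h : ∀ᶠ y in 𝓝 q, P y) : ∀ᶠ s in 𝓝 q.2, P (q.1, s) :=
  (Continuous.tendsto (f := fun s : ℝ => (q.1, s)) (by fun_prop) q.2).eventually h

lemma pd_congr {d : ℕ} {f g : Euc d → ℝ} {x : Euc d} (h : f =ᶠ[𝓝 x] g) (i : Fin d) :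
    pd i f x = pd i g x := by
  simp only [pd, h.fderiv_eq]

lemma pd_eventuallyEq {d : ℕ} {f g : Euc d → ℝ} {x : Euc d} (h : f =ᶠ[𝓝 x] g) (i : Fin d) :
    pd i f =ᶠ[𝓝 x] pd i g :=
  h.eventuallyEq_nhds.mono fun _ hy => pd_congr hy i

lemma pd_const_mul {d : ℕ} (a : ℝ) (f : Euc d → ℝ) (i : Fin d) :
    pd i (fun y => a * f y) = fun y => a * pd i f y := by
  funext x
  have : (fun y => a * f y) = a • f := rfl
  simp only [pd, this, fderiv_const_smul_field, Pi.smul_apply, smul_apply, smul_eq_mul]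

lemma pd_sub {d : ℕ} {f g : Euc d → ℝ} {x : Euc d} (hf : DifferentiableAt ℝ f x)
    (hg : DifferentiableAt ℝ g x) (i : Fin d) :
    pd i (fun y => f y - g y) x = pd i f x - pd i g x := by
  rw [pd_eq_of_hasFDerivAt (hf.hasFDerivAt.fun_sub hg.hasFDerivAt)]
  simp [pd]

lemma contDiffAt_pd {d : ℕ} {f : Euc d → ℝ} {x : Euc d} {n : ℕ} (hf : ContDiffAt ℝ (n + 1) f x)
    (i : Fin d) : ContDiffAt ℝ n (pd i f) x := by
  have h : ContDiffAt ℝ n (fderiv ℝ f) x := hf.fderiv_right le_rfl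
  exact h.clm_apply contDiffAt_const

lemma pd_pd_sub {d : ℕ} {f g : Euc d → ℝ} {x : Euc d} (hf : ContDiffAt ℝ 2 f x)
    (hg : ContDiffAt ℝ 2 g x) (i j : Fin d) :
    pd j (pd i (fun y => f y - g y)) x = pd j (pd i f) x - pd j (pd i g) x := by
  have h : pd i (fun y => f y - g y) =ᶠ[𝓝 x] fun y => pd i f y - pd i g y := by
    filter_upwards [hf.eventually (by simp), hg.eventually (by simp)] with y h1 h2
    exact pd_sub (h1.differentiableAt (by simp)) (h2.differentiableAt (by simp)) i
  rw [pd_congr h]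
  refine pd_sub ?_ ?_ j
  · exact (contDiffAt_pd (n := 1) (by exact_mod_cast hf) i).differentiableAt (by simp)
  · exact (contDiffAt_pd (n := 1) (by exact_mod_cast hg) i).differentiableAt (by simp)

lemma pd_pd_space_slice {d : ℕ} {S : Euc d × ℝ → ℝ} {q : Euc d × ℝ}
    (h : ContDiffAt ℝ 2 S q) (i j : Fin d) :
    pd j (pd i (fun y => S (y, q.2))) q.1 =
      fderiv ℝ (fun y => fderiv ℝ S y (spaceVec i)) q (spaceVec j) := by
  have h1 : pd i (fun y => S (y, q.2)) =ᶠ[𝓝 q.1]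
      fun y => fderiv ℝ S (y, q.2) (spaceVec i) := by
    filter_upwards [(h.eventually (by simp)).space_slice] with y hy
    exact pd_space_slice (q := (y, q.2)) (hy.differentiableAt (by simp)) i
  rw [pd_congr h1]
  refine pd_space_slice (S := fun y => fderiv ℝ S y (spaceVec i)) ?_ j
  have h2 : ContDiffAt ℝ 1 (fderiv ℝ S) q := h.fderiv_right (by norm_num)
  exact (h2.clm_apply contDiffAt_const).differentiableAt (by simp)

lemma heatOp_eq {d : ℕ} {S : Euc d × ℝ → ℝ} {q : Euc d × ℝ} (h : ContDiffAt ℝ 2 S q) :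
    heatOp S q = fderiv ℝ S q timeVec -
      1 / 2 * ∑ i, fderiv ℝ (fun y => fderiv ℝ S y (spaceVec i)) q (spaceVec i) := by
  rw [heatOp, (hasDerivAt_time_slice (h.differentiableAt (by simp))).deriv]
  simp only [pd_pd_space_slice h]

lemma heatOp_congr {d : ℕ} {S T : Euc d × ℝ → ℝ} {q : Euc d × ℝ} (h : S =ᶠ[𝓝 q] T) :
    heatOp S q = heatOp T q := by
  have h1 : (fun s => S (q.1, s)) =ᶠ[𝓝 q.2] fun s => T (q.1, s) := h.time_slice
  have h2 : (fun y => S (y, q.2)) =ᶠ[𝓝 q.1] fun y => T (y, q.2) := h.space_slice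
  simp only [heatOp, h1.deriv_eq, pd_congr (pd_eventuallyEq h2 _)]

lemma heatOp_zero {d : ℕ} (q : Euc d × ℝ) : heatOp (fun _ : Euc d × ℝ => (0 : ℝ)) q = 0 := by
  have : ∀ i, pd i (fun _ : Euc d => (0 : ℝ)) = fun _ => 0 := fun i => by
    funext x; simp [pd]
  simp [heatOp, this]

lemma contDiffAt_space_slice {d : ℕ} {S : Euc d × ℝ → ℝ} {q : Euc d × ℝ} {n : WithTop ℕ∞}
    (h : ContDiffAt ℝ n S q) : ContDiffAt ℝ n (fun y => S (y, q.2)) q.1 :=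
  ContDiffAt.comp (g := S) q.1 h (contDiffAt_id.prodMk contDiffAt_const)

lemma contDiffAt_time_slice {d : ℕ} {S : Euc d × ℝ → ℝ} {q : Euc d × ℝ} {n : WithTop ℕ∞}
    (h : ContDiffAt ℝ n S q) : ContDiffAt ℝ n (fun s => S (q.1, s)) q.2 :=
  ContDiffAt.comp (g := S) q.2 h (contDiffAt_const.prodMk contDiffAt_id)

lemma heatOp_sub {d : ℕ} {S T : Euc d × ℝ → ℝ} {q : Euc d × ℝ} (hS : ContDiffAt ℝ 2 S q)
    (hT : ContDiffAt ℝ 2 T q) : heatOp (fun y => S y - T y) q = heatOp S q - heatOp T q := by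
  have h1 := (hasDerivAt_time_slice (hS.differentiableAt (by simp)))
  have h2 := (hasDerivAt_time_slice (hT.differentiableAt (by simp)))
  simp only [heatOp, (h1.fun_sub h2).deriv, h1.deriv, h2.deriv,
    pd_pd_sub (contDiffAt_space_slice hS) (contDiffAt_space_slice hT),
    Finset.sum_sub_distrib]
  ring

lemma contDiff_heatOp {d : ℕ} {S : Euc d × ℝ → ℝ} (h : ContDiff ℝ ∞ S) :
    ContDiff ℝ ∞ (heatOp S) := by
  have e : heatOp S = fun q => fderiv ℝ S q timeVec -
      1 / 2 * ∑ i, fderiv ℝ (fun y => fderiv ℝ S y (spaceVec i)) q (spaceVec i) :=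
    funext fun q => heatOp_eq ((contDiff_infty.1 h 2).contDiffAt)
  have hd : ∀ {T : Euc d × ℝ → ℝ} (v : Euc d × ℝ), ContDiff ℝ ∞ T →
      ContDiff ℝ ∞ fun q => fderiv ℝ T q v := fun {T} v hT =>
    (hT.fderiv_right (by simp)).clm_apply contDiff_const
  rw [e]
  exact (hd _ h).sub (contDiff_const.mul (ContDiff.sum fun i _ => hd _ (hd _ h)))

variable {d : ℕ}

/-- The localized heat kernel. -/
noncomputable def locKer (ρ : ContDiffBump (0 : Euc d × ℝ)) (q : Euc d × ℝ) : ℝ :=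
  ρ q * heatKernel q

/-- The smooth remainder of the localized heat kernel. -/
noncomputable def remKer (ρ : ContDiffBump (0 : Euc d × ℝ)) (q : Euc d × ℝ) : ℝ :=
  (1 - ρ q) * heatKernel q

/-- The defect of the localized heat kernel. -/
noncomputable def defKer (ρ : ContDiffBump (0 : Euc d × ℝ)) : Euc d × ℝ → ℝ :=
  heatOp (remKer ρ)

lemma locKer_eq (ρ : ContDiffBump (0 : Euc d × ℝ)) (q : Euc d × ℝ) :
    locKer ρ q = heatKernel q - remKer ρ q := by
  simp only [locKer, remKer]; ring

lemma locKer_nonneg (ρ : ContDiffBump (0 : Euc d × ℝ)) (q : Euc d × ℝ) : 0 ≤ locKer ρ q :=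
  mul_nonneg ρ.nonneg (heatKernel_nonneg q)

lemma locKer_le (ρ : ContDiffBump (0 : Euc d × ℝ)) (q : Euc d × ℝ) :
    locKer ρ q ≤ heatKernel q := by
  have := mul_le_mul_of_nonneg_right (ρ.le_one (x := q)) (heatKernel_nonneg q)
  simpa [locKer] using this

lemma remKer_nonneg (ρ : ContDiffBump (0 : Euc d × ℝ)) (q : Euc d × ℝ) : 0 ≤ remKer ρ q :=
  mul_nonneg (sub_nonneg.2 ρ.le_one) (heatKernel_nonneg q)

lemma remKer_le (ρ : ContDiffBump (0 : Euc d × ℝ)) (q : Euc d × ℝ) :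
    remKer ρ q ≤ heatKernel q := by
  have := locKer_nonneg ρ q
  rw [locKer_eq] at this
  linarith

lemma locKer_of_nonpos (ρ : ContDiffBump (0 : Euc d × ℝ)) {z : Euc d} {r : ℝ} (hr : r ≤ 0) :
    locKer ρ (z, r) = 0 := by
  simp [locKer, heatKernel_of_nonpos hr]

lemma remKer_of_nonpos (ρ : ContDiffBump (0 : Euc d × ℝ)) {z : Euc d} {r : ℝ} (hr : r ≤ 0) :
    remKer ρ (z, r) = 0 := by
  simp [remKer, heatKernel_of_nonpos hr]

lemma locKer_of_rOut_le (ρ : ContDiffBump (0 : Euc d × ℝ)) {q : Euc d × ℝ} (hq : ρ.rOut ≤ ‖q‖) :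
    locKer ρ q = 0 := by
  rw [locKer, ρ.zero_of_le_dist (by simpa using hq), zero_mul]

lemma locKer_eq_heatKernel (ρ : ContDiffBump (0 : Euc d × ℝ)) {q : Euc d × ℝ}
    (hq : ‖q‖ ≤ ρ.rIn) : locKer ρ q = heatKernel q := by
  rw [locKer, ρ.one_of_mem_closedBall (by simpa using hq), one_mul]

lemma remKer_eventuallyEq_zero (ρ : ContDiffBump (0 : Euc d × ℝ)) {q : Euc d × ℝ}
    (hq : ‖q‖ < ρ.rIn) : remKer ρ =ᶠ[𝓝 q] fun _ => 0 := by
  filter_upwards [(continuous_norm.tendsto q).eventually (gt_mem_nhds hq)] with y hy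
  rw [remKer, ρ.one_of_mem_closedBall (by simpa using hy.le)]
  simp

lemma remKer_eventuallyEq_heatKernel (ρ : ContDiffBump (0 : Euc d × ℝ)) {q : Euc d × ℝ}
    (hq : ρ.rOut < ‖q‖) : remKer ρ =ᶠ[𝓝 q] heatKernel := by
  filter_upwards [(continuous_norm.tendsto q).eventually (lt_mem_nhds hq)] with y hy
  rw [remKer, ρ.zero_of_le_dist (by simpa using hy.le)]
  simp

lemma locKer_eventuallyEq_zero (ρ : ContDiffBump (0 : Euc d × ℝ)) {q : Euc d × ℝ}
    (hq : ρ.rOut < ‖q‖) : locKer ρ =ᶠ[𝓝 q] fun _ => 0 := by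
  filter_upwards [(continuous_norm.tendsto q).eventually (lt_mem_nhds hq)] with y hy
  exact locKer_of_rOut_le ρ hy.le

lemma contDiff_remKer (ρ : ContDiffBump (0 : Euc d × ℝ)) : ContDiff ℝ ∞ (remKer ρ) := by
  rw [contDiff_iff_contDiffAt]
  intro q
  by_cases hq : q = 0
  · subst hq
    exact contDiffAt_const.congr_of_eventuallyEq
      (remKer_eventuallyEq_zero ρ (by simpa using ρ.rIn_pos))
  · exact (contDiffAt_const.sub ρ.contDiffAt).mul (contDiffAt_heatKernel hq)

lemma contDiff_defKer (ρ : ContDiffBump (0 : Euc d × ℝ)) : ContDiff ℝ ∞ (defKer ρ) :=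
  contDiff_heatOp (contDiff_remKer ρ)

lemma defKer_of_nonpos (ρ : ContDiffBump (0 : Euc d × ℝ)) {z : Euc d} {r : ℝ} (hr : r ≤ 0) :
    defKer ρ (z, r) = 0 := by
  have h1 : EqOn (fun r => defKer ρ (z, r)) (fun _ => 0) (Iio 0) := by
    intro s hs
    have : remKer ρ =ᶠ[𝓝 (z, s)] fun _ => 0 := by
      filter_upwards [(continuous_snd.tendsto (z, s)).eventually (gt_mem_nhds hs)] with y hy
      exact remKer_of_nonpos ρ (z := y.1) (le_of_lt hy)
    simp only [defKer, heatOp_congr this, heatOp_zero]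
  have h2 := h1.closure ((contDiff_defKer ρ).continuous.comp (by fun_prop)) continuous_const
  rw [closure_Iio] at h2
  exact h2 hr

lemma defKer_of_lt_rIn (ρ : ContDiffBump (0 : Euc d × ℝ)) {q : Euc d × ℝ}
    (hq : ‖q‖ < ρ.rIn) : defKer ρ q = 0 := by
  rw [defKer, heatOp_congr (remKer_eventuallyEq_zero ρ hq), heatOp_zero]

lemma defKer_of_rOut_lt (ρ : ContDiffBump (0 : Euc d × ℝ)) {q : Euc d × ℝ}
    (hq : ρ.rOut < ‖q‖) : defKer ρ q = 0 := by
  rcases le_or_gt q.2 0 with h | h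
  · exact defKer_of_nonpos ρ (z := q.1) h
  · rw [defKer, heatOp_congr (remKer_eventuallyEq_heatKernel ρ hq)]
    exact heatOp_heatKernel_of_pos h q.1

lemma hasCompactSupport_defKer (ρ : ContDiffBump (0 : Euc d × ℝ)) :
    HasCompactSupport (defKer ρ) := by
  refine HasCompactSupport.of_support_subset_isCompact
    (isCompact_closedBall (0 : Euc d × ℝ) ρ.rOut) fun q hq => ?_
  by_contra h
  exact hq (defKer_of_rOut_lt ρ (by simpa using h))

lemma integrable_defKer (ρ : ContDiffBump (0 : Euc d × ℝ)) : Integrable (defKer ρ) :=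
  (contDiff_defKer ρ).continuous.integrable_of_hasCompactSupport (hasCompactSupport_defKer ρ)

lemma heatOp_locKer (ρ : ContDiffBump (0 : Euc d × ℝ)) {z : Euc d} {r : ℝ} (hr : 0 < r) :
    heatOp (locKer ρ) (z, r) = -defKer ρ (z, r) := by
  have hne : (z, r) ≠ 0 := fun h => hr.ne' (congrArg Prod.snd h)
  rw [show locKer ρ = fun q => heatKernel q - remKer ρ q from funext (locKer_eq ρ), heatOp_sub,
    heatOp_heatKernel_of_pos hr, zero_sub, defKer]
  · exact contDiffAt_infty.1 (contDiffAt_heatKernel hne) 2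
  · exact (contDiff_infty.1 (contDiff_remKer ρ) 2).contDiffAt

lemma contDiffAt_locKer (ρ : ContDiffBump (0 : Euc d × ℝ)) {q : Euc d × ℝ} (hq : q ≠ 0) :
    ContDiffAt ℝ ∞ (locKer ρ) q :=
  ρ.contDiffAt.mul (contDiffAt_heatKernel hq)

lemma measurable_locKer (ρ : ContDiffBump (0 : Euc d × ℝ)) : Measurable (locKer ρ) :=
  ρ.continuous.measurable.mul measurable_heatKernel

/-- A dominating function for derivatives of the localized heat kernel. -/
noncomputable def locDom (γ R : ℝ) (q : Euc d × ℝ) : ℝ :=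
  gaussDom γ (R + 1) q + (Metric.closedBall (0 : Euc d × ℝ) R).indicator 1 q

lemma integrable_locDom {γ : ℝ} (hγ : γ < 1) (R : ℝ) : Integrable (locDom (d := d) γ R) :=
  (integrable_gaussDom hγ _).add <|
    (integrable_indicator_iff Metric.isClosed_closedBall.measurableSet).2
      (integrableOn_const measure_closedBall_lt_top.ne)

lemma locDom_nonneg (γ R : ℝ) (q : Euc d × ℝ) : 0 ≤ locDom γ R q :=
  add_nonneg (gaussDom_nonneg _ _ _) (indicator_nonneg (fun _ _ => zero_le_one) _)

/-- Bound by `locDom` of a function supported in a ball. -/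
lemma abs_le_locDom {γ R A B : ℝ} {F G H : Euc d × ℝ → ℝ} (hA : 0 ≤ A) (hB : 0 ≤ B)
    (hF : ∀ q, R < ‖q‖ → F q = 0) (hF0 : ∀ z r, r ≤ 0 → F (z, r) = 0)
    (hFGH : ∀ z r, 0 < r → |F (z, r)| ≤ G (z, r) + H (z, r))
    (hG : ∀ z r, 0 < r → G (z, r) ≤ A * (r ^ (-γ) * heatKernel (z, 2 * r)))
    (hH : ∀ q, ‖q‖ ≤ R → H q ≤ B) (q : Euc d × ℝ) :
    |F q| ≤ (A + B) * locDom γ R q := by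
  have h0 : 0 ≤ (A + B) * locDom γ R q := mul_nonneg (by positivity) (locDom_nonneg _ _ _)
  obtain ⟨z, r⟩ := q
  rcases le_or_gt r 0 with hr | hr
  · rw [hF0 z r hr]; simpa using h0
  rcases le_or_gt ‖((z, r) : Euc d × ℝ)‖ R with hq | hq
  · have hrR : r < R + 1 := by
      have := (norm_snd_le ((z, r) : Euc d × ℝ)).trans hq
      rw [Real.norm_eq_abs] at this
      linarith [le_abs_self r]
    have e1 : locDom γ R ((z, r) : Euc d × ℝ) = r ^ (-γ) * heatKernel (z, 2 * r) + 1 := by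
      rw [locDom, gaussDom, indicator_of_mem (show r ∈ Ioo 0 (R + 1) from ⟨hr, hrR⟩),
        indicator_of_mem (by simpa using hq), Pi.one_apply]
    have h1 := hG z r hr
    have h2 := hH _ hq
    have h3 := hFGH z r hr
    have h4 : 0 ≤ r ^ (-γ) * heatKernel (z, 2 * r) :=
      mul_nonneg (rpow_nonneg hr.le _) (heatKernel_nonneg _)
    rw [e1]
    nlinarith [mul_nonneg hB h4]
  · rw [hF _ hq]; simpa using h0

lemma norm_rpow_mul_heatKernel_div_le (a b : ℝ) (ha : 0 ≤ a) : ∃ C ≥ 0, ∀ (z : Euc d) (r : ℝ),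
    0 < r →
      ‖z‖ ^ a / r ^ b * heatKernel (z, r) ≤ C * (r ^ (-(b - a / 2)) * heatKernel (z, 2 * r)) := by
  obtain ⟨C, hC, h⟩ := norm_rpow_mul_heatKernel_le (d := d) a ha
  refine ⟨C, hC, fun z r hr => ?_⟩
  have h1 := h z r hr
  have hb : 0 < r ^ b := rpow_pos_of_pos hr b
  calc ‖z‖ ^ a / r ^ b * heatKernel (z, r) = (‖z‖ ^ a * heatKernel (z, r)) / r ^ b := by ring
    _ ≤ (C * (r ^ (a / 2) * heatKernel (z, 2 * r))) / r ^ b := by gcongr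
    _ = _ := by
      rw [show -(b - a / 2) = a / 2 - b by ring, rpow_sub hr]
      ring

lemma integrable_of_abs_le_mul {F G : Euc d × ℝ → ℝ} {A : ℝ} (hF : Measurable F)
    (hG : Integrable G) (h : ∀ q, |F q| ≤ A * G q) : Integrable F :=
  (hG.const_mul A).mono' hF.aestronglyMeasurable (Eventually.of_forall h)

lemma integrable_locKer (ρ : ContDiffBump (0 : Euc d × ℝ)) : Integrable (locKer ρ) := by
  obtain ⟨C, hC, h⟩ := norm_rpow_mul_heatKernel_div_le (d := d) 0 0 le_rfl
  refine integrable_of_abs_le_mul (measurable_locKer ρ)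
    (integrable_locDom zero_lt_one ρ.rOut)
    (abs_le_locDom (F := locKer ρ) (G := heatKernel) (H := fun _ => 0) (B := 0) hC le_rfl
      (fun q hq => locKer_of_rOut_le ρ hq.le) (fun z r hr => locKer_of_nonpos ρ hr) ?_ ?_ ?_)
  · intro z r _
    rw [abs_of_nonneg (locKer_nonneg _ _), add_zero]
    exact locKer_le _ _
  · intro z r hr
    simpa using h z r hr
  · simp

/-- First space derivatives of the localized heat kernel. -/
noncomputable def locKerD (ρ : ContDiffBump (0 : Euc d × ℝ)) (i : Fin d) (q : Euc d × ℝ) : ℝ :=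
  pd i (fun y => locKer ρ (y, q.2)) q.1

/-- Second space derivatives of the localized heat kernel. -/
noncomputable def locKerDD (ρ : ContDiffBump (0 : Euc d × ℝ)) (i j : Fin d)
    (q : Euc d × ℝ) : ℝ :=
  pd j (pd i (fun y => locKer ρ (y, q.2))) q.1

lemma contDiffAt_space_slice_heatKernel {z : Euc d} {r : ℝ} :
    ContDiffAt ℝ 2 (fun y : Euc d => heatKernel (y, r)) z := by
  rcases le_or_gt r 0 with hr | hr
  · simpa only [heatKernel_of_nonpos hr] using contDiffAt_const
  · have hne : (z, r) ≠ 0 := fun h => hr.ne' (congrArg Prod.snd h)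
    exact contDiffAt_space_slice (contDiffAt_infty.1 (contDiffAt_heatKernel hne) 2)

lemma contDiffAt_space_slice_remKer (ρ : ContDiffBump (0 : Euc d × ℝ)) {z : Euc d} {r : ℝ} :
    ContDiffAt ℝ 2 (fun y : Euc d => remKer ρ (y, r)) z :=
  contDiffAt_space_slice (S := remKer ρ) (q := (z, r))
    (contDiff_infty.1 (contDiff_remKer ρ) 2).contDiffAt

lemma pd_zero (i : Fin d) : pd i (fun _ : Euc d => (0 : ℝ)) = fun _ => 0 := by
  funext x; simp [pd]

lemma locKerD_of_nonpos (ρ : ContDiffBump (0 : Euc d × ℝ)) (i : Fin d) {z : Euc d} {r : ℝ}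
    (hr : r ≤ 0) : locKerD ρ i (z, r) = 0 := by
  simp only [locKerD, locKer_of_nonpos ρ hr, pd_zero]

lemma locKerDD_of_nonpos (ρ : ContDiffBump (0 : Euc d × ℝ)) (i j : Fin d) {z : Euc d} {r : ℝ}
    (hr : r ≤ 0) : locKerDD ρ i j (z, r) = 0 := by
  simp only [locKerDD, locKer_of_nonpos ρ hr, pd_zero]

lemma locKerD_of_rOut_lt (ρ : ContDiffBump (0 : Euc d × ℝ)) (i : Fin d) {q : Euc d × ℝ}
    (hq : ρ.rOut < ‖q‖) : locKerD ρ i q = 0 := by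
  have h : (fun y => locKer ρ (y, q.2)) =ᶠ[𝓝 q.1] fun _ => 0 :=
    (locKer_eventuallyEq_zero ρ hq).space_slice
  rw [locKerD, pd_congr h, pd_zero]

lemma locKerDD_of_rOut_lt (ρ : ContDiffBump (0 : Euc d × ℝ)) (i j : Fin d) {q : Euc d × ℝ}
    (hq : ρ.rOut < ‖q‖) : locKerDD ρ i j q = 0 := by
  have h : (fun y => locKer ρ (y, q.2)) =ᶠ[𝓝 q.1] fun _ => 0 :=
    (locKer_eventuallyEq_zero ρ hq).space_slice
  rw [locKerDD, pd_congr (pd_eventuallyEq h i), pd_zero, pd_zero]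

lemma locKerD_eq (ρ : ContDiffBump (0 : Euc d × ℝ)) (i : Fin d) (q : Euc d × ℝ) :
    locKerD ρ i q = -(q.1 i / q.2) * heatKernel q - fderiv ℝ (remKer ρ) q (spaceVec i) := by
  obtain ⟨z, r⟩ := q
  have hw := pd_space_slice (S := remKer ρ) (q := (z, r))
    ((contDiff_remKer ρ).contDiffAt.differentiableAt (by simp)) i
  rw [← hw]
  rcases le_or_gt r 0 with hr | hr
  · simp only [locKerD, locKer_of_nonpos ρ hr, remKer_of_nonpos ρ hr, heatKernel_of_nonpos hr,
      pd_zero]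
    ring
  · simp only [locKerD, locKer_eq]
    rw [pd_sub (contDiffAt_space_slice_heatKernel.differentiableAt (by simp))
      ((contDiffAt_space_slice_remKer ρ).differentiableAt (by simp)), pd_heatKernel i hr]

lemma locKerDD_eq (ρ : ContDiffBump (0 : Euc d × ℝ)) (i j : Fin d) (q : Euc d × ℝ) :
    locKerDD ρ i j q = (q.1 i * q.1 j / q.2 ^ 2 - (if i = j then 1 else 0) / q.2) * heatKernel q -
      fderiv ℝ (fun y => fderiv ℝ (remKer ρ) y (spaceVec i)) q (spaceVec j) := by
  obtain ⟨z, r⟩ := q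
  have hw := pd_pd_space_slice (S := remKer ρ) (q := (z, r))
    (contDiff_infty.1 (contDiff_remKer ρ) 2).contDiffAt i j
  rw [← hw]
  rcases le_or_gt r 0 with hr | hr
  · simp only [locKerDD, locKer_of_nonpos ρ hr, remKer_of_nonpos ρ hr, heatKernel_of_nonpos hr,
      pd_zero]
    ring
  · simp only [locKerDD, locKer_eq]
    rw [pd_pd_sub contDiffAt_space_slice_heatKernel (contDiffAt_space_slice_remKer ρ),
      pd_pd_heatKernel i j hr]

lemma continuous_fderiv_apply_of_contDiff {S : Euc d × ℝ → ℝ} (h : ContDiff ℝ ∞ S)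
    (v : Euc d × ℝ) : ContDiff ℝ ∞ fun q => fderiv ℝ S q v :=
  (h.fderiv_right (by simp)).clm_apply contDiff_const

lemma measurable_coord (i : Fin d) : Measurable fun q : Euc d × ℝ => q.1 i :=
  (by fun_prop : Continuous fun q : Euc d × ℝ => q.1 i).measurable

lemma measurable_locKerD (ρ : ContDiffBump (0 : Euc d × ℝ)) (i : Fin d) :
    Measurable (locKerD ρ i) := by
  rw [show locKerD ρ i = _ from funext (locKerD_eq ρ i)]
  exact (((measurable_coord i).div measurable_snd).neg.mul measurable_heatKernel).sub
    (continuous_fderiv_apply_of_contDiff (contDiff_remKer ρ) _).continuous.measurable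

lemma measurable_locKerDD (ρ : ContDiffBump (0 : Euc d × ℝ)) (i j : Fin d) :
    Measurable (locKerDD ρ i j) := by
  rw [show locKerDD ρ i j = _ from funext (locKerDD_eq ρ i j)]
  refine Measurable.sub (Measurable.mul (Measurable.sub ?_ ?_) measurable_heatKernel) ?_
  · exact ((measurable_coord i).mul (measurable_coord j)).div (measurable_snd.pow_const 2)
  · exact measurable_const.div measurable_snd
  · exact (continuous_fderiv_apply_of_contDiff (continuous_fderiv_apply_of_contDiff
      (contDiff_remKer ρ) _) _).continuous.measurable

lemma exists_bound_on_closedBall {F : Euc d × ℝ → ℝ} (hF : Continuous F) (R : ℝ) :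
    ∃ B ≥ 0, ∀ q, ‖q‖ ≤ R → |F q| ≤ B := by
  obtain ⟨B, hB⟩ := (isCompact_closedBall (0 : Euc d × ℝ) R).exists_bound_of_continuousOn
    hF.continuousOn
  exact ⟨max B 0, le_max_right _ _, fun q hq =>
    (hB q (by simpa using hq)).trans (le_max_left _ _)⟩

lemma abs_coord_le (z : Euc d) (i : Fin d) : |z i| ≤ ‖z‖ := PiLp.norm_apply_le z i

lemma integrable_locKerD (ρ : ContDiffBump (0 : Euc d × ℝ)) (i : Fin d) :
    Integrable (locKerD ρ i) := by
  obtain ⟨C, hC, h⟩ := norm_rpow_mul_heatKernel_div_le (d := d) 1 1 zero_le_one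
  obtain ⟨B, hB, hw⟩ := exists_bound_on_closedBall
    (continuous_fderiv_apply_of_contDiff (contDiff_remKer ρ) (spaceVec i)).continuous ρ.rOut
  refine integrable_of_abs_le_mul (measurable_locKerD ρ i)
    (integrable_locDom (γ := 1 - 1 / 2) (by norm_num) ρ.rOut)
    (abs_le_locDom (G := fun q => ‖q.1‖ ^ (1 : ℝ) / q.2 ^ (1 : ℝ) * heatKernel q)
      (H := fun q => |fderiv ℝ (remKer ρ) q (spaceVec i)|) hC hB
      (fun q hq => locKerD_of_rOut_lt ρ i hq) (fun z r hr => locKerD_of_nonpos ρ i hr)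
      (fun z r hr => ?_) h hw)
  rw [locKerD_eq]
  refine (abs_sub _ _).trans (add_le_add_left ?_ _)
  rw [abs_mul, abs_neg, abs_div, abs_of_pos hr, abs_of_nonneg (heatKernel_nonneg _),
    rpow_one, rpow_one]
  gcongr
  · exact heatKernel_nonneg _
  · exact abs_coord_le _ _

lemma integrable_rpow_mul_locKerDD (ρ : ContDiffBump (0 : Euc d × ℝ)) (i j : Fin d) {α : ℝ}
    (hα : 0 < α) : Integrable fun q => ‖q.1‖ ^ α * locKerDD ρ i j q := by
  obtain ⟨C, hC, h⟩ := norm_rpow_mul_heatKernel_div_le (d := d) (α + 2) 2 (by positivity)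
  obtain ⟨C', hC', h'⟩ := norm_rpow_mul_heatKernel_div_le (d := d) α 1 hα.le
  have hcont : Continuous fun q : Euc d × ℝ => ‖q.1‖ ^ α :=
    (continuous_norm.comp continuous_fst).rpow_const fun _ => Or.inr hα.le
  obtain ⟨B, hB, hw⟩ := exists_bound_on_closedBall (hcont.mul
    (continuous_fderiv_apply_of_contDiff (continuous_fderiv_apply_of_contDiff
      (contDiff_remKer ρ) (spaceVec i)) (spaceVec j)).continuous) ρ.rOut
  refine integrable_of_abs_le_mul (hcont.measurable.mul (measurable_locKerDD ρ i j))
    (integrable_locDom (γ := 1 - α / 2) (by linarith) ρ.rOut)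
    (abs_le_locDom (A := C + C') (G := fun q => ‖q.1‖ ^ (α + 2) / q.2 ^ (2 : ℝ) * heatKernel q +
        ‖q.1‖ ^ α / q.2 ^ (1 : ℝ) * heatKernel q)
      (H := fun q => |‖q.1‖ ^ α * fderiv ℝ (fun y => fderiv ℝ (remKer ρ) y (spaceVec i)) q
        (spaceVec j)|) (by positivity) hB
      (fun q hq => by rw [locKerDD_of_rOut_lt ρ i j hq, mul_zero])
      (fun z r hr => by rw [locKerDD_of_nonpos ρ i j hr, mul_zero])
      (fun z r hr => ?_) (fun z r hr => ?_) hw)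
  · rw [locKerDD_eq, mul_sub]
    refine (abs_sub _ _).trans (add_le_add_left ?_ _)
    rw [abs_mul, abs_mul, abs_of_nonneg (heatKernel_nonneg _), ← mul_assoc, ← add_mul]
    refine mul_le_mul_of_nonneg_right ?_ (heatKernel_nonneg _)
    have hz : 0 ≤ ‖z‖ ^ α := rpow_nonneg (norm_nonneg _) _
    have h2 : ‖z‖ ^ (α + 2) = ‖z‖ ^ α * ‖z‖ ^ 2 := by
      rw [rpow_add_of_nonneg (norm_nonneg _) hα.le (by norm_num)]; norm_num
    have h3 : ‖z‖ ^ α * ‖z‖ ^ 2 / r ^ (2 : ℝ) + ‖z‖ ^ α / r ^ (1 : ℝ) =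
        ‖z‖ ^ α * (‖z‖ ^ 2 / r ^ 2 + r⁻¹) := by
      rw [rpow_one, rpow_two]; ring
    rw [abs_of_nonneg hz, h2]
    refine le_trans ?_ h3.ge
    refine mul_le_mul_of_nonneg_left ((abs_sub _ _).trans (add_le_add ?_ ?_)) hz
    · rw [abs_div, abs_mul, abs_of_pos (show 0 < r ^ 2 by positivity)]
      gcongr
      nlinarith [abs_coord_le z i, abs_coord_le z j, abs_nonneg (z i), abs_nonneg (z j)]
    · rw [abs_div, abs_of_pos hr, div_eq_mul_inv]
      refine mul_le_of_le_one_left (by positivity) ?_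
      split_ifs <;> simp
  · have e1 := h z r hr
    have e2 := h' z r hr
    rw [show (2 : ℝ) - (α + 2) / 2 = 1 - α / 2 by ring] at e1
    rw [add_mul]
    exact add_le_add e1 e2

/-- A smooth time cutoff vanishing up to time `1/(m+1)` and equal to one after `2/(m+1)`. -/
noncomputable def timeCut (m : ℕ) (r : ℝ) : ℝ := smoothTransition ((m + 1) * r - 1)

lemma contDiff_timeCut (m : ℕ) : ContDiff ℝ ∞ (timeCut m) :=
  smoothTransition.contDiff.comp (by fun_prop)

lemma timeCut_nonneg (m : ℕ) (r : ℝ) : 0 ≤ timeCut m r := smoothTransition.nonneg _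

lemma timeCut_le_one (m : ℕ) (r : ℝ) : timeCut m r ≤ 1 := smoothTransition.le_one _

lemma abs_timeCut_le_one (m : ℕ) (r : ℝ) : |timeCut m r| ≤ 1 := by
  rw [abs_of_nonneg (timeCut_nonneg m r)]; exact timeCut_le_one m r

lemma timeCut_eq_zero {m : ℕ} {r : ℝ} (h : r ≤ 1 / (m + 1)) : timeCut m r = 0 := by
  refine smoothTransition.zero_of_nonpos ?_
  rw [le_div_iff₀ (by positivity)] at h
  linarith

lemma timeCut_eq_one {m : ℕ} {r : ℝ} (h : 2 / (m + 1) ≤ r) : timeCut m r = 1 := by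
  refine smoothTransition.one_of_one_le ?_
  rw [div_le_iff₀ (by positivity)] at h
  linarith

lemma tendsto_timeCut {r : ℝ} (hr : 0 < r) :
    Tendsto (fun m => timeCut m r) atTop (𝓝 1) := by
  refine tendsto_const_nhds.congr' ?_
  have h : Tendsto (fun m : ℕ => (2 : ℝ) * (1 / ((m : ℝ) + 1))) atTop (𝓝 0) := by
    simpa using tendsto_one_div_add_atTop_nhds_zero_nat.const_mul (2 : ℝ)
  filter_upwards [h.eventually (gt_mem_nhds hr)] with m hm
  exact (timeCut_eq_one (by rw [← mul_one_div]; exact hm.le)).symm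

lemma integrable_timeCut_mul {K : Euc d × ℝ → ℝ} (hK : Integrable K) (m : ℕ) :
    Integrable fun q => timeCut m q.2 * K q :=
  hK.bdd_mul (c := 1) ((contDiff_timeCut m).continuous.comp
    continuous_snd).aestronglyMeasurable (Eventually.of_forall fun _ => abs_timeCut_le_one m _)

lemma tendsto_integral_timeCut {K : Euc d × ℝ → ℝ} (hK : Integrable K)
    (hK0 : ∀ z r, r ≤ 0 → K (z, r) = 0) :
    Tendsto (fun m => ∫ q, |timeCut m q.2 * K q - K q|) atTop (𝓝 0) := by
  rw [show (0 : ℝ) = ∫ q : Euc d × ℝ, (0 : ℝ) by simp]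
  refine tendsto_integral_of_dominated_convergence (fun q => 2 * |K q|) (fun m => ?_)
    (hK.abs.const_mul 2) (fun m => Eventually.of_forall fun q => ?_)
    (Eventually.of_forall fun q => ?_)
  · exact ((integrable_timeCut_mul hK m).sub hK).abs.aestronglyMeasurable
  · rw [norm_eq_abs, abs_abs]
    refine (abs_sub _ _).trans ?_
    rw [abs_mul]
    nlinarith [abs_timeCut_le_one m q.2, abs_nonneg (K q)]
  · rcases le_or_gt q.2 0 with h | h
    · have : K q = 0 := hK0 q.1 q.2 h
      simp [this]
    · have := (((tendsto_timeCut h).mul_const (K q)).sub_const (K q)).abs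
      simpa using this

lemma abs_cv_timeCut_sub_le {K f : Euc d × ℝ → ℝ} {B : ℝ} (hK : Integrable K)
    (hf : Measurable f) (hB : ∀ y, |f y| ≤ B) (m : ℕ) (q : Euc d × ℝ) :
    |cv (fun y => timeCut m y.2 * K y) f q - cv K f q| ≤
      B * ∫ q, |timeCut m q.2 * K q - K q| := by
  rw [← cv_sub_left (integrable_timeCut_mul hK m) hK hf hB]
  exact abs_cv_le ((integrable_timeCut_mul hK m).sub hK) hB q

/-- The localized heat kernel with the singularity cut off. -/
noncomputable def apxKer (ρ : ContDiffBump (0 : Euc d × ℝ)) (m : ℕ) (q : Euc d × ℝ) : ℝ :=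
  timeCut m q.2 * locKer ρ q

lemma apxKer_eventuallyEq_zero (ρ : ContDiffBump (0 : Euc d × ℝ)) (m : ℕ) {q : Euc d × ℝ}
    (hq : q.2 ≤ 0) : apxKer ρ m =ᶠ[𝓝 q] fun _ => 0 := by
  have h : q.2 < 1 / ((m : ℝ) + 1) := hq.trans_lt (by positivity)
  filter_upwards [(continuous_snd.tendsto q).eventually (gt_mem_nhds h)] with y hy
  rw [apxKer, timeCut_eq_zero (le_of_lt hy), zero_mul]

lemma contDiff_apxKer (ρ : ContDiffBump (0 : Euc d × ℝ)) (m : ℕ) :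
    ContDiff ℝ ∞ (apxKer ρ m) := by
  rw [contDiff_iff_contDiffAt]
  intro q
  by_cases hq : q = 0
  · exact contDiffAt_const.congr_of_eventuallyEq (apxKer_eventuallyEq_zero ρ m (by simp [hq]))
  · exact ((contDiff_timeCut m).contDiffAt.comp q contDiffAt_snd).mul (contDiffAt_locKer ρ hq)

lemma hasCompactSupport_apxKer (ρ : ContDiffBump (0 : Euc d × ℝ)) (m : ℕ) :
    HasCompactSupport (apxKer ρ m) :=
  (ρ.hasCompactSupport.mul_right (f' := heatKernel)).mul_left

lemma fderiv_apxKer (ρ : ContDiffBump (0 : Euc d × ℝ)) (m : ℕ) (i : Fin d) :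
    (fun q => fderiv ℝ (apxKer ρ m) q (spaceVec i)) =
      fun q => timeCut m q.2 * locKerD ρ i q := by
  funext q
  rw [← pd_space_slice ((contDiff_apxKer ρ m).contDiffAt.differentiableAt (by simp))]
  simp only [apxKer, pd_const_mul, locKerD]

lemma fderiv_fderiv_apxKer (ρ : ContDiffBump (0 : Euc d × ℝ)) (m : ℕ) (i j : Fin d) :
    (fun q => fderiv ℝ (fun q => fderiv ℝ (apxKer ρ m) q (spaceVec i)) q (spaceVec j)) =
      fun q => timeCut m q.2 * locKerDD ρ i j q := by
  funext q
  rw [← pd_pd_space_slice (contDiff_infty.1 (contDiff_apxKer ρ m) 2).contDiffAt]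
  simp only [apxKer, pd_const_mul, locKerDD]

lemma heatOp_apxKer (ρ : ContDiffBump (0 : Euc d × ℝ)) (m : ℕ) (q : Euc d × ℝ) :
    heatOp (apxKer ρ m) q =
      deriv (timeCut m) q.2 * locKer ρ q - timeCut m q.2 * defKer ρ q := by
  rcases le_or_gt q.2 0 with h | h
  · rw [heatOp_congr (apxKer_eventuallyEq_zero ρ m h), heatOp_zero,
      locKer_of_nonpos ρ (z := q.1) (r := q.2) h, defKer_of_nonpos ρ (z := q.1) (r := q.2) h]
    simp
  · have hne : q ≠ 0 := fun h' => h.ne' (congrArg Prod.snd h')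
    have h1 := hasDerivAt_time_slice ((contDiffAt_locKer ρ hne).differentiableAt (by simp))
    have h2 := ((contDiff_timeCut m).differentiable (by simp) q.2).hasDerivAt
    have h3 : HasDerivAt (fun s => apxKer ρ m (q.1, s)) _ q.2 := h2.mul h1
    have h4 := heatOp_locKer ρ (z := q.1) h
    rw [heatOp, h1.deriv] at h4
    rw [heatOp, h3.deriv]
    simp only [apxKer, pd_const_mul, ← Finset.mul_sum]
    have h5 : defKer ρ q = defKer ρ (q.1, q.2) := rfl
    rw [h5, ← neg_neg (defKer ρ (q.1, q.2)), ← h4]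
    ring

lemma cv_space_indep_eq_zero {K : Euc d × ℝ → ℝ} (hK : ContDiff ℝ 1 K)
    (hKc : HasCompactSupport K) {g : Euc d × ℝ → ℝ} {B : ℝ} (hg : Measurable g)
    (hB : ∀ y, |g y| ≤ B) (hind : ∀ x y t, g (x, t) = g (y, t)) (i : Fin d) (q : Euc d × ℝ) :
    cv (fun y => fderiv ℝ K y (spaceVec i)) g q = 0 := by
  rw [← fderiv_cv_apply hK hKc hg hB, ← pd_space_slice
    ((contDiff_cv (n := 1) hK hKc hg hB).contDiffAt.differentiableAt (by simp))]
  have : (fun y => cv K g (y, q.2)) = fun _ => cv K g (0, q.2) := by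
    funext y
    simp only [cv]
    congr 1
    funext w
    congr 1
    exact hind _ _ _
  rw [this]
  simp [pd]

lemma measurable_freeze {f : Euc d × ℝ → ℝ} (hf : Measurable f) (x : Euc d) :
    Measurable fun y : Euc d × ℝ => f (x, y.2) :=
  hf.comp (measurable_const.prodMk measurable_snd)

/-- The second space derivatives of the localized heat potential. -/
noncomputable def locPotDD (ρ : ContDiffBump (0 : Euc d × ℝ)) (f : Euc d × ℝ → ℝ) (i j : Fin d)
    (q : Euc d × ℝ) : ℝ :=
  ∫ y, locKerDD ρ i j y * (f (q - y) - f (q.1, q.2 - y.2))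

lemma abs_cv_apxKer_DD_sub_le (ρ : ContDiffBump (0 : Euc d × ℝ)) {f : Euc d × ℝ → ℝ} {B H α : ℝ}
    (hα : 0 < α) (hf : Measurable f) (hB : ∀ y, |f y| ≤ B)
    (hH : ∀ x y t, |f (x, t) - f (y, t)| ≤ H * ‖x - y‖ ^ α) (i j : Fin d) (m : ℕ)
    (q : Euc d × ℝ) :
    |cv (fun q => fderiv ℝ (fun q => fderiv ℝ (apxKer ρ m) q (spaceVec i)) q (spaceVec j)) f q -
      locPotDD ρ f i j q| ≤
      H * ∫ q, |timeCut m q.2 * (‖q.1‖ ^ α * locKerDD ρ i j q) - ‖q.1‖ ^ α * locKerDD ρ i j q| := by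
  set g : Euc d × ℝ → ℝ := fun y => f (q.1, y.2) with hg
  have hK : ContDiff ℝ ∞ fun q => fderiv ℝ (apxKer ρ m) q (spaceVec i) :=
    continuous_fderiv_apply_of_contDiff (contDiff_apxKer ρ m) _
  have hKc : HasCompactSupport fun q => fderiv ℝ (apxKer ρ m) q (spaceVec i) :=
    (hasCompactSupport_apxKer ρ m).fderiv_apply ℝ _
  have hgm : Measurable g := measurable_freeze hf q.1
  have h0 := cv_space_indep_eq_zero (contDiff_infty.1 hK 1) hKc (B := B) hgm (fun y => hB _)
    (fun x y t => rfl) j q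
  have hKi : Integrable fun q =>
      fderiv ℝ (fun q => fderiv ℝ (apxKer ρ m) q (spaceVec i)) q (spaceVec j) :=
    (continuous_fderiv_apply_of_contDiff hK _).continuous.integrable_of_hasCompactSupport
      (hKc.fderiv_apply ℝ _)
  rw [← sub_zero (cv _ f q), ← h0]
  simp only [cv]
  rw [← integral_sub (integrable_mul_comp_sub hKi hf hB q)
    (integrable_mul_comp_sub hKi hgm (fun y => hB _) q), locPotDD]
  have hi := integrable_rpow_mul_locKerDD ρ i j hα
  have hdiff : ∀ y : Euc d × ℝ, |f (q - y) - f (q.1, q.2 - y.2)| ≤ H * ‖y.1‖ ^ α := fun y => by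
    have := hH (q - y).1 q.1 (q.2 - y.2)
    rwa [show (q - y).1 - q.1 = -y.1 by simp, norm_neg] at this
  have e1 : Integrable fun y => locKerDD ρ i j y * (f (q - y) - f (q.1, q.2 - y.2)) := by
    refine (hi.norm.const_mul H).mono' ?_ (Eventually.of_forall fun y => ?_)
    · refine ((measurable_locKerDD ρ i j).mul (Measurable.sub ?_ ?_)).aestronglyMeasurable
      · exact hf.comp (measurable_const.sub measurable_id)
      · exact hf.comp (measurable_const.prodMk (measurable_const.sub measurable_snd))
    · rw [norm_mul, norm_mul, Real.norm_eq_abs (‖y.1‖ ^ α), abs_of_nonneg (rpow_nonneg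
        (norm_nonneg _) _), norm_eq_abs (_ - _)]
      nlinarith [hdiff y, norm_nonneg (locKerDD ρ i j y)]
  rw [← integral_sub, ← integral_const_mul]
  · rw [← Real.norm_eq_abs]
    refine norm_integral_le_of_norm_le (((integrable_timeCut_mul hi m).sub hi).abs.const_mul H)
      (Eventually.of_forall fun y => ?_)
    have e2 := congrFun (fderiv_fderiv_apxKer ρ m i j) y
    have e3 : g (q - y) = f (q.1, q.2 - y.2) := rfl
    rw [e2, e3, ← mul_sub, mul_assoc, ← sub_one_mul, ← sub_one_mul, norm_mul, norm_mul, abs_mul,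
      abs_mul, abs_of_nonneg (rpow_nonneg (norm_nonneg y.1) _), Real.norm_eq_abs,
      Real.norm_eq_abs, norm_eq_abs]
    have := mul_le_mul_of_nonneg_left (hdiff y)
      (mul_nonneg (abs_nonneg (timeCut m y.2 - 1)) (abs_nonneg (locKerDD ρ i j y)))
    linarith
  · exact (integrable_mul_comp_sub hKi hf hB q).sub
      (integrable_mul_comp_sub hKi hgm (fun y => hB _) q)
  · exact e1

lemma fderiv_eq_sum_pd (f : Euc d → ℝ) (x : Euc d) :
    fderiv ℝ f x = ∑ i, pd i f x • (EuclideanSpace.proj i : Euc d →L[ℝ] ℝ) := by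
  ext v
  have hv : v = ∑ i, v i • EuclideanSpace.single i (1 : ℝ) := by
    ext j
    simp [Finset.sum_apply, Pi.single_apply]
  conv_lhs => rw [hv]
  simp [pd, mul_comm]

lemma contDiff_of_pd {f : Euc d → ℝ} {n : ℕ} (hf : Differentiable ℝ f)
    (h : ∀ i, ContDiff ℝ n (pd i f)) : ContDiff ℝ (n + 1) f := by
  rw [contDiff_succ_iff_fderiv]
  refine ⟨hf, by simp, ?_⟩
  rw [show fderiv ℝ f = _ from funext (fderiv_eq_sum_pd f)]
  exact ContDiff.sum fun i _ => (h i).smul contDiff_const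

lemma norm_sum_smul_proj_le (a : Fin d → ℝ) :
    ‖∑ i, a i • (EuclideanSpace.proj i : Euc d →L[ℝ] ℝ)‖ ≤ ∑ i, |a i| := by
  refine (norm_sum_le _ _).trans (Finset.sum_le_sum fun i _ => ?_)
  rw [norm_smul, norm_eq_abs]
  refine mul_le_of_le_one_right (abs_nonneg _) ?_
  refine ContinuousLinearMap.opNorm_le_bound _ zero_le_one fun v => ?_
  rw [one_mul]
  exact PiLp.norm_apply_le v i

/-- Uniform convergence of partial derivatives passes to the limit. -/
lemma hasFDerivAt_of_uniform_pd {f : ℕ → Euc d → ℝ} {g : Euc d → ℝ} {a : Fin d → Euc d → ℝ}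
    {e : Fin d → ℕ → ℝ} (hf : ∀ m, Differentiable ℝ (f m))
    (hfg : ∀ x, Tendsto (fun m => f m x) atTop (𝓝 (g x)))
    (he : ∀ i, Tendsto (e i) atTop (𝓝 0))
    (hpd : ∀ i m x, |pd i (f m) x - a i x| ≤ e i m) (x : Euc d) :
    HasFDerivAt g (∑ i, a i x • (EuclideanSpace.proj i : Euc d →L[ℝ] ℝ)) x := by
  refine hasFDerivAt_of_tendstoUniformly (f := f) (f' := fun m x => fderiv ℝ (f m) x)
    (g' := fun x => ∑ i, a i x • (EuclideanSpace.proj i : Euc d →L[ℝ] ℝ)) (l := atTop) ?_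
    (fun m x => (hf m x).hasFDerivAt) hfg x
  rw [Metric.tendstoUniformly_iff]
  intro ε hε
  have hs : Tendsto (fun m => ∑ i, e i m) atTop (𝓝 0) := by
    simpa using tendsto_finsetSum Finset.univ fun i _ => he i
  filter_upwards [hs.eventually (gt_mem_nhds hε)] with m hm x
  rw [dist_comm, dist_eq_norm, fderiv_eq_sum_pd, ← Finset.sum_sub_distrib]
  simp only [← sub_smul]
  exact (norm_sum_smul_proj_le _).trans_lt ((Finset.sum_le_sum fun i _ => hpd i m x).trans_lt hm)

lemma pd_of_uniform_pd {f : ℕ → Euc d → ℝ} {g : Euc d → ℝ} {a : Fin d → Euc d → ℝ}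
    {e : Fin d → ℕ → ℝ} (hf : ∀ m, Differentiable ℝ (f m))
    (hfg : ∀ x, Tendsto (fun m => f m x) atTop (𝓝 (g x)))
    (he : ∀ i, Tendsto (e i) atTop (𝓝 0))
    (hpd : ∀ i m x, |pd i (f m) x - a i x| ≤ e i m) (i : Fin d) : pd i g = a i := by
  funext x
  rw [pd_eq_of_hasFDerivAt (hasFDerivAt_of_uniform_pd hf hfg he hpd x)]
  simp

lemma continuous_of_uniform {E : Type*} [TopologicalSpace E] {f : ℕ → E → ℝ} {g : E → ℝ}
    {e : ℕ → ℝ} (hf : ∀ m, Continuous (f m)) (he : Tendsto e atTop (𝓝 0))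
    (h : ∀ m x, |f m x - g x| ≤ e m) : Continuous g := by
  have hu : TendstoUniformly f g atTop := by
    rw [Metric.tendstoUniformly_iff]
    intro ε hε
    filter_upwards [he.eventually (gt_mem_nhds hε)] with m hm x
    rw [dist_comm, Real.dist_eq]
    exact (h m x).trans_lt hm
  exact hu.continuous (Eventually.of_forall hf).frequently

lemma tendsto_of_abs_sub_le {f : ℕ → ℝ} {a : ℝ} {e : ℕ → ℝ} (he : Tendsto e atTop (𝓝 0))
    (h : ∀ m, |f m - a| ≤ e m) : Tendsto f atTop (𝓝 a) := by
  rw [tendsto_iff_dist_tendsto_zero]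
  exact squeeze_zero (fun m => dist_nonneg) h he

/-- `S` is a classical solution of the inhomogeneous heat equation with source `F` at `q`. -/
def HeatAt (S F : Euc d × ℝ → ℝ) (q : Euc d × ℝ) : Prop :=
  ContDiffAt ℝ 2 (fun y => S (y, q.2)) q.1 ∧ ContDiffAt ℝ 1 (fun s => S (q.1, s)) q.2 ∧
    deriv (fun s => S (q.1, s)) q.2 =
      1 / 2 * ∑ i, pd i (pd i (fun y => S (y, q.2))) q.1 + F q

lemma HeatAt.congr {S S' F F' : Euc d × ℝ → ℝ} {q : Euc d × ℝ} (h : HeatAt S F q)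
    (hS : S' =ᶠ[𝓝 q] S) (hF : F' q = F q) : HeatAt S' F' q := by
  have h1 : (fun s => S' (q.1, s)) =ᶠ[𝓝 q.2] fun s => S (q.1, s) := hS.time_slice
  have h2 : (fun y => S' (y, q.2)) =ᶠ[𝓝 q.1] fun y => S (y, q.2) := hS.space_slice
  refine ⟨h.1.congr_of_eventuallyEq h2, h.2.1.congr_of_eventuallyEq h1, ?_⟩
  rw [h1.deriv_eq, h.2.2, hF]
  simp only [pd_congr (pd_eventuallyEq h2 _)]

lemma HeatAt.sub {S S' F F' : Euc d × ℝ → ℝ} {q : Euc d × ℝ} (h : HeatAt S F q)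
    (h' : HeatAt S' F' q) : HeatAt (fun y => S y - S' y) (fun y => F y - F' y) q := by
  refine ⟨h.1.sub h'.1, h.2.1.sub h'.2.1, ?_⟩
  have h1 := (h.2.1.differentiableAt (by simp)).hasDerivAt
  have h2 := (h'.2.1.differentiableAt (by simp)).hasDerivAt
  simp only [(h1.fun_sub h2).deriv, h.2.2, h'.2.2, pd_pd_sub h.1 h'.1, Finset.sum_sub_distrib]
  ring

lemma ContDiff.heatAt {S : Euc d × ℝ → ℝ} (h : ContDiff ℝ ∞ S) (q : Euc d × ℝ) :
    HeatAt S (heatOp S) q := by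
  have h2 : ContDiffAt ℝ 2 S q := (contDiff_infty.1 h 2).contDiffAt
  refine ⟨contDiffAt_space_slice h2, contDiffAt_time_slice (h2.of_le (by norm_num)), ?_⟩
  rw [heatOp]; ring

lemma HeatAt.neg {S F : Euc d × ℝ → ℝ} {q : Euc d × ℝ} (h : HeatAt S F q) :
    HeatAt (fun y => -S y) (fun y => -F y) q := by
  have h0 := (contDiff_const (c := (0 : ℝ)) (E := Euc d × ℝ) (n := ∞)).heatAt q
  refine (h0.sub h).congr (Eventually.of_forall fun y => by simp) ?_
  simp [heatOp_zero]

lemma HeatAt.add {S S' F F' : Euc d × ℝ → ℝ} {q : Euc d × ℝ} (h : HeatAt S F q)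
    (h' : HeatAt S' F' q) : HeatAt (fun y => S y + S' y) (fun y => F y + F' y) q :=
  (h.sub h'.neg).congr (Eventually.of_forall fun y => by simp) (by simp)

lemma fderiv_cv_apply_fun {K f : Euc d × ℝ → ℝ} {B : ℝ} (hK : ContDiff ℝ 1 K)
    (hKc : HasCompactSupport K) (hf : Measurable f) (hB : ∀ y, |f y| ≤ B) (e : Euc d × ℝ) :
    (fun q => fderiv ℝ (cv K f) q e) = cv (fun y => fderiv ℝ K y e) f :=
  funext fun q => fderiv_cv_apply hK hKc hf hB e q

lemma pd_cv {K f : Euc d × ℝ → ℝ} {B : ℝ} (hK : ContDiff ℝ 1 K)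
    (hKc : HasCompactSupport K) (hf : Measurable f) (hB : ∀ y, |f y| ≤ B) (i : Fin d) (t : ℝ)
    (x : Euc d) : pd i (fun y => cv K f (y, t)) x =
      cv (fun y => fderiv ℝ K y (spaceVec i)) f (x, t) := by
  rw [← fderiv_cv_apply hK hKc hf hB, ← pd_space_slice (q := (x, t))
    ((contDiff_cv (n := 1) hK hKc hf hB).contDiffAt.differentiableAt (by simp))]

lemma cv_finset_sum {ι : Type*} (s : Finset ι) {K : ι → Euc d × ℝ → ℝ} {f : Euc d × ℝ → ℝ}
    {B : ℝ} (hK : ∀ i, Integrable (K i)) (hf : Measurable f) (hB : ∀ y, |f y| ≤ B)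
    (q : Euc d × ℝ) : cv (fun y => ∑ i ∈ s, K i y) f q = ∑ i ∈ s, cv (K i) f q := by
  simp only [cv, Finset.sum_mul]
  exact integral_finsetSum _ fun i _ => integrable_mul_comp_sub (hK i) hf hB q

/-- The heat operator commutes with convolution by a smooth compactly supported kernel. -/
lemma heatOp_cv {K f : Euc d × ℝ → ℝ} {B : ℝ} (hK : ContDiff ℝ ∞ K)
    (hKc : HasCompactSupport K) (hf : Measurable f) (hB : ∀ y, |f y| ≤ B) (q : Euc d × ℝ) :
    heatOp (cv K f) q = cv (heatOp K) f q := by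
  have hD : ∀ v, ContDiff ℝ ∞ fun q => fderiv ℝ K q v := fun v =>
    continuous_fderiv_apply_of_contDiff hK v
  have hDc : ∀ v, HasCompactSupport fun q => fderiv ℝ K q v := fun v => hKc.fderiv_apply ℝ v
  have hDD : ∀ v v', Integrable fun q => fderiv ℝ (fun q => fderiv ℝ K q v) q v' := fun v v' =>
    (continuous_fderiv_apply_of_contDiff (hD v) v').continuous.integrable_of_hasCompactSupport
      ((hDc v).fderiv_apply ℝ v')
  have h1 : ∀ {L : Euc d × ℝ → ℝ}, ContDiff ℝ ∞ L → ContDiff ℝ 1 L := fun h => contDiff_infty.1 h 1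
  have e : heatOp K = fun q => fderiv ℝ K q timeVec -
      1 / 2 * ∑ i, fderiv ℝ (fun y => fderiv ℝ K y (spaceVec i)) q (spaceVec i) :=
    funext fun q => heatOp_eq (contDiff_infty.1 hK 2).contDiffAt
  rw [heatOp_eq (contDiff_infty.1 (contDiff_cv (n := ⊤) hK hKc hf hB) 2).contDiffAt, e,
    cv_sub_left ((hD _).continuous.integrable_of_hasCompactSupport (hDc _))
      ((integrable_finsetSum _ fun i _ => hDD _ _).const_mul _) hf hB, cv_const_mul,
    cv_finset_sum _ (fun i => hDD _ _) hf hB, fderiv_cv_apply (h1 hK) hKc hf hB]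
  simp only [fderiv_cv_apply_fun (h1 hK) hKc hf hB, fderiv_cv_apply (h1 (hD _)) (hDc _) hf hB]

lemma tendsto_const_mul_integral_timeCut {K : Euc d × ℝ → ℝ} (hK : Integrable K)
    (hK0 : ∀ z r, r ≤ 0 → K (z, r) = 0) (B : ℝ) :
    Tendsto (fun m => B * ∫ q, |timeCut m q.2 * K q - K q|) atTop (𝓝 0) := by
  simpa using (tendsto_integral_timeCut hK hK0).const_mul B

lemma hasFDerivAt_cv_locKer (ρ : ContDiffBump (0 : Euc d × ℝ)) {f : Euc d × ℝ → ℝ} {B : ℝ}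
    (hf : Measurable f) (hB : ∀ y, |f y| ≤ B) (x : Euc d) (t : ℝ) :
    HasFDerivAt (fun y => cv (locKer ρ) f (y, t))
      (∑ i, cv (locKerD ρ i) f (x, t) • (EuclideanSpace.proj i : Euc d →L[ℝ] ℝ)) x := by
  have h1 : ∀ m, ContDiff ℝ 1 (apxKer ρ m) := fun m => contDiff_infty.1 (contDiff_apxKer ρ m) 1
  refine hasFDerivAt_of_uniform_pd (f := fun m y => cv (apxKer ρ m) f (y, t))
    (a := fun i x => cv (locKerD ρ i) f (x, t)) (fun m => ?_)
    (fun x => tendsto_of_abs_sub_le (tendsto_const_mul_integral_timeCut (integrable_locKer ρ)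
      (fun z r => locKer_of_nonpos ρ) B) fun m =>
        abs_cv_timeCut_sub_le (integrable_locKer ρ) hf hB m (x, t))
    (fun i => tendsto_const_mul_integral_timeCut (integrable_locKerD ρ i)
      (fun z r => locKerD_of_nonpos ρ i) B) (fun i m x => ?_) x
  · exact ((contDiff_cv (n := 1) (h1 m) (hasCompactSupport_apxKer ρ m) hf hB).comp
      (contDiff_id.prodMk contDiff_const)).differentiable (by simp)
  · rw [pd_cv (h1 m) (hasCompactSupport_apxKer ρ m) hf hB, fderiv_apxKer]
    exact abs_cv_timeCut_sub_le (integrable_locKerD ρ i) hf hB m (x, t)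

lemma pd_cv_locKer (ρ : ContDiffBump (0 : Euc d × ℝ)) {f : Euc d × ℝ → ℝ} {B : ℝ}
    (hf : Measurable f) (hB : ∀ y, |f y| ≤ B) (i : Fin d) (t : ℝ) :
    pd i (fun y => cv (locKer ρ) f (y, t)) = fun y => cv (locKerD ρ i) f (y, t) := by
  funext x
  rw [pd_eq_of_hasFDerivAt (hasFDerivAt_cv_locKer ρ hf hB x t)]
  simp

lemma cv_locKer_lipschitz (ρ : ContDiffBump (0 : Euc d × ℝ)) {f : Euc d × ℝ → ℝ} {B : ℝ}
    (hf : Measurable f) (hB : ∀ y, |f y| ≤ B) (x y : Euc d) (t : ℝ) :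
    |cv (locKer ρ) f (x, t) - cv (locKer ρ) f (y, t)| ≤
      (B * ∑ i, ∫ q, |locKerD ρ i q|) * ‖x - y‖ := by
  refine convex_univ.norm_image_sub_le_of_norm_hasFDerivWithin_le
    (f := fun y => cv (locKer ρ) f (y, t))
    (fun z _ => (hasFDerivAt_cv_locKer ρ hf hB z t).hasFDerivWithinAt) (fun z _ => ?_)
    (mem_univ y) (mem_univ x)
  refine (norm_sum_smul_proj_le _).trans ?_
  rw [Finset.mul_sum]
  exact Finset.sum_le_sum fun i _ => abs_cv_le (integrable_locKerD ρ i) hB _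

/-- The localized heat potential of a density that is Hölder continuous in space is twice
continuously differentiable in space. -/
lemma cv_locKer_space (ρ : ContDiffBump (0 : Euc d × ℝ)) {f : Euc d × ℝ → ℝ} {B H α : ℝ}
    (hα : 0 < α) (hf : Measurable f) (hB : ∀ y, |f y| ≤ B)
    (hH : ∀ x y t, |f (x, t) - f (y, t)| ≤ H * ‖x - y‖ ^ α) (t : ℝ) :
    ContDiff ℝ 2 (fun y => cv (locKer ρ) f (y, t)) ∧
      ∀ i j, pd j (pd i fun y => cv (locKer ρ) f (y, t)) = fun y => locPotDD ρ f i j (y, t) := by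
  have hK := contDiff_apxKer ρ
  have hKc := hasCompactSupport_apxKer ρ
  have h1 : ∀ {L : Euc d × ℝ → ℝ}, ContDiff ℝ ∞ L → ContDiff ℝ 1 L := fun h => contDiff_infty.1 h 1
  have hD : ∀ m v, ContDiff ℝ ∞ fun q => fderiv ℝ (apxKer ρ m) q v := fun m v =>
    continuous_fderiv_apply_of_contDiff (hK m) v
  have hDc : ∀ m v, HasCompactSupport fun q => fderiv ℝ (apxKer ρ m) q v := fun m v =>
    (hKc m).fderiv_apply ℝ v
  have hs : ∀ {L : Euc d × ℝ → ℝ}, ContDiff ℝ 1 L → ContDiff ℝ 1 fun y => L (y, t) := fun h =>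
    h.comp (contDiff_id.prodMk contDiff_const)
  have hSD : ∀ m v, ContDiff ℝ 1 fun y => cv (fun q => fderiv ℝ (apxKer ρ m) q v) f (y, t) :=
    fun m v => hs (contDiff_cv (n := 1) (h1 (hD m v)) (hDc m v) hf hB)
  have l2 : ∀ i j, Tendsto (fun m => H * ∫ q, |timeCut m q.2 * (‖q.1‖ ^ α * locKerDD ρ i j q) -
      ‖q.1‖ ^ α * locKerDD ρ i j q|) atTop (𝓝 0) := fun i j => by
    simpa using (tendsto_integral_timeCut (integrable_rpow_mul_locKerDD ρ i j hα)
      (fun z r hr => by rw [locKerDD_of_nonpos ρ i j hr, mul_zero])).const_mul H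
  have hp1 := fun i => pd_cv_locKer ρ hf hB i t
  have hd0 : Differentiable ℝ fun y => cv (locKer ρ) f (y, t) := fun x =>
    (hasFDerivAt_cv_locKer ρ hf hB x t).differentiableAt
  have c1 : ∀ i x, Tendsto (fun m => cv (fun q => fderiv ℝ (apxKer ρ m) q (spaceVec i)) f (x, t))
      atTop (𝓝 (cv (locKerD ρ i) f (x, t))) := fun i x => tendsto_of_abs_sub_le
      (tendsto_const_mul_integral_timeCut (integrable_locKerD ρ i)
        (fun z r => locKerD_of_nonpos ρ i) B) fun m => by
    rw [fderiv_apxKer]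
    exact abs_cv_timeCut_sub_le (integrable_locKerD ρ i) hf hB m (x, t)
  have b2 : ∀ i j m x, |pd j (fun y => cv (fun q => fderiv ℝ (apxKer ρ m) q (spaceVec i)) f (y, t))
      x - locPotDD ρ f i j (x, t)| ≤ H * ∫ q, |timeCut m q.2 * (‖q.1‖ ^ α * locKerDD ρ i j q) -
      ‖q.1‖ ^ α * locKerDD ρ i j q| := fun i j m x => by
    rw [pd_cv (h1 (hD m _)) (hDc m _) hf hB]
    exact abs_cv_apxKer_DD_sub_le ρ hα hf hB hH i j m (x, t)
  have hp2 : ∀ i j, pd j (fun y => cv (locKerD ρ i) f (y, t)) = fun y => locPotDD ρ f i j (y, t) :=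
    fun i => pd_of_uniform_pd (fun m => (hSD m _).differentiable (by simp)) (c1 i) (l2 i) (b2 i)
  have hd1 : ∀ i, Differentiable ℝ fun y => cv (locKerD ρ i) f (y, t) := fun i x =>
    (hasFDerivAt_of_uniform_pd (fun m => (hSD m _).differentiable (by simp)) (c1 i) (l2 i) (b2 i)
      x).differentiableAt
  have hc2 : ∀ i j, Continuous fun y => locPotDD ρ f i j (y, t) := fun i j => by
    refine continuous_of_uniform (fun m => ?_) (l2 i j) (b2 i j)
    rw [show (pd j fun y => cv (fun q => fderiv ℝ (apxKer ρ m) q (spaceVec i)) f (y, t)) = _ from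
      funext (pd_cv (h1 (hD m _)) (hDc m _) hf hB j t)]
    have := contDiff_cv (n := 0) ((continuous_fderiv_apply_of_contDiff (hD m (spaceVec i))
      (spaceVec j)).of_le (by simp)) ((hDc m _).fderiv_apply ℝ _) hf hB
    exact this.continuous.comp (by fun_prop)
  refine ⟨?_, fun i j => by rw [hp1, hp2]⟩
  have := contDiff_of_pd (n := 1) hd0 fun i => by
    rw [hp1]
    have := contDiff_of_pd (n := 0) (hd1 i) fun j => by
      rw [hp2]
      exact contDiff_zero.2 (hc2 i j)
    simpa using this
  norm_num at this
  exact this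

lemma deriv_timeCut_nonneg (m : ℕ) (r : ℝ) : 0 ≤ deriv (timeCut m) r := by
  refine Monotone.deriv_nonneg fun a b hab => smoothTransition.monotone ?_
  gcongr

lemma deriv_timeCut_eq_zero_of_lt {m : ℕ} {r : ℝ} (h : r < 1 / (m + 1)) :
    deriv (timeCut m) r = 0 := by
  have : timeCut m =ᶠ[𝓝 r] fun _ => 0 := by
    filter_upwards [gt_mem_nhds h] with s hs using timeCut_eq_zero (le_of_lt hs)
  rw [this.deriv_eq, deriv_const]

lemma deriv_timeCut_eq_zero_of_gt {m : ℕ} {r : ℝ} (h : 2 / (m + 1) < r) :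
    deriv (timeCut m) r = 0 := by
  have : timeCut m =ᶠ[𝓝 r] fun _ => 1 := by
    filter_upwards [lt_mem_nhds h] with s hs using timeCut_eq_one (le_of_lt hs)
  rw [this.deriv_eq, deriv_const]

lemma continuous_deriv_timeCut (m : ℕ) : Continuous (deriv (timeCut m)) :=
  (contDiff_timeCut m).continuous_deriv (by simp)

lemma hasCompactSupport_deriv_timeCut (m : ℕ) : HasCompactSupport (deriv (timeCut m)) := by
  refine HasCompactSupport.intro (isCompact_Icc (a := (1 : ℝ) / (m + 1)) (b := 2 / (m + 1)))
    fun r hr => ?_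
  rw [mem_Icc, not_and_or, not_le, not_le] at hr
  exact hr.elim deriv_timeCut_eq_zero_of_lt deriv_timeCut_eq_zero_of_gt

lemma integral_deriv_timeCut (m : ℕ) : ∫ r, deriv (timeCut m) r = 1 := by
  have h0 : (1 : ℝ) / (m + 1) ≤ 2 / (m + 1) := by gcongr; norm_num
  have hd : ∀ r, DifferentiableAt ℝ (timeCut m) r := fun r =>
    (contDiff_timeCut m).differentiable (by simp) r
  have := intervalIntegral.integral_deriv_eq_sub (f := timeCut m) (a := 0)
    (b := 2 / ((m : ℝ) + 1)) (fun r _ => hd r)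
    ((continuous_deriv_timeCut m).intervalIntegrable _ _)
  rw [timeCut_eq_one le_rfl, timeCut_eq_zero (by positivity), sub_zero,
    intervalIntegral.integral_of_le (by positivity)] at this
  rw [← this]
  symm
  refine setIntegral_eq_integral_of_forall_compl_eq_zero fun r hr => ?_
  rw [mem_Ioc, not_and_or, not_le, not_lt] at hr
  refine hr.elim (fun h => deriv_timeCut_eq_zero_of_lt (h.trans_lt (by positivity)))
    deriv_timeCut_eq_zero_of_gt

lemma deriv_timeCut_heat (m : ℕ) {c : ℝ} (hc : 0 < c) :
    Integrable (fun q : Euc d × ℝ => deriv (timeCut m) q.2 * heatKernel (q.1, c * q.2)) ∧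
      ∫ q : Euc d × ℝ, deriv (timeCut m) q.2 * heatKernel (q.1, c * q.2) = 1 := by
  have hm : Measurable fun q : Euc d × ℝ => deriv (timeCut m) q.2 * heatKernel (q.1, c * q.2) :=
    ((continuous_deriv_timeCut m).measurable.comp measurable_snd).mul
      (measurable_heatKernel.comp (by fun_prop))
  have e : ∀ r, ∫ z : Euc d, deriv (timeCut m) r * heatKernel (z, c * r) =
      deriv (timeCut m) r := fun r => by
    rw [integral_const_mul]
    rcases le_or_gt r 0 with hr | hr
    · rw [deriv_timeCut_eq_zero_of_lt (hr.trans_lt (by positivity)), zero_mul]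
    · rw [integral_heatKernel (by positivity), mul_one]
  have hi : Integrable fun q : Euc d × ℝ =>
      deriv (timeCut m) q.2 * heatKernel (q.1, c * q.2) := by
    rw [Measure.volume_eq_prod, integrable_prod_iff' hm.aestronglyMeasurable]
    refine ⟨Eventually.of_forall fun r => ?_, ?_⟩
    · show Integrable fun z : Euc d => deriv (timeCut m) r * heatKernel (z, c * r)
      refine Integrable.const_mul ?_ _
      rcases le_or_gt r 0 with hr | hr
      · simp [heatKernel_of_nonpos (mul_nonpos_of_nonneg_of_nonpos hc.le hr)]
      · exact integrable_heatKernel (by positivity)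
    · simp_rw [Real.norm_of_nonneg (mul_nonneg (deriv_timeCut_nonneg m _) (heatKernel_nonneg _)),
        e]
      exact (continuous_deriv_timeCut m).integrable_of_hasCompactSupport
        (hasCompactSupport_deriv_timeCut m)
  refine ⟨hi, ?_⟩
  rw [Measure.volume_eq_prod] at hi ⊢
  rw [integral_prod_symm _ hi]
  simp only [e, integral_deriv_timeCut]

lemma deriv_timeCut_heat_tail {δ : ℝ} (hδ : 0 < δ) :
    ∃ C : ℝ, 0 ≤ C ∧ ∀ m : ℕ, 2 / ((m : ℝ) + 1) < δ → ∀ q : Euc d × ℝ, δ ≤ ‖q‖ →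
      deriv (timeCut m) q.2 * heatKernel q ≤
        C / (m + 1) * (deriv (timeCut m) q.2 * heatKernel (q.1, 2 * q.2)) := by
  obtain ⟨C, hC, h⟩ := norm_rpow_mul_heatKernel_le (d := d) 2 zero_le_two
  refine ⟨C * 2 / δ ^ 2, by positivity, fun m hm ⟨z, r⟩ hq => ?_⟩
  simp only
  rcases lt_or_ge r (1 / (m + 1)) with h1 | h1
  · simp [deriv_timeCut_eq_zero_of_lt h1]
  rcases lt_or_ge (2 / ((m : ℝ) + 1)) r with h2 | h2
  · simp [deriv_timeCut_eq_zero_of_gt h2]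
  have hr : 0 < r := lt_of_lt_of_le (by positivity) h1
  have hz : δ ≤ ‖z‖ := by
    rw [Prod.norm_def, le_max_iff] at hq
    rcases hq with hq | hq
    · exact hq
    · simp only [Real.norm_of_nonneg hr.le] at hq
      linarith
  have h3 := h z r hr
  rw [show (2 : ℝ) / 2 = 1 by norm_num, rpow_one, rpow_two] at h3
  have h4 : heatKernel (z, r) ≤ C * 2 / δ ^ 2 / (m + 1) * heatKernel (z, 2 * r) := by
    have h5 : δ ^ 2 * heatKernel (z, r) ≤ C * (2 / (m + 1) * heatKernel (z, 2 * r)) := by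
      calc δ ^ 2 * heatKernel (z, r) ≤ ‖z‖ ^ 2 * heatKernel (z, r) := by
            gcongr
            exact heatKernel_nonneg _
        _ ≤ _ := h3
        _ ≤ _ := by
            gcongr
            exact heatKernel_nonneg _
    calc heatKernel (z, r) = δ ^ 2 * heatKernel (z, r) / δ ^ 2 := by field_simp
      _ ≤ C * (2 / (m + 1) * heatKernel (z, 2 * r)) / δ ^ 2 := by gcongr
      _ = _ := by ring
  calc _ ≤ deriv (timeCut m) r * (C * 2 / δ ^ 2 / (m + 1) * heatKernel (z, 2 * r)) :=
        mul_le_mul_of_nonneg_left h4 (deriv_timeCut_nonneg m r)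
    _ = _ := by ring

/-- The kernels `deriv (timeCut m) q.2 * locKer ρ q` form an approximate identity. -/
lemma tendstoUniformly_cv_deriv_timeCut (ρ : ContDiffBump (0 : Euc d × ℝ)) {f : Euc d × ℝ → ℝ}
    {B : ℝ} (hf : UniformContinuous f) (hB : ∀ y, |f y| ≤ B) :
    TendstoUniformly (fun m => cv (fun q => deriv (timeCut m) q.2 * locKer ρ q) f) f atTop := by
  rw [Metric.tendstoUniformly_iff]
  intro ε hε
  obtain ⟨δ', hδ', hfδ⟩ := Metric.uniformContinuous_iff.1 hf (ε / 2) (by positivity)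
  set δ := min δ' ρ.rIn with hδd
  have hδ : 0 < δ := lt_min hδ' ρ.rIn_pos
  obtain ⟨C, hC, hCm⟩ := deriv_timeCut_heat_tail (d := d) hδ
  have hB0 : 0 ≤ B := (abs_nonneg _).trans (hB 0)
  have t1 : Tendsto (fun m : ℕ => (2 : ℝ) / ((m : ℝ) + 1)) atTop (𝓝 0) := by
    simpa [div_eq_mul_inv] using tendsto_one_div_add_atTop_nhds_zero_nat.const_mul (2 : ℝ)
  have t2 : Tendsto (fun m : ℕ => 2 * B * C / ((m : ℝ) + 1)) atTop (𝓝 0) := by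
    simpa [div_eq_mul_inv] using tendsto_one_div_add_atTop_nhds_zero_nat.const_mul (2 * B * C)
  filter_upwards [t1.eventually (gt_mem_nhds hδ), t2.eventually (gt_mem_nhds (half_pos hε))]
    with m hm1 hm2 q
  obtain ⟨i1, v1⟩ : Integrable (fun q : Euc d × ℝ => deriv (timeCut m) q.2 * heatKernel q) ∧
      ∫ q : Euc d × ℝ, deriv (timeCut m) q.2 * heatKernel q = 1 := by
    simpa only [one_mul] using deriv_timeCut_heat (d := d) m one_pos
  obtain ⟨i2, v2⟩ := deriv_timeCut_heat (d := d) m two_pos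
  have hmeas : Measurable fun q : Euc d × ℝ => deriv (timeCut m) q.2 * locKer ρ q :=
    ((continuous_deriv_timeCut m).measurable.comp measurable_snd).mul (measurable_locKer ρ)
  have hK : Integrable fun q : Euc d × ℝ => deriv (timeCut m) q.2 * locKer ρ q :=
    i1.mono' hmeas.aestronglyMeasurable (Eventually.of_forall fun y => by
      rw [Real.norm_of_nonneg (mul_nonneg (deriv_timeCut_nonneg m _) (locKer_nonneg ρ _))]
      exact mul_le_mul_of_nonneg_left (locKer_le ρ y) (deriv_timeCut_nonneg m _))
  have e : f q = ∫ y : Euc d × ℝ, deriv (timeCut m) y.2 * heatKernel y * f q := by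
    rw [integral_mul_const, v1, one_mul]
  have key : |cv (fun q => deriv (timeCut m) q.2 * locKer ρ q) f q - f q| ≤
      ε / 2 * 1 + 2 * B * (C / (m + 1) * 1) := by
    have e1 : cv (fun q => deriv (timeCut m) q.2 * locKer ρ q) f q - f q =
        ∫ y : Euc d × ℝ, (deriv (timeCut m) y.2 * locKer ρ y * f (q - y) -
          deriv (timeCut m) y.2 * heatKernel y * f q) := by
      rw [integral_sub (integrable_mul_comp_sub hK hf.continuous.measurable hB q)
        (i1.mul_const _), ← e, cv]
    have e2 : ε / 2 * 1 + 2 * B * (C / (m + 1) * 1) = ∫ y : Euc d × ℝ,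
        (ε / 2 * (deriv (timeCut m) y.2 * heatKernel y) + 2 * B * (C / (m + 1) *
          (deriv (timeCut m) y.2 * heatKernel (y.1, 2 * y.2)))) := by
      rw [integral_add (i1.const_mul _) ((i2.const_mul _).const_mul _), integral_const_mul,
        integral_const_mul, integral_const_mul, v1, v2]
    rw [e1, e2, ← Real.norm_eq_abs]
    refine norm_integral_le_of_norm_le ((i1.const_mul _).add ((i2.const_mul _).const_mul _))
      (Eventually.of_forall fun y => ?_)
    rw [Real.norm_eq_abs]
    have a0 := mul_nonneg (deriv_timeCut_nonneg m y.2) (heatKernel_nonneg y)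
    have a1 := mul_nonneg (deriv_timeCut_nonneg m y.2) (heatKernel_nonneg (y.1, 2 * y.2))
    rcases lt_or_ge ‖y‖ δ with hy | hy
    · rw [locKer_eq_heatKernel ρ (hy.le.trans (min_le_right _ _)), ← mul_sub, abs_mul,
        abs_of_nonneg a0]
      have h1 : |f (q - y) - f q| ≤ ε / 2 := by
        rw [← Real.dist_eq]
        exact (hfδ (by simpa using hy.trans_le (min_le_left _ _))).le
      have h2 : 0 ≤ 2 * B *
          (C / (m + 1) * (deriv (timeCut m) y.2 * heatKernel (y.1, 2 * y.2))) := by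
        positivity
      nlinarith
    · have h1 := hCm m hm1 y hy
      have h2 : |deriv (timeCut m) y.2 * locKer ρ y * f (q - y)| ≤
          deriv (timeCut m) y.2 * heatKernel y * B := by
        rw [abs_mul, abs_of_nonneg (mul_nonneg (deriv_timeCut_nonneg m _) (locKer_nonneg ρ _))]
        exact mul_le_mul (mul_le_mul_of_nonneg_left (locKer_le ρ y) (deriv_timeCut_nonneg m _))
          (hB _) (abs_nonneg _) a0
      have h3 : |deriv (timeCut m) y.2 * heatKernel y * f q| ≤
          deriv (timeCut m) y.2 * heatKernel y * B := by
        rw [abs_mul, abs_of_nonneg a0]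
        exact mul_le_mul_of_nonneg_left (hB _) a0
      have h4 := abs_sub (deriv (timeCut m) y.2 * locKer ρ y * f (q - y))
        (deriv (timeCut m) y.2 * heatKernel y * f q)
      have h5 : 0 ≤ ε / 2 * (deriv (timeCut m) y.2 * heatKernel y) := by positivity
      nlinarith
  rw [dist_comm, Real.dist_eq]
  refine key.trans_lt ?_
  have : 2 * B * (C / ((m : ℝ) + 1) * 1) = 2 * B * C / (m + 1) := by ring
  linarith

/-- Interior regularity of the localized heat potential of a Hölder continuous density. -/
lemma heatAt_cv_locKer (ρ : ContDiffBump (0 : Euc d × ℝ)) {f : Euc d × ℝ → ℝ} {B H α : ℝ}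
    (hα : 0 < α) (hf : UniformContinuous f) (hB : ∀ y, |f y| ≤ B)
    (hH : ∀ x y t, |f (x, t) - f (y, t)| ≤ H * ‖x - y‖ ^ α) (q : Euc d × ℝ) :
    HeatAt (cv (locKer ρ) f) (fun y => f y - cv (defKer ρ) f y) q := by
  have hfm := hf.continuous.measurable
  obtain ⟨x, t⟩ := q
  obtain ⟨hs2, hsdd⟩ := cv_locKer_space ρ hα hfm hB hH t
  have hK := contDiff_apxKer ρ
  have hKc := hasCompactSupport_apxKer ρ
  have h1 : ∀ {L : Euc d × ℝ → ℝ}, ContDiff ℝ ∞ L → ContDiff ℝ 1 L := fun h => contDiff_infty.1 h 1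
  have hD : ∀ m v, ContDiff ℝ ∞ fun q => fderiv ℝ (apxKer ρ m) q v := fun m v =>
    continuous_fderiv_apply_of_contDiff (hK m) v
  have hDc : ∀ m v, HasCompactSupport fun q => fderiv ℝ (apxKer ρ m) q v := fun m v =>
    (hKc m).fderiv_apply ℝ v
  have hS : ∀ m, ContDiff ℝ ∞ (cv (apxKer ρ m) f) := fun m => contDiff_cv (n := ⊤) (hK m) (hKc m)
    hfm hB
  set A : ℕ → Euc d × ℝ → ℝ := fun m => cv (fun q => deriv (timeCut m) q.2 * locKer ρ q) f with hA
  set G : Euc d × ℝ → ℝ := fun y => 1 / 2 * ∑ i, locPotDD ρ f i i y +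
    (f y - cv (defKer ρ) f y) with hG
  set dd : ℕ → Fin d → Euc d × ℝ → ℝ := fun m i => cv (fun q => fderiv ℝ (fun q =>
    fderiv ℝ (apxKer ρ m) q (spaceVec i)) q (spaceVec i)) f with hdd
  have hdef : ∀ m, Integrable fun q => timeCut m q.2 * defKer ρ q := fun m =>
    integrable_timeCut_mul (integrable_defKer ρ) m
  have hder : ∀ m y, deriv (fun s => cv (apxKer ρ m) f (y.1, s)) y.2 =
      1 / 2 * ∑ i, dd m i y + (A m y - cv (fun q => timeCut m q.2 * defKer ρ q) f y) :=
      fun m y => by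
    have e1 := heatOp_cv (hK m) (hKc m) hfm hB y
    have e2 : heatOp (apxKer ρ m) = fun q => deriv (timeCut m) q.2 * locKer ρ q -
      timeCut m q.2 * defKer ρ q := funext (heatOp_apxKer ρ m)
    have hint : Integrable fun q => deriv (timeCut m) q.2 * locKer ρ q := by
      have h0 : Integrable (heatOp (apxKer ρ m)) :=
        (contDiff_heatOp (hK m)).continuous.integrable_of_hasCompactSupport (by
          refine HasCompactSupport.intro (hKc m) fun z hz => ?_
          rw [heatOp_congr (notMem_tsupport_iff_eventuallyEq.1 hz)]
          exact heatOp_zero z)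
      refine (h0.add (hdef m)).congr (Eventually.of_forall fun z => ?_)
      simp [e2]
    rw [e2, cv_sub_left hint (hdef m) hfm hB, heatOp] at e1
    have e3 : ∀ i, pd i (pd i fun z => cv (apxKer ρ m) f (z, y.2)) y.1 = dd m i y := fun i => by
      rw [pd_pd_space_slice (contDiff_infty.1 (hS m) 2).contDiffAt,
        fderiv_cv_apply_fun (h1 (hK m)) (hKc m) hfm hB,
        fderiv_cv_apply (h1 (hD m _)) (hDc m _) hfm hB]
    simp only [e3] at e1
    simp only [hA]
    linarith
  have hu : TendstoUniformly (fun m y => deriv (fun s => cv (apxKer ρ m) f (y.1, s)) y.2) G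
      atTop := by
    have l2 : ∀ i, Tendsto (fun m => H * ∫ q, |timeCut m q.2 * (‖q.1‖ ^ α * locKerDD ρ i i q) -
        ‖q.1‖ ^ α * locKerDD ρ i i q|) atTop (𝓝 0) := fun i => by
      simpa using (tendsto_integral_timeCut (integrable_rpow_mul_locKerDD ρ i i hα)
        (fun z r hr => by rw [locKerDD_of_nonpos ρ i i hr, mul_zero])).const_mul H
    have l3 := (tendsto_finsetSum Finset.univ fun i _ => l2 i).const_mul (1 / 2)
    have l4 := l3.add (tendsto_const_mul_integral_timeCut (integrable_defKer ρ)
      (fun z r => defKer_of_nonpos ρ) B)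
    simp only [Finset.sum_const_zero, mul_zero, add_zero] at l4
    rw [Metric.tendstoUniformly_iff]
    intro ε hε
    filter_upwards [l4.eventually (gt_mem_nhds (half_pos hε)),
      (Metric.tendstoUniformly_iff.1 (tendstoUniformly_cv_deriv_timeCut ρ hf hB)) (ε / 2)
        (half_pos hε)] with m hm hm' y
    rw [dist_comm, Real.dist_eq, hder]
    have b1 : |∑ i, dd m i y - ∑ i, locPotDD ρ f i i y| ≤ _ :=
      (by rw [← Finset.sum_sub_distrib]; exact Finset.abs_sum_le_sum_abs _ _ : _ ≤ _).trans
      (Finset.sum_le_sum fun i _ => abs_cv_apxKer_DD_sub_le ρ hα hfm hB hH i i m y)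
    have b2 := abs_cv_timeCut_sub_le (integrable_defKer ρ) hfm hB m y
    have b3 := hm' y
    rw [dist_comm, Real.dist_eq] at b3
    simp only [hG]
    rw [abs_lt] at b3 ⊢
    rw [abs_le] at b1 b2
    constructor <;> simp only [hA] at * <;> linarith [b1.1, b1.2, b2.1, b2.2, b3.1, b3.2]
  have hd : ∀ s, HasDerivAt (fun s => cv (locKer ρ) f (x, s)) (G (x, s)) s := by
    refine hasDerivAt_of_tendstoUniformly (l := atTop)
      (f := fun m s => cv (apxKer ρ m) f (x, s)) (f' := fun m s =>
        deriv (fun s => cv (apxKer ρ m) f (x, s)) s) (hu.comp fun s : ℝ => (x, s))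
      (Eventually.of_forall fun m s => ?_) fun s => ?_
    · exact (((hS m).comp (contDiff_const.prodMk contDiff_id)).differentiable (by simp)
        s).hasDerivAt
    · exact tendsto_of_abs_sub_le (tendsto_const_mul_integral_timeCut (integrable_locKer ρ)
        (fun z r => locKer_of_nonpos ρ) B) fun m =>
          abs_cv_timeCut_sub_le (integrable_locKer ρ) hfm hB m (x, s)
  have hGc : Continuous fun s => G (x, s) := by
    refine (hu.comp fun s : ℝ => (x, s)).continuous (Eventually.of_forall fun m => ?_).frequently
    exact ((hS m).comp (contDiff_const.prodMk contDiff_id)).continuous_deriv (by simp)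
  refine ⟨hs2.contDiffAt, ?_, ?_⟩
  · refine ContDiff.contDiffAt (contDiff_one_iff_deriv.2 ⟨fun s => (hd s).differentiableAt, ?_⟩)
    rwa [show deriv (fun s => cv (locKer ρ) f (x, s)) = fun s => G (x, s) from
      funext fun s => (hd s).deriv]
  · simp only [(hd t).deriv, hG, hsdd]

lemma deriv_deriv_nonpos_of_isLocalMax {g : ℝ → ℝ} {a : ℝ} (h : IsLocalMax g a)
    (hg : ContinuousAt g a) : deriv (deriv g) a ≤ 0 := by
  by_contra! hpos
  have hmin := isLocalMin_of_deriv_deriv_pos hpos h.deriv_eq_zero hg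
  have hc : g =ᶠ[𝓝 a] fun _ => g a := by
    filter_upwards [h, hmin] with s h1 h2 using le_antisymm h1 h2
  rw [hc.deriv.deriv_eq] at hpos
  simp at hpos

lemma hasDerivAt_comp_line {f : Euc d → ℝ} {x : Euc d} (i : Fin d) {s : ℝ}
    (hf : DifferentiableAt ℝ f (x + s • EuclideanSpace.single i 1)) :
    HasDerivAt (fun s : ℝ => f (x + s • EuclideanSpace.single i 1))
      (pd i f (x + s • EuclideanSpace.single i 1)) s := by
  have h1 : HasDerivAt (fun s : ℝ => x + s • (EuclideanSpace.single i (1 : ℝ) : Euc d))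
      (EuclideanSpace.single i 1) s := by
    simpa using ((hasDerivAt_id s).smul_const (EuclideanSpace.single i (1 : ℝ) : Euc d)).const_add x
  exact hf.hasFDerivAt.comp_hasDerivAt s h1

lemma pd_pd_nonpos_of_isLocalMax {f : Euc d → ℝ} {x : Euc d} (h : IsLocalMax f x)
    (hf : ContDiffAt ℝ 2 f x) (i : Fin d) : pd i (pd i f) x ≤ 0 := by
  set g : ℝ → ℝ := fun s => f (x + s • EuclideanSpace.single i 1) with hg
  have hline : Tendsto (fun s : ℝ => x + s • (EuclideanSpace.single i (1 : ℝ) : Euc d)) (𝓝 0)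
      (𝓝 x) := by
    have : Continuous fun s : ℝ => x + s • (EuclideanSpace.single i (1 : ℝ) : Euc d) := by fun_prop
    simpa using this.tendsto 0
  have h1 : deriv g =ᶠ[𝓝 0] fun s => pd i f (x + s • EuclideanSpace.single i 1) := by
    filter_upwards [hline.eventually (hf.eventually (by simp))] with s hs
    exact (hasDerivAt_comp_line i (hs.differentiableAt (by simp))).deriv
  have h2 : deriv (deriv g) 0 = pd i (pd i f) x := by
    have hp : DifferentiableAt ℝ (pd i f) x :=
      (contDiffAt_pd (n := 1) (by simpa [one_add_one_eq_two] using hf) i).differentiableAt (by simp)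
    have := hasDerivAt_comp_line (f := pd i f) (x := x) i (s := 0) (by simpa using hp)
    rw [h1.deriv_eq, this.deriv]
    simp
  rw [← h2]
  refine deriv_deriv_nonpos_of_isLocalMax ?_ ?_
  · have := hline.eventually h
    simpa [IsLocalMax, IsMaxFilter, hg] using this
  · exact (hasDerivAt_comp_line (f := f) (x := x) i (s := 0)
      (by simpa using hf.differentiableAt (by simp))).continuousAt

lemma deriv_nonneg_of_le_left {g : ℝ → ℝ} {a t g' : ℝ} (ha : a < t) (hg : HasDerivAt g g' t)
    (h : ∀ s ∈ Ioo a t, g s ≤ g t) : 0 ≤ g' := by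
  have h1 := hasDerivAt_iff_tendsto_slope_left_right.1 hg
  refine ge_of_tendsto h1.1 ?_
  filter_upwards [Ioo_mem_nhdsLT ha] with s hs
  rw [slope_def_field]
  exact div_nonneg_of_nonpos (by linarith [h s hs]) (by linarith [hs.2])

/-- The weak parabolic maximum principle. -/
lemma heat_max_principle {O : Set (Euc d)} (hO : IsOpen O) {T b : ℝ} {D F : Euc d × ℝ → ℝ}
    (hDc : ContinuousOn D (O ×ˢ Icc 0 T)) (h0 : ∀ x ∈ O, D (x, 0) ≤ 0)
    (hK : ∀ m > 0, ∃ K ⊆ O, IsCompact K ∧ ∀ x ∈ O, ∀ t ∈ Icc 0 T, m ≤ D (x, t) → x ∈ K)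
    (hH : ∀ x ∈ O, ∀ t ∈ Ioc 0 T, 0 < D (x, t) →
      HeatAt D F (x, t) ∧ F (x, t) ≤ b * D (x, t)) :
    ∀ x ∈ O, ∀ t ∈ Icc 0 T, D (x, t) ≤ 0 := by
  intro x₁ hx₁ t₁ ht₁
  by_contra! hpos
  set l := |b| + 1 with hl
  have hl0 : 0 < l := by positivity
  set E : Euc d × ℝ → ℝ := fun q => exp (-l * q.2) * D q with hE
  have hED : ∀ q : Euc d × ℝ, 0 ≤ q.2 → 0 < D q → E q ≤ D q := fun q hq hD =>
    mul_le_of_le_one_left hD.le (exp_le_one_iff.2 (by nlinarith))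
  have hEpos : ∀ q : Euc d × ℝ, 0 < E q → 0 < D q := fun q hq =>
    pos_of_mul_pos_right hq (exp_pos _).le
  have hμ : 0 < E (x₁, t₁) := mul_pos (exp_pos _) hpos
  obtain ⟨K, hKO, hKc, hKm⟩ := hK _ hμ
  have hin : ∀ x ∈ O, ∀ t ∈ Icc 0 T, E (x₁, t₁) ≤ E (x, t) → x ∈ K := fun x hx t ht h =>
    hKm x hx t ht (h.trans (hED (x, t) ht.1 (hEpos _ (hμ.trans_le h))))
  obtain ⟨⟨x, t⟩, ⟨hxK, ht⟩, hmax⟩ := (hKc.prod isCompact_Icc).exists_isMaxOn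
    ⟨(x₁, t₁), hin x₁ hx₁ t₁ ht₁ le_rfl, ht₁⟩ (f := E) (by
      refine ContinuousOn.mul (by fun_prop) (hDc.mono (prod_mono_left hKO)))
  simp only at hxK ht
  have hxO := hKO hxK
  have hglob : ∀ y ∈ O, ∀ s ∈ Icc 0 T, E (y, s) ≤ E (x, t) := fun y hy s hs => by
    by_cases hyK : y ∈ K
    · exact hmax ⟨hyK, hs⟩
    · exact (le_of_not_ge fun h => hyK (hin y hy s hs h)).trans
        (hmax ⟨hin x₁ hx₁ t₁ ht₁ le_rfl, ht₁⟩)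
  have hEx : 0 < E (x, t) := hμ.trans_le (hglob x₁ hx₁ t₁ ht₁)
  have hDx : 0 < D (x, t) := hEpos _ hEx
  have ht0 : 0 < t := by
    refine lt_of_le_of_ne ht.1 fun h => ?_
    rw [← h] at hDx
    linarith [h0 x hxO]
  obtain ⟨⟨hs2, ht1, heq⟩, hF⟩ := hH x hxO t ⟨ht0, ht.2⟩ hDx
  simp only at hs2 ht1 heq
  have hspace : ∀ i, pd i (pd i fun y => D (y, t)) x ≤ 0 := fun i => by
    refine pd_pd_nonpos_of_isLocalMax ?_ hs2 i
    filter_upwards [hO.mem_nhds hxO] with y hy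
    exact le_of_mul_le_mul_left (hglob y hy t ht) (exp_pos _)
  have htime := (ht1.differentiableAt (by simp)).hasDerivAt
  have hexp : HasDerivAt (fun s : ℝ => exp (-l * s)) (exp (-l * t) * (-l)) t := by
    simpa using ((hasDerivAt_id t).const_mul (-l)).exp
  have h2 := deriv_nonneg_of_le_left ht0 (hexp.fun_mul htime) fun s hs =>
    hglob x hxO s ⟨hs.1.le, hs.2.le.trans ht.2⟩
  have h3 : 0 ≤ -l * D (x, t) + deriv (fun s => D (x, s)) t := by
    refine nonneg_of_mul_nonneg_right (a := exp (-l * t)) ?_ (exp_pos _)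
    linarith
  have h4 : ∑ i, pd i (pd i fun y => D (y, t)) x ≤ 0 := Finset.sum_nonpos fun i _ => hspace i
  have h5 : b * D (x, t) < l * D (x, t) := by
    have : b < l := by linarith [le_abs_self b]
    gcongr
  linarith

lemma hasFDerivAt_normSq_sub (a x : Euc d) :
    HasFDerivAt (fun y : Euc d => ‖y - a‖ ^ 2) ((2 : ℝ) • innerSL ℝ (x - a)) x := by
  have h := (hasStrictFDerivAt_norm_sq (x - a)).hasFDerivAt.comp x
    ((hasFDerivAt_id x).sub_const a)
  refine h.congr_fderiv ?_
  ext v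
  simp [two_smul]

lemma pd_radial {h : ℝ → ℝ} {h' : ℝ} {a x : Euc d} (hh : HasDerivAt h h' (‖x - a‖ ^ 2))
    (i : Fin d) : pd i (fun y => h (‖y - a‖ ^ 2)) x = 2 * (h' * (x i - a i)) := by
  have hc : HasFDerivAt (fun y => h (‖y - a‖ ^ 2)) _ x :=
    hh.comp_hasFDerivAt x (hasFDerivAt_normSq_sub a x)
  rw [pd_eq_of_hasFDerivAt hc]
  simp [EuclideanSpace.inner_single_right]
  ring

lemma sum_sq_coord_sub (a x : Euc d) : ∑ i, (x i - a i) ^ 2 = ‖x - a‖ ^ 2 := by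
  simp [EuclideanSpace.norm_sq_eq]

/-- The Laplacian of a radial function. -/
lemma sum_pd_pd_radial {h h₁ : ℝ → ℝ} {h₂ : ℝ} {a x : Euc d}
    (hh : ∀ᶠ s in 𝓝 (‖x - a‖ ^ 2), HasDerivAt h (h₁ s) s)
    (hh₁ : HasDerivAt h₁ h₂ (‖x - a‖ ^ 2)) :
    ∑ i, pd i (pd i fun y => h (‖y - a‖ ^ 2)) x =
      4 * ‖x - a‖ ^ 2 * h₂ + 2 * d * h₁ (‖x - a‖ ^ 2) := by
  have key : ∀ i, pd i (pd i fun y => h (‖y - a‖ ^ 2)) x =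
      4 * h₂ * (x i - a i) ^ 2 + 2 * h₁ (‖x - a‖ ^ 2) := fun i => by
    have hc : Tendsto (fun y : Euc d => ‖y - a‖ ^ 2) (𝓝 x) (𝓝 (‖x - a‖ ^ 2)) :=
      (hasFDerivAt_normSq_sub a x).continuousAt
    have e : pd i (fun y => h (‖y - a‖ ^ 2)) =ᶠ[𝓝 x]
        fun y => 2 * (h₁ (‖y - a‖ ^ 2) * (y i - a i)) := by
      filter_upwards [hc.eventually hh] with y hy using pd_radial hy i
    have hi : HasFDerivAt (fun y : Euc d => y i - a i)
        (EuclideanSpace.proj i : Euc d →L[ℝ] ℝ) x :=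
      (EuclideanSpace.proj i : Euc d →L[ℝ] ℝ).hasFDerivAt.sub_const _
    have h1 : HasFDerivAt (fun y => h₁ (‖y - a‖ ^ 2)) _ x :=
      hh₁.comp_hasFDerivAt x (hasFDerivAt_normSq_sub a x)
    rw [pd_congr e, pd_eq_of_hasFDerivAt ((h1.fun_mul hi).const_mul 2)]
    simp [EuclideanSpace.inner_single_right]
    ring
  simp only [key, Finset.sum_add_distrib, ← Finset.mul_sum, sum_sq_coord_sub]
  simp
  ring

/-- The maximum principle for bounded functions on the whole space. -/
lemma heat_max_principle_of_le {T M : ℝ} {D F : Euc d × ℝ → ℝ}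
    (hDc : ContinuousOn D (univ ×ˢ Icc 0 T)) (h0 : ∀ x, D (x, 0) ≤ 0)
    (hM : ∀ x, ∀ t ∈ Icc 0 T, D (x, t) ≤ M)
    (hH : ∀ x, ∀ t ∈ Ioc 0 T, 0 < D (x, t) → HeatAt D F (x, t) ∧ F (x, t) ≤ 0) :
    ∀ x, ∀ t ∈ Icc 0 T, D (x, t) ≤ 0 := by
  intro x₀ t₀ ht₀
  set g : ℝ → Euc d × ℝ → ℝ := fun ε q => ε * (‖q.1‖ ^ 2 + (d + 1) * q.2) with hg
  have hgs : ∀ ε, ContDiff ℝ ∞ (g ε) := fun ε =>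
    contDiff_const.mul (((contDiff_norm_sq ℝ).comp contDiff_fst).add
      (contDiff_const.mul contDiff_snd))
  have hgh : ∀ ε q, heatOp (g ε) q = ε := fun ε q => by
    have h1 : ∑ i, pd i (pd i fun y => g ε (y, q.2)) q.1 = 2 * d * ε := by
      have := sum_pd_pd_radial (h := fun s => ε * (s + (d + 1) * q.2)) (h₁ := fun _ => ε)
        (a := 0) (x := q.1) (Eventually.of_forall fun s => by
          simpa using ((hasDerivAt_id s).add_const ((d + 1 : ℝ) * q.2)).const_mul ε)
        (hasDerivAt_const _ _)
      simpa using this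
    have h2 : deriv (fun s => g ε (q.1, s)) q.2 = ε * (d + 1) := by
      have h3 : HasDerivAt (fun s => g ε (q.1, s)) (ε * ((d + 1) * 1)) q.2 :=
        (((hasDerivAt_id q.2).const_mul (d + 1 : ℝ)).const_add (‖q.1‖ ^ 2)).const_mul ε
      rw [h3.deriv, mul_one]
    rw [heatOp, h1, h2]
    ring
  have hε : ∀ ε > 0, D (x₀, t₀) ≤ g ε (x₀, t₀) := fun ε hε => by
    have := heat_max_principle isOpen_univ (T := T) (b := 0) (D := fun q => D q - g ε q)
      (F := fun q => F q - ε) (hDc.sub (hgs ε).continuous.continuousOn) (fun x _ => ?_)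
      (fun m hm => ⟨Metric.closedBall 0 (M / ε + 1), subset_univ _,
        isCompact_closedBall _ _, fun x _ t ht h => ?_⟩)
      (fun x _ t ht hpos => ⟨?_, ?_⟩) x₀ (mem_univ _) t₀ ht₀
    · linarith
    · have : 0 ≤ g ε (x, 0) := by simp only [hg]; positivity
      linarith [h0 x]
    · have h1 := hM x t ht
      have h2 : ε * ‖x‖ ^ 2 ≤ g ε (x, t) := by
        simp only [hg]
        have := ht.1
        gcongr
        exact le_add_of_nonneg_right (by positivity)
      have h3 : ‖x‖ ^ 2 ≤ M / ε := by
        rw [le_div_iff₀ hε]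
        linarith
      rw [mem_closedBall_zero_iff]
      nlinarith [norm_nonneg x]
    · have h1 : 0 ≤ g ε (x, t) := by
        have := ht.1
        simp only [hg]; positivity
      have := (hH x t ht (by linarith)).1.sub ((hgs ε).heatAt (x, t))
      exact this.congr (Eventually.of_forall fun _ => rfl) (by simp only [hgh])
    · have h1 : 0 ≤ g ε (x, t) := by
        have := ht.1
        simp only [hg]; positivity
      have := (hH x t ht (by linarith)).2
      linarith
  have hlim : Tendsto (fun ε => g ε (x₀, t₀)) (𝓝[>] 0) (𝓝 0) := by
    have : Continuous fun ε => g ε (x₀, t₀) := by simp only [hg]; fun_prop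
    have h := this.tendsto 0
    simp only [hg, zero_mul] at h
    exact h.mono_left nhdsWithin_le_nhds
  exact ge_of_tendsto hlim (eventually_mem_nhdsWithin.mono fun ε hε' => hε ε hε')

/-- The heat kernel restricted to times before `T`. -/
noncomputable def truncKer (T : ℝ) (q : Euc d × ℝ) : ℝ :=
  if q.2 < T then heatKernel q else 0

lemma measurable_truncKer (T : ℝ) : Measurable (truncKer (d := d) T) :=
  Measurable.ite (measurableSet_lt measurable_snd measurable_const) measurable_heatKernel
    measurable_const

lemma truncKer_nonneg (T : ℝ) (q : Euc d × ℝ) : 0 ≤ truncKer T q := by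
  unfold truncKer
  split_ifs
  exacts [heatKernel_nonneg q, le_rfl]

lemma integrable_truncKer (T : ℝ) : Integrable (truncKer (d := d) T) := by
  have h := (measurable_truncKer (d := d) T).aestronglyMeasurable (μ := volume)
  rw [Measure.volume_eq_prod] at h ⊢
  rw [integrable_prod_iff' h]
  have hs : ∀ r, ∫ z : Euc d, ‖truncKer T (z, r)‖ = (Ioo 0 T).indicator (fun _ => 1) r :=
      fun r => by
    simp_rw [Real.norm_of_nonneg (truncKer_nonneg _ _)]
    by_cases hT : r < T
    · rcases le_or_gt r 0 with hr | hr
      · simp [truncKer, heatKernel_of_nonpos hr, not_lt.2 hr]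
      · simp [truncKer, hT, integral_heatKernel hr, hr]
    · simp [truncKer, hT]
  refine ⟨Eventually.of_forall fun r => ?_, ?_⟩
  · by_cases hT : r < T
    · simp only [truncKer, hT, if_true]
      rcases le_or_gt r 0 with hr | hr
      · simp [heatKernel_of_nonpos hr]
      · exact integrable_heatKernel hr
    · simp [truncKer, hT]
  · simp only [hs]
    exact (integrable_indicator_iff measurableSet_Ioo).2 (by simp)

lemma heatKernel_mul_eq_truncKer_mul {f : Euc d × ℝ → ℝ} (hf0 : ∀ x t, t ≤ 0 → f (x, t) = 0)
    {T : ℝ} {q : Euc d × ℝ} (hq : q.2 ≤ T) (y : Euc d × ℝ) :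
    heatKernel y * f (q - y) = truncKer T y * f (q - y) := by
  by_cases hy : y.2 < T
  · simp [truncKer, hy]
  · rw [show f (q - y) = 0 from hf0 _ _ (sub_nonpos.2 (by linarith))]
    simp

lemma cv_heatKernel_eq_truncKer {f : Euc d × ℝ → ℝ} (hf0 : ∀ x t, t ≤ 0 → f (x, t) = 0)
    {T : ℝ} {q : Euc d × ℝ} (hq : q.2 ≤ T) : cv heatKernel f q = cv (truncKer T) f q :=
  integral_congr_ae (Eventually.of_forall (heatKernel_mul_eq_truncKer_mul hf0 hq))

lemma integrable_heatKernel_mul {f : Euc d × ℝ → ℝ} {B : ℝ} (hf : Measurable f)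
    (hB : ∀ y, |f y| ≤ B) (hf0 : ∀ x t, t ≤ 0 → f (x, t) = 0) (q : Euc d × ℝ) :
    Integrable fun y => heatKernel y * f (q - y) := by
  simp only [heatKernel_mul_eq_truncKer_mul hf0 le_rfl]
  exact integrable_mul_comp_sub (integrable_truncKer _) hf hB q

lemma abs_cv_heatKernel_le {f : Euc d × ℝ → ℝ} {B : ℝ} (hB : ∀ y, |f y| ≤ B)
    (hf0 : ∀ x t, t ≤ 0 → f (x, t) = 0) {T : ℝ} {q : Euc d × ℝ} (hq : q.2 ≤ T) :
    |cv heatKernel f q| ≤ B * ∫ y : Euc d × ℝ, |truncKer T y| := by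
  rw [cv_heatKernel_eq_truncKer hf0 hq]
  exact abs_cv_le (integrable_truncKer T) hB q

lemma cv_heatKernel_of_nonpos {f : Euc d × ℝ → ℝ} (hf0 : ∀ x t, t ≤ 0 → f (x, t) = 0)
    (x : Euc d) {t : ℝ} (ht : t ≤ 0) : cv heatKernel f (x, t) = 0 := by
  rw [cv_heatKernel_eq_truncKer hf0 (T := 0) ht]
  refine integral_eq_zero_of_ae (Eventually.of_forall fun y => ?_)
  have : truncKer 0 y = 0 := by
    unfold truncKer
    split_ifs with h
    exacts [heatKernel_of_nonpos (z := y.1) h.le, rfl]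
  simp [this]

lemma continuous_cv_heatKernel {f : Euc d × ℝ → ℝ} {B : ℝ} (hf : Measurable f)
    (hB : ∀ y, |f y| ≤ B) (hf0 : ∀ x t, t ≤ 0 → f (x, t) = 0) :
    Continuous (cv heatKernel f) := by
  rw [continuous_iff_continuousAt]
  intro q
  refine ((continuous_cv (integrable_truncKer (q.2 + 1)) hf hB).continuousAt).congr ?_
  filter_upwards [(continuous_snd.tendsto q).eventually (gt_mem_nhds (lt_add_one q.2))] with y hy
  exact (cv_heatKernel_eq_truncKer hf0 (le_of_lt hy)).symm

/-- On bounded regions the heat potential of a density with bounded support in space is a localized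
heat potential. -/
lemma kernel_mul_eq_of_bounded_support {f : Euc d × ℝ → ℝ} {L R : ℝ}
    (hf0 : ∀ x t, t ≤ 0 → f (x, t) = 0) (hfL : ∀ x t, L ≤ ‖x‖ → f (x, t) = 0)
    (ρ : ContDiffBump (0 : Euc d × ℝ)) (hρ : L + R + |R| < ρ.rIn) {x : Euc d} {t : ℝ}
    (hL : 0 ≤ L) (hx : ‖x‖ ≤ R) (ht : t ≤ R) (y : Euc d × ℝ) :
    heatKernel y * f ((x, t) - y) = locKer ρ y * f ((x, t) - y) ∧
      defKer ρ y * f ((x, t) - y) = 0 := by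
  rcases lt_or_ge ‖y‖ ρ.rIn with hy | hy
  · rw [locKer_eq_heatKernel ρ hy.le, defKer_of_lt_rIn ρ hy]
    simp
  · rcases le_or_gt y.2 0 with h0 | h0
    · rw [show heatKernel y = 0 from heatKernel_of_nonpos (z := y.1) h0,
        show locKer ρ y = 0 from locKer_of_nonpos ρ (z := y.1) h0,
        show defKer ρ y = 0 from defKer_of_nonpos ρ (z := y.1) h0]
      simp
    · have : f ((x, t) - y) = 0 := by
        rw [Prod.norm_def, le_max_iff, Real.norm_of_nonneg h0.le] at hy
        rcases hy with hy | hy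
        · refine hfL _ _ ?_
          have h1 := norm_sub_norm_le y.1 x
          rw [norm_sub_rev] at h1
          simp only
          linarith [abs_nonneg R]
        · exact hf0 _ _ (by simp only; linarith [abs_nonneg R])
      simp [this]

lemma exists_bump_eq_locKer {f : Euc d × ℝ → ℝ} {L : ℝ}
    (hf0 : ∀ x t, t ≤ 0 → f (x, t) = 0) (hfL : ∀ x t, L ≤ ‖x‖ → f (x, t) = 0) (hL : 0 ≤ L)
    (R : ℝ) : ∃ ρ : ContDiffBump (0 : Euc d × ℝ), ∀ (x : Euc d) t, ‖x‖ ≤ R → t ≤ R →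
      cv heatKernel f (x, t) = cv (locKer ρ) f (x, t) ∧ cv (defKer ρ) f (x, t) = 0 := by
  refine ⟨⟨L + |R| + |R| + 1, L + |R| + |R| + 2, by positivity, by linarith⟩,
    fun x t hx ht => ⟨?_, ?_⟩⟩
  · refine integral_congr_ae (Eventually.of_forall fun y => ?_)
    exact (kernel_mul_eq_of_bounded_support hf0 hfL _ (by dsimp only; linarith [le_abs_self R])
      hL hx ht y).1
  · refine integral_eq_zero_of_ae (Eventually.of_forall fun y => ?_)
    exact (kernel_mul_eq_of_bounded_support hf0 hfL _ (by dsimp only; linarith [le_abs_self R])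
      hL hx ht y).2

lemma cv_heatKernel_lipschitz {f : Euc d × ℝ → ℝ} {B L : ℝ} (hf : Measurable f)
    (hB : ∀ y, |f y| ≤ B) (hf0 : ∀ x t, t ≤ 0 → f (x, t) = 0)
    (hfL : ∀ x t, L ≤ ‖x‖ → f (x, t) = 0) (hL : 0 ≤ L) (R : ℝ) :
    ∃ C, 0 ≤ C ∧ ∀ x y t, ‖x‖ ≤ R → ‖y‖ ≤ R → t ≤ R →
      |cv heatKernel f (x, t) - cv heatKernel f (y, t)| ≤ C * ‖x - y‖ := by
  obtain ⟨ρ, hρ⟩ := exists_bump_eq_locKer hf0 hfL hL R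
  refine ⟨B * ∑ i, ∫ q, |locKerD ρ i q|, ?_, fun x y t hx hy ht => ?_⟩
  · exact mul_nonneg ((abs_nonneg _).trans (hB 0))
      (Finset.sum_nonneg fun i _ => integral_nonneg fun _ => abs_nonneg _)
  · rw [(hρ x t hx ht).1, (hρ y t hy ht).1]
    exact cv_locKer_lipschitz ρ hf hB x y t

/-- The heat potential of a locally Hölder continuous density solves the heat equation. -/
lemma heatAt_cv_heatKernel {f : Euc d × ℝ → ℝ} {B L α : ℝ} (hα : 0 < α) (hf : Continuous f)
    (hB : ∀ y, |f y| ≤ B) (hf0 : ∀ x t, t ≤ 0 → f (x, t) = 0)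
    (hfL : ∀ x t, L ≤ ‖x‖ → f (x, t) = 0) (hL : 0 ≤ L)
    (hH : ∀ T, ∃ H, ∀ x y t, t ≤ T → |f (x, t) - f (y, t)| ≤ H * ‖x - y‖ ^ α)
    (q : Euc d × ℝ) : HeatAt (cv heatKernel f) f q := by
  obtain ⟨x, t⟩ := q
  set T := |t| + 1 with hT
  set θ : ℝ → ℝ := fun s => max 0 (min 1 (T + 1 - s)) with hθ
  have hθ0 : ∀ s, 0 ≤ θ s := fun s => le_max_left _ _
  have hθ1 : ∀ s, θ s ≤ 1 := fun s => max_le zero_le_one (min_le_left _ _)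
  have hθT : ∀ s, s ≤ T → θ s = 1 := fun s hs => by
    simp only [hθ]
    rw [min_eq_left (by linarith), max_eq_right zero_le_one]
  have hθT' : ∀ s, T + 1 ≤ s → θ s = 0 := fun s hs =>
    max_eq_left ((min_le_right _ _).trans (by linarith))
  set g : Euc d × ℝ → ℝ := fun y => θ y.2 * f y with hg
  have hgc : Continuous g := by simp only [hg, hθ]; fun_prop
  have hgf : ∀ y, |g y| ≤ |f y| := fun y => by
    simp only [hg]
    rw [abs_mul, abs_of_nonneg (hθ0 _)]
    exact mul_le_of_le_one_left (abs_nonneg _) (hθ1 _)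
  have hgB : ∀ y, |g y| ≤ B := fun y => (hgf y).trans (hB y)
  have hg0 : ∀ x t, t ≤ 0 → g (x, t) = 0 := fun x t ht => by simp [hg, hf0 x t ht]
  have hgL : ∀ x t, L ≤ ‖x‖ → g (x, t) = 0 := fun x t hx => by simp [hg, hfL x t hx]
  have hgs : HasCompactSupport g := by
    refine HasCompactSupport.intro ((isCompact_closedBall (0 : Euc d) L).prod
      (isCompact_Icc (a := 0) (b := T + 1))) fun y hy => ?_
    rw [mem_prod, mem_closedBall_zero_iff, mem_Icc] at hy
    by_contra hne
    refine hy ⟨le_of_not_ge fun h => hne (hgL y.1 y.2 h), le_of_not_ge fun h =>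
      hne (hg0 y.1 y.2 h), le_of_not_ge fun h => hne ?_⟩
    simp [hg, hθT' _ h]
  obtain ⟨H, hH⟩ := hH (T + 1)
  have hgH : ∀ x y t, |g (x, t) - g (y, t)| ≤ |H| * ‖x - y‖ ^ α := fun x y t => by
    have hn : 0 ≤ ‖x - y‖ ^ α := rpow_nonneg (norm_nonneg _) _
    simp only [hg]
    rw [← mul_sub, abs_mul, abs_of_nonneg (hθ0 _)]
    rcases le_or_gt t (T + 1) with ht | ht
    · calc θ t * |f (x, t) - f (y, t)| ≤ |f (x, t) - f (y, t)| :=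
            mul_le_of_le_one_left (abs_nonneg _) (hθ1 _)
        _ ≤ _ := hH x y t ht
        _ ≤ _ := mul_le_mul_of_nonneg_right (le_abs_self H) hn
    · rw [hθT' _ ht.le, zero_mul]
      positivity
  obtain ⟨ρ, hρ⟩ := exists_bump_eq_locKer hg0 hgL hL (‖x‖ + T)
  have hgu := hgs.uniformContinuous_of_continuous hgc
  refine (heatAt_cv_locKer ρ hα hgu hgB hgH (x, t)).congr ?_ ?_
  · have h1 : ∀ᶠ y : Euc d × ℝ in 𝓝 (x, t), ‖y.1‖ < ‖x‖ + T :=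
      (continuous_fst.norm.tendsto (x, t)).eventually (gt_mem_nhds (by
        simp only; linarith [abs_nonneg t]))
    have h2 : ∀ᶠ y : Euc d × ℝ in 𝓝 (x, t), y.2 < T :=
      (continuous_snd.tendsto (x, t)).eventually (gt_mem_nhds (by
        simp only; linarith [le_abs_self t]))
    filter_upwards [h1, h2] with y hy1 hy2
    rw [← (hρ y.1 y.2 hy1.le (by linarith [norm_nonneg x])).1]
    refine integral_congr_ae (Eventually.of_forall fun z => ?_)
    simp only [hg]
    rcases le_or_gt z.2 0 with hz | hz
    · rw [show heatKernel z = 0 from heatKernel_of_nonpos (z := z.1) hz]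
      simp
    · rw [hθT _ (by simp only [Prod.snd_sub]; linarith), one_mul]
  · rw [(hρ x t (by linarith [abs_nonneg t]) (by linarith [norm_nonneg x, le_abs_self t])).2]
    simp only [hg]
    rw [hθT _ (by linarith [le_abs_self t])]
    ring

lemma heatOp_of_nonpos {w : Euc d × ℝ → ℝ} (hw : ContDiff ℝ ∞ w)
    (hw0 : ∀ x t, t ≤ 0 → w (x, t) = 0) (z : Euc d) {r : ℝ} (hr : r ≤ 0) :
    heatOp w (z, r) = 0 := by
  have h1 : EqOn (fun r => heatOp w (z, r)) (fun _ => 0) (Iio 0) := by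
    intro s hs
    have : w =ᶠ[𝓝 (z, s)] fun _ => 0 := by
      filter_upwards [(continuous_snd.tendsto (z, s)).eventually (gt_mem_nhds hs)] with y hy
      exact hw0 y.1 y.2 (le_of_lt hy)
    simp only [heatOp_congr this, heatOp_zero]
  have h2 := h1.closure ((contDiff_heatOp hw).continuous.comp (by fun_prop)) continuous_const
  rw [closure_Iio] at h2
  exact h2 hr

lemma abs_le_of_continuous_of_hasCompactSupport {f : Euc d × ℝ → ℝ} (hf : Continuous f)
    (hc : HasCompactSupport f) : ∃ B, 0 ≤ B ∧ ∀ y, |f y| ≤ B := by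
  obtain ⟨B, hB⟩ := hc.exists_bound_of_continuous hf
  exact ⟨B, (norm_nonneg _).trans (hB 0), hB⟩

lemma exists_eq_zero_of_le_norm {f : Euc d × ℝ → ℝ} (hc : HasCompactSupport f) :
    ∃ L, 0 ≤ L ∧ ∀ x t, L ≤ ‖x‖ → f (x, t) = 0 := by
  obtain ⟨R, hR⟩ := hc.isCompact.isBounded.subset_closedBall 0
  refine ⟨|R| + 1, by positivity, fun x t hx => ?_⟩
  by_contra h
  have h1 := hR (subset_tsupport f (Function.mem_support.2 h))
  rw [mem_closedBall_zero_iff, Prod.norm_def] at h1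
  linarith [(le_max_left _ _).trans h1, le_abs_self R]

/-- A bounded smooth function vanishing for nonpositive times is the heat potential of its image
under the heat operator. -/
lemma eq_cv_heatKernel_heatOp {w : Euc d × ℝ → ℝ} {M : ℝ} (hw : ContDiff ℝ ∞ w)
    (hM : ∀ y, |w y| ≤ M) (hw0 : ∀ x t, t ≤ 0 → w (x, t) = 0)
    (hc : HasCompactSupport (heatOp w)) : w = cv heatKernel (heatOp w) := by
  have hg := contDiff_heatOp hw
  have hg0 : ∀ x t, t ≤ 0 → heatOp w (x, t) = 0 := fun x t ht => heatOp_of_nonpos hw hw0 x ht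
  obtain ⟨B, hB0, hB⟩ := abs_le_of_continuous_of_hasCompactSupport hg.continuous hc
  obtain ⟨L, hL, hgL⟩ := exists_eq_zero_of_le_norm hc
  obtain ⟨C, hC⟩ := ContDiff.lipschitzWith_of_hasCompactSupport hc hg (by simp)
  have hH : ∀ T : ℝ, ∃ H : ℝ, ∀ (x y : Euc d) t, t ≤ T →
      |heatOp w (x, t) - heatOp w (y, t)| ≤ H * ‖x - y‖ ^ (1 : ℝ) := fun T =>
    ⟨C, fun x y t _ => by
      have := hC.dist_le_mul (x, t) (y, t)
      rwa [Real.dist_eq, dist_prod_same_right, dist_eq_norm, ← rpow_one ‖x - y‖] at this⟩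
  have hV : ∀ q, HeatAt (fun y => w y - cv heatKernel (heatOp w) y) (fun _ => 0) q := fun q =>
    ((hw.heatAt q).sub (heatAt_cv_heatKernel one_pos hg.continuous hB hg0 hgL hL hH q)).congr
      (Eventually.of_forall fun _ => rfl) (by simp)
  have hVc := continuous_cv_heatKernel hg.continuous.measurable hB hg0
  have hb : ∀ (x : Euc d) {t T : ℝ}, t ≤ T → |w (x, t) - cv heatKernel (heatOp w) (x, t)| ≤
      M + B * ∫ y : Euc d × ℝ, |truncKer T y| := fun x t T ht =>
    (abs_sub _ _).trans (add_le_add (hM _) (abs_cv_heatKernel_le hB hg0 ht))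
  have hz : ∀ (x : Euc d) {t : ℝ}, t ≤ 0 → w (x, t) - cv heatKernel (heatOp w) (x, t) = 0 :=
    fun x t ht => by rw [hw0 x t ht, cv_heatKernel_of_nonpos hg0 x ht, sub_zero]
  funext ⟨x, t⟩
  rcases le_or_gt t 0 with ht | ht
  · exact sub_eq_zero.1 (hz x ht)
  · have h1 := heat_max_principle_of_le (T := t) (hw.continuous.sub hVc).continuousOn
      (fun x => (hz x le_rfl).le) (fun x s hs => (le_abs_self _).trans (hb x hs.2))
      (fun x s _ _ => ⟨hV (x, s), le_rfl⟩) x t ⟨ht.le, le_rfl⟩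
    have h2 := heat_max_principle_of_le (T := t) (hw.continuous.sub hVc).neg.continuousOn
      (fun x => (neg_eq_zero.2 (hz x le_rfl)).le)
      (fun x s hs => (neg_le_abs _).trans (hb x hs.2))
      (F := fun _ => -0) (fun x s _ _ => ⟨(hV (x, s)).neg, neg_zero.le⟩) x t ⟨ht.le, le_rfl⟩
    simp only [Pi.sub_apply, Pi.neg_apply] at h1 h2
    linarith

lemma exists_heatKernel_le {R : ℝ} (hR : 0 < R) :
    ∃ C, ∀ q : Euc d × ℝ, R ≤ ‖q‖ → heatKernel q ≤ C := by
  obtain ⟨C, hC, h⟩ := norm_rpow_mul_heatKernel_le (d := d) d (Nat.cast_nonneg d)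
  have hpos : ∀ (z : Euc d) {r : ℝ}, 0 < r → heatKernel (z, r) ≤ (2 * π * r) ^ (-(d : ℝ) / 2) :=
    fun z r hr => by
      rw [heatKernel_of_pos hr]
      refine mul_le_of_le_one_right (by positivity) (exp_le_one_iff.2 ?_)
      have : 0 ≤ ‖z‖ ^ 2 / (2 * r) := by positivity
      rw [neg_div]; linarith
  refine ⟨max ((2 * π * R) ^ (-(d : ℝ) / 2)) (R ^ (-(d : ℝ)) * (C * (4 * π) ^ (-(d : ℝ) / 2))),
    fun ⟨z, r⟩ hq => ?_⟩
  rcases le_or_gt r 0 with hr | hr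
  · rw [heatKernel_of_nonpos hr]
    exact le_max_of_le_left (by positivity)
  rw [Prod.norm_def, le_max_iff, Real.norm_of_nonneg hr.le] at hq
  rcases hq with hq | hq
  · refine le_max_of_le_right ?_
    have hz : 0 < ‖z‖ := hR.trans_le hq
    have h1 := (h z r hr).trans (mul_le_mul_of_nonneg_left
      (mul_le_mul_of_nonneg_left (hpos z (r := 2 * r) (by positivity)) (by positivity)) hC)
    have h2 : r ^ ((d : ℝ) / 2) * (2 * π * (2 * r)) ^ (-(d : ℝ) / 2) =
        (4 * π) ^ (-(d : ℝ) / 2) := by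
      rw [show 2 * π * (2 * r) = 4 * π * r by ring, mul_rpow (by positivity) hr.le,
        mul_left_comm, ← rpow_add hr, show (d : ℝ) / 2 + -(d : ℝ) / 2 = 0 by ring, rpow_zero,
        mul_one]
    rw [h2] at h1
    have h3 : heatKernel (z, r) ≤ ‖z‖ ^ (-(d : ℝ)) * (C * (4 * π) ^ (-(d : ℝ) / 2)) := by
      rw [rpow_neg hz.le, inv_mul_eq_div, le_div_iff₀ (by positivity), mul_comm]
      exact h1
    refine h3.trans (mul_le_mul_of_nonneg_right ?_ (by positivity))
    exact rpow_le_rpow_of_nonpos hR hq (by simp)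
  · refine le_max_of_le_left ((hpos z hr).trans ?_)
    refine rpow_le_rpow_of_nonpos (by positivity) (by gcongr) ?_
    have := Nat.cast_nonneg (α := ℝ) d
    linarith

lemma exists_abs_remKer_le (ρ : ContDiffBump (0 : Euc d × ℝ)) : ∃ M, ∀ q, |remKer ρ q| ≤ M := by
  obtain ⟨C, hC⟩ := exists_heatKernel_le (d := d) one_pos
  obtain ⟨B, -, hB⟩ := exists_bound_on_closedBall (contDiff_remKer ρ).continuous 1
  refine ⟨max B C, fun q => ?_⟩
  rcases le_total ‖q‖ 1 with h | h
  · exact le_max_of_le_left (hB q h)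
  · rw [abs_of_nonneg (remKer_nonneg ρ q)]
    exact le_max_of_le_right ((remKer_le ρ q).trans (hC q h))

lemma hasCompactSupport_heatOp {w : Euc d × ℝ → ℝ} (hc : HasCompactSupport w) :
    HasCompactSupport (heatOp w) := by
  refine HasCompactSupport.intro hc fun q hq => ?_
  rw [heatOp_congr (notMem_tsupport_iff_eventuallyEq.1 hq)]
  exact heatOp_zero q

lemma remKer_eq_cv (ρ : ContDiffBump (0 : Euc d × ℝ)) :
    remKer ρ = cv heatKernel (defKer ρ) := by
  obtain ⟨M, hM⟩ := exists_abs_remKer_le ρ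
  exact eq_cv_heatKernel_heatOp (contDiff_remKer ρ) hM (fun _ _ => remKer_of_nonpos ρ)
    (hasCompactSupport_defKer ρ)

lemma defKer_eq_cv (ρ : ContDiffBump (0 : Euc d × ℝ)) :
    defKer ρ = cv heatKernel (heatOp (defKer ρ)) := by
  obtain ⟨M, -, hM⟩ := abs_le_of_continuous_of_hasCompactSupport (contDiff_defKer ρ).continuous
    (hasCompactSupport_defKer ρ)
  exact eq_cv_heatKernel_heatOp (contDiff_defKer ρ) hM (fun _ _ => defKer_of_nonpos ρ)
    (hasCompactSupport_heatOp (hasCompactSupport_defKer ρ))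

/-- Convolution with the heat potential of `g` is convolution of the heat potential with `g`. -/
lemma cv_cv_heatKernel {f g : Euc d × ℝ → ℝ} {B : ℝ} (hf : Measurable f)
    (hB : ∀ y, |f y| ≤ B) (hf0 : ∀ x t, t ≤ 0 → f (x, t) = 0) (hg : Continuous g)
    (hgc : HasCompactSupport g) (hg0 : ∀ x t, t ≤ 0 → g (x, t) = 0) (q : Euc d × ℝ) :
    cv (cv heatKernel g) f q = cv g (cv heatKernel f) q := by
  have hgi : Integrable g := hg.integrable_of_hasCompactSupport hgc
  have hT := integrable_truncKer (d := d) q.2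
  have h1 : cv (cv heatKernel g) f q = cv (cv g (truncKer q.2)) f q := by
    refine integral_congr_ae (Eventually.of_forall fun y => ?_)
    simp only
    rcases le_or_gt q.2 y.2 with hy | hy
    · rw [show f (q - y) = 0 from hf0 _ _ (sub_nonpos.2 hy), mul_zero, mul_zero]
    · rw [cv_heatKernel_eq_truncKer hg0 hy.le, cv_eq_integral_sub]
      simp only [cv, mul_comm]
  have h2 : cv g (cv heatKernel f) q = cv g (cv (truncKer q.2) f) q := by
    refine integral_congr_ae (Eventually.of_forall fun y => ?_)
    simp only
    rcases le_or_gt y.2 0 with hy | hy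
    · rw [show g y = 0 from hg0 y.1 y.2 hy, zero_mul, zero_mul]
    · rw [cv_heatKernel_eq_truncKer hf0 (sub_le_self q.2 hy.le)]
  rw [h1, h2]
  simp only [cv_eq_convolution]
  refine convolution_assoc (L := ContinuousLinearMap.mul ℝ ℝ) (L₂ := ContinuousLinearMap.mul ℝ ℝ)
    (L₃ := ContinuousLinearMap.mul ℝ ℝ) (L₄ := ContinuousLinearMap.mul ℝ ℝ)
    (fun x y z => by simp [mul_assoc]) hgi.aestronglyMeasurable hT.aestronglyMeasurable
    hf.aestronglyMeasurable ?_ ?_ ?_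
  · exact hgi.ae_convolution_exists _ hT
  · refine Eventually.of_forall fun x => ?_
    simp only [ConvolutionExistsAt, ContinuousLinearMap.mul_apply']
    exact integrable_mul_comp_sub hT.norm hf.norm (B := B) (fun y => by
      rw [abs_of_nonneg (norm_nonneg _)]; exact hB y) x
  · simp only [ConvolutionExistsAt, ContinuousLinearMap.mul_apply']
    rw [← cv_eq_convolution]
    have hc := continuous_cv hT.norm hf.norm (B := B) (fun y => by
      rw [abs_of_nonneg (norm_nonneg _)]; exact hB y)
    exact integrable_mul_comp_sub hgi.norm hc.measurable (fun y => abs_cv_le hT.norm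
      (fun y => by rw [abs_of_nonneg (norm_nonneg _)]; exact hB y) y) q

/-- Local representation of heat potentials. -/
lemma cv_heatKernel_eq_add (ρ : ContDiffBump (0 : Euc d × ℝ)) {f : Euc d × ℝ → ℝ} {B : ℝ}
    (hf : Measurable f) (hB : ∀ y, |f y| ≤ B) (hf0 : ∀ x t, t ≤ 0 → f (x, t) = 0)
    (q : Euc d × ℝ) :
    cv heatKernel f q = cv (locKer ρ) f q + cv (defKer ρ) (cv heatKernel f) q := by
  rw [← cv_cv_heatKernel hf hB hf0 (contDiff_defKer ρ).continuous (hasCompactSupport_defKer ρ)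
    (fun _ _ => defKer_of_nonpos ρ), ← remKer_eq_cv]
  have h1 := integrable_heatKernel_mul hf hB hf0 q
  have h2 := integrable_mul_comp_sub (integrable_locKer ρ) hf hB q
  have h3 : Integrable fun y => remKer ρ y * f (q - y) := by
    refine (h1.sub h2).congr (Eventually.of_forall fun y => ?_)
    simp only [Pi.sub_apply, locKer_eq]
    ring
  simp only [cv]
  rw [← integral_add h2 h3]
  refine integral_congr_ae (Eventually.of_forall fun y => ?_)
  simp only [locKer_eq]
  ring

lemma cv_defKer_eq_cv_heatOp (ρ : ContDiffBump (0 : Euc d × ℝ)) {f : Euc d × ℝ → ℝ} {B : ℝ}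
    (hf : Measurable f) (hB : ∀ y, |f y| ≤ B) (hf0 : ∀ x t, t ≤ 0 → f (x, t) = 0)
    (q : Euc d × ℝ) :
    cv (defKer ρ) f q = cv (heatOp (defKer ρ)) (cv heatKernel f) q := by
  rw [← cv_cv_heatKernel hf hB hf0 (contDiff_heatOp (contDiff_defKer ρ)).continuous
    (hasCompactSupport_heatOp (hasCompactSupport_defKer ρ))
    (fun z _ => heatOp_of_nonpos (contDiff_defKer ρ) (fun _ _ => defKer_of_nonpos ρ) z),
    ← defKer_eq_cv]

/-- The heat kernel with exponential damping in time. -/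
noncomputable def dampKer (l : ℝ) (q : Euc d × ℝ) : ℝ := heatKernel q * exp (-(l * q.2))

lemma dampKer_nonneg (l : ℝ) (q : Euc d × ℝ) : 0 ≤ dampKer l q :=
  mul_nonneg (heatKernel_nonneg q) (exp_pos _).le

lemma measurable_dampKer (l : ℝ) : Measurable (dampKer l : Euc d × ℝ → ℝ) :=
  measurable_heatKernel.mul (by fun_prop)

lemma integral_dampKer_slice (l r : ℝ) :
    ∫ z : Euc d, dampKer l (z, r) = (Ioi 0).indicator (fun r => exp (-(l * r))) r := by
  simp only [dampKer, integral_mul_const]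
  rcases le_or_gt r 0 with hr | hr
  · simp [heatKernel_of_nonpos hr, hr]
  · simp [integral_heatKernel hr, hr]

lemma integrable_dampKer {l : ℝ} (hl : 0 < l) : Integrable (dampKer l : Euc d × ℝ → ℝ) := by
  rw [Measure.volume_eq_prod, integrable_prod_iff'
    (measurable_dampKer l).aestronglyMeasurable]
  refine ⟨Eventually.of_forall fun r => ?_, ?_⟩
  · simp only [dampKer]
    rcases le_or_gt r 0 with hr | hr
    · simp [heatKernel_of_nonpos hr]
    · exact (integrable_heatKernel hr).mul_const _
  · simp only [Real.norm_of_nonneg (dampKer_nonneg l _), integral_dampKer_slice]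
    rw [integrable_indicator_iff measurableSet_Ioi]
    simpa only [neg_mul] using exp_neg_integrableOn_Ioi 0 hl

lemma integral_abs_dampKer {l : ℝ} (hl : 0 < l) :
    ∫ q : Euc d × ℝ, |dampKer l q| = 1 / l := by
  simp only [abs_of_nonneg (dampKer_nonneg l _)]
  have hi := integrable_dampKer (d := d) hl
  rw [Measure.volume_eq_prod] at hi ⊢
  rw [integral_prod_symm _ hi]
  simp only [integral_dampKer_slice]
  rw [integral_indicator measurableSet_Ioi]
  have := integral_exp_neg_mul_rpow (p := 1) (b := l) one_pos hl
  simp only [rpow_one, neg_mul] at this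
  rw [this]
  norm_num [rpow_neg_one]

/-- Global solvability of the Duhamel equation for bounded Lipschitz nonlinearities. -/
lemma exists_eq_cv_heatKernel {G : Euc d × ℝ → ℝ → ℝ} {B Λ : ℝ}
    (hGc : Continuous fun p : (Euc d × ℝ) × ℝ => G p.1 p.2) (hB : ∀ y τ, |G y τ| ≤ B)
    (hΛ : 0 < Λ) (hG : ∀ y σ τ, |G y σ - G y τ| ≤ Λ * |σ - τ|)
    (hG0 : ∀ x t, t ≤ 0 → G (x, t) 0 = 0) :
    ∃ u : Euc d × ℝ → ℝ, Continuous u ∧ (∀ x t, t ≤ 0 → u (x, t) = 0) ∧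
      ∀ q, u q = cv heatKernel (fun y => G y (u y)) q := by
  set l := 2 * Λ with hl
  have hl0 : 0 < l := by positivity
  have hK := integrable_dampKer (d := d) hl0
  set F : (Euc d × ℝ → ℝ) → Euc d × ℝ → ℝ := fun v =>
    {y | 0 < y.2}.indicator fun y => exp (-(l * y.2)) * G y (exp (l * y.2) * v y) with hF
  have hexp : ∀ y : Euc d × ℝ, 0 < y.2 → exp (-(l * y.2)) ≤ 1 := fun y hy =>
    exp_le_one_iff.2 (by have := mul_pos hl0 hy; linarith)
  have hFm : ∀ v, Continuous v → Measurable (F v) := fun v hv => by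
    refine Measurable.indicator (Continuous.measurable ?_)
      (isOpen_lt continuous_const continuous_snd).measurableSet
    have : Continuous fun y : Euc d × ℝ => G y (exp (l * y.2) * v y) :=
      hGc.comp (f := fun y : Euc d × ℝ => (y, exp (l * y.2) * v y)) (by fun_prop)
    fun_prop
  have hB0 : 0 ≤ B := (abs_nonneg _).trans (hB 0 0)
  have hFB : ∀ v y, |F v y| ≤ B := fun v y => by
    simp only [hF, indicator_apply]
    split_ifs with h
    · rw [abs_mul, abs_of_pos (exp_pos _)]
      exact (mul_le_of_le_one_left (abs_nonneg _) (hexp y h)).trans (hB _ _)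
    · simpa using hB0
  have hFL : ∀ v w y, |F v y - F w y| ≤ Λ * |v y - w y| := fun v w y => by
    simp only [hF, indicator_apply]
    split_ifs with h
    · rw [← mul_sub, abs_mul, abs_of_pos (exp_pos _)]
      calc _ ≤ exp (-(l * y.2)) * (Λ * |exp (l * y.2) * v y - exp (l * y.2) * w y|) := by
            gcongr; exact hG _ _ _
        _ = (exp (-(l * y.2)) * exp (l * y.2)) * (Λ * |v y - w y|) := by
            rw [← mul_sub, abs_mul, abs_of_pos (exp_pos _)]; ring
        _ = _ := by rw [← exp_add]; simp
    · simp only [sub_zero, abs_zero]; positivity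
  have hcc : ∀ v, Continuous v → Continuous (cv (dampKer l) (F v)) := fun v hv =>
    continuous_cv hK (hFm v hv) (hFB v)
  set Φ : (Euc d × ℝ →ᵇ ℝ) → (Euc d × ℝ →ᵇ ℝ) := fun v =>
    BoundedContinuousFunction.ofNormedAddCommGroup (cv (dampKer l) (F v))
      (hcc v v.continuous) _ (fun q => abs_cv_le hK (hFB v) q) with hΦ
  have hcontr : ContractingWith (1 / 2) Φ := by
    refine ⟨by norm_num, LipschitzWith.of_dist_le_mul fun v w => ?_⟩
    rw [BoundedContinuousFunction.dist_le (by positivity)]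
    intro q
    have h1 : cv (dampKer l) (F v) q - cv (dampKer l) (F w) q =
        cv (dampKer l) (fun y => F v y - F w y) q := by
      simp only [cv, mul_sub]
      exact (integral_sub (integrable_mul_comp_sub hK (hFm v v.continuous) (hFB v) q)
        (integrable_mul_comp_sub hK (hFm w w.continuous) (hFB w) q)).symm
    have h2 : ∀ y, |F v y - F w y| ≤ Λ * dist v w := fun y =>
      (hFL v w y).trans (mul_le_mul_of_nonneg_left
        (BoundedContinuousFunction.dist_coe_le_dist (f := v) (g := w) y) hΛ.le)
    have h3 := abs_cv_le hK h2 q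
    rw [integral_abs_dampKer hl0] at h3
    simp only [hΦ, BoundedContinuousFunction.coe_ofNormedAddCommGroup, Real.dist_eq, h1]
    refine h3.trans (le_of_eq ?_)
    rw [hl]
    push_cast
    field_simp
  set v := hcontr.fixedPoint Φ with hv
  have hfix : ∀ q, v q = cv (dampKer l) (F v) q := fun q => by
    have h := hcontr.fixedPoint_isFixedPt
    conv_lhs => rw [hv, ← h.eq]
    rfl
  have hv0 : ∀ x t, t ≤ 0 → v (x, t) = 0 := fun x t ht => by
    rw [hfix]
    refine integral_eq_zero_of_ae (Eventually.of_forall fun y => ?_)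
    simp only [dampKer, hF, indicator_apply, Pi.zero_apply]
    rcases le_or_gt y.2 0 with hy | hy
    · rw [show heatKernel y = 0 from heatKernel_of_nonpos (z := y.1) hy]
      simp
    · rw [if_neg, mul_zero]
      simp only [mem_ofPred_eq, Prod.snd_sub, not_lt]
      linarith
  refine ⟨fun y => exp (l * y.2) * v y, by fun_prop, fun x t ht => by simp [hv0 x t ht],
    fun q => ?_⟩
  beta_reduce
  rw [hfix, cv, cv, ← integral_const_mul]
  refine integral_congr_ae (Eventually.of_forall fun y => ?_)
  simp only [dampKer, hF, indicator_apply, mem_ofPred_eq, Prod.snd_sub]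
  split_ifs with h
  · calc _ = (exp (l * q.2) * exp (-(l * y.2)) * exp (-(l * (q.2 - y.2)))) *
          (heatKernel y * G (q - y) (exp (l * (q.2 - y.2)) * v (q - y))) := by ring
      _ = _ := by
        rw [← exp_add, ← exp_add, show l * q.2 + -(l * y.2) + -(l * (q.2 - y.2)) = 0 by ring,
          exp_zero, one_mul]
  · have h0 := hv0 (q - y).1 (q - y).2 (not_lt.1 h)
    rw [Prod.mk.eta] at h0
    rw [h0, mul_zero, mul_zero, mul_zero]
    rw [show G (q - y) 0 = 0 from hG0 _ _ (not_lt.1 h), mul_zero]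

/-- The piecewise linear ramp from `0` to `1`. -/
noncomputable def ramp (r : ℝ) : ℝ := max 0 (min 1 r)

lemma ramp_nonneg (r : ℝ) : 0 ≤ ramp r := le_max_left _ _

lemma ramp_le_one (r : ℝ) : ramp r ≤ 1 := max_le zero_le_one (min_le_left _ _)

lemma abs_ramp_le_one (r : ℝ) : |ramp r| ≤ 1 := by
  rw [abs_of_nonneg (ramp_nonneg r)]; exact ramp_le_one r

lemma ramp_of_one_le {r : ℝ} (h : 1 ≤ r) : ramp r = 1 := by simp [ramp, h]

lemma ramp_of_nonpos {r : ℝ} (h : r ≤ 0) : ramp r = 0 :=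
  max_eq_left ((min_le_right _ _).trans h)

@[fun_prop]
lemma continuous_ramp : Continuous ramp := by unfold ramp; fun_prop

lemma abs_clamp_sub_le (N r s : ℝ) : |max 0 (min N r) - max 0 (min N s)| ≤ |r - s| := by
  have h1 := abs_max_sub_max_le_max 0 (min N r) 0 (min N s)
  have h2 := abs_min_sub_min_le_max N r N s
  rw [sub_self, abs_zero] at h1 h2
  exact h1.trans (max_le (abs_nonneg _) (h2.trans (max_le (abs_nonneg _) le_rfl)))

lemma abs_ramp_sub_le (r s : ℝ) : |ramp r - ramp s| ≤ |r - s| := abs_clamp_sub_le 1 r s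

lemma abs_rpow_sub_rpow_le {p N a b : ℝ} (hp : 1 ≤ p) (ha : a ∈ Icc 0 N) (hb : b ∈ Icc 0 N) :
    |a ^ p - b ^ p| ≤ p * N ^ (p - 1) * |a - b| := by
  refine (convex_Icc 0 N).norm_image_sub_le_of_norm_hasDerivWithin_le
    (f := fun x : ℝ => x ^ p) (f' := fun x => p * x ^ (p - 1)) (fun x _ =>
      (hasDerivAt_rpow_const (Or.inr hp)).hasDerivWithinAt) (fun x hx => ?_) hb ha
  have := hx.1
  rw [Real.norm_of_nonneg (by positivity)]
  exact mul_le_mul_of_nonneg_left (rpow_le_rpow hx.1 hx.2 (by linarith)) (by linarith)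

lemma le_mul_rpow_of_le {D M c r α : ℝ} (hM : D ≤ M) (hc : D ≤ c * r) (hr : 0 ≤ r)
    (hM0 : 0 ≤ M) (hc0 : 0 ≤ c) (hα : 0 < α) (hα1 : α ≤ 1) : D ≤ (c + M) * r ^ α := by
  have hrα : 0 ≤ r ^ α := rpow_nonneg hr _
  rcases le_total r 1 with h | h
  · have h1 : r ≤ r ^ α := by
      simpa using rpow_le_rpow_of_exponent_ge' hr h hα.le hα1
    nlinarith [mul_le_mul_of_nonneg_left h1 hc0, mul_nonneg hM0 hrα]
  · have h1 : 1 ≤ r ^ α := one_le_rpow h hα.le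
    nlinarith [mul_le_mul_of_nonneg_left h1 hM0, mul_nonneg hc0 hrα]

/-- The product of a Hölder cutoff with a function that is Hölder on its support is Hölder. -/
lemma abs_mul_sub_mul_le_rpow {E : Type*} [SeminormedAddCommGroup E] {a w : E → ℝ} {K : Set E}
    {A W Ca Cw α : ℝ} (ha : ∀ x, |a x| ≤ A) (haH : ∀ x y, |a x - a y| ≤ Ca * ‖x - y‖ ^ α)
    (ha0 : ∀ x ∉ K, a x = 0) (hw : ∀ x ∈ K, |w x| ≤ W)
    (hwH : ∀ x ∈ K, ∀ y ∈ K, |w x - w y| ≤ Cw * ‖x - y‖ ^ α) (hW0 : 0 ≤ W) (hCw0 : 0 ≤ Cw)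
    (x y : E) : |a x * w x - a y * w y| ≤ (A * Cw + W * Ca) * ‖x - y‖ ^ α := by
  have hr : 0 ≤ ‖x - y‖ ^ α := rpow_nonneg (norm_nonneg _) _
  have hA0 : 0 ≤ A := (abs_nonneg _).trans (ha x)
  have h0 : 0 ≤ A * Cw * ‖x - y‖ ^ α := by positivity
  have key : ∀ z ∈ K, W * |a x - a y| ≥ |w z| * |a x - a y| := fun z hz =>
    mul_le_mul_of_nonneg_right (hw z hz) (abs_nonneg _)
  have hWC : W * |a x - a y| ≤ W * Ca * ‖x - y‖ ^ α := by
    rw [mul_assoc]; exact mul_le_mul_of_nonneg_left (haH x y) hW0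
  rw [add_mul]
  by_cases hx : x ∈ K
  · by_cases hy : y ∈ K
    · have h1 : a x * w x - a y * w y = a x * (w x - w y) + w y * (a x - a y) := by ring
      have h2 : |a x| * |w x - w y| ≤ A * (Cw * ‖x - y‖ ^ α) :=
        mul_le_mul (ha x) (hwH x hx y hy) (abs_nonneg _) hA0
      rw [h1]
      refine (abs_add_le _ _).trans ?_
      rw [abs_mul, abs_mul]
      linarith [key y hy]
    · have h1 : a x * w x - a y * w y = w x * (a x - a y) := by rw [ha0 y hy]; ring
      rw [h1, abs_mul]
      linarith [key x hx]
  · by_cases hy : y ∈ K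
    · have h1 : a x * w x - a y * w y = w y * (a x - a y) := by rw [ha0 x hx]; ring
      rw [h1, abs_mul]
      linarith [key y hy]
    · rw [ha0 x hx, ha0 y hy, zero_mul, zero_mul, sub_zero, abs_zero]
      have := (mul_nonneg hW0 (abs_nonneg (a x - a y))).trans hWC
      linarith

/-- `u` is the heat potential of the bounded continuous density `f`, which vanishes for nonpositive
times, and solves the heat equation with right-hand side `f`. -/
structure IsHeatPotential (f u : Euc d × ℝ → ℝ) : Prop where
  continuous_u : Continuous u
  continuous_f : Continuous f
  bdd : ∃ B, ∀ y, |f y| ≤ B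
  f_zero : ∀ x t, t ≤ 0 → f (x, t) = 0
  u_zero : ∀ x t, t ≤ 0 → u (x, t) = 0
  eq_cv : ∀ q, u q = cv heatKernel f q
  heatAt : ∀ q, HeatAt u f q

lemma HeatAt.sub_const {S F : Euc d × ℝ → ℝ} {q : Euc d × ℝ} (h : HeatAt S F q) (c : ℝ) :
    HeatAt (fun y => S y - c) F q := by
  have h0 := (contDiff_const (c := c) (E := Euc d × ℝ) (n := ∞)).heatAt q
  refine (h.sub h0).congr (Eventually.of_forall fun y => rfl) ?_
  have : ∀ i, pd i (fun _ : Euc d => c) = fun _ => 0 := fun i => by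
    funext x; simp [pd]
  simp [heatOp, this, pd_zero]

/-- Solvability of the truncated reaction-diffusion problem. -/
lemma exists_isHeatPotential {b : Euc d → ℝ} {s : Euc d × ℝ → ℝ} {p L α H B A Cs : ℝ}
    (hp : 1 < p) (hL : 0 ≤ L) (hα : 0 < α) (hα1 : α ≤ 1) (hbc : Continuous b)
    (hbB : ∀ x, |b x| ≤ B) (hbH : ∀ x y, |b x - b y| ≤ H * ‖x - y‖ ^ α)
    (hbL : ∀ x, L ≤ ‖x‖ → b x = 0) (hsc : Continuous s) (hs0 : ∀ y, 0 ≤ s y)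
    (hsA : ∀ y, s y ≤ A) (hsH : ∀ x y t, |s (x, t) - s (y, t)| ≤ Cs * ‖x - y‖ ^ α)
    (hst : ∀ x t, t ≤ 0 → s (x, t) = 0) (hsL : ∀ x t, L ≤ ‖x‖ → s (x, t) = 0) :
    ∃ u : Euc d × ℝ → ℝ, (∀ y, 0 ≤ u y) ∧ (∃ N, ∀ y, u y ≤ N) ∧ IsHeatPotential
      (fun y => b y.1 * u y - ramp (L + 1 - ‖y.1‖) * u y ^ p + s y) u := by
  have hB0 : 0 ≤ B := (abs_nonneg _).trans (hbB 0)
  have hA0 : 0 ≤ A := (hs0 0).trans (hsA 0)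
  have hp1 : 0 < p - 1 := by linarith
  set N := max 1 ((B + A) ^ (1 / (p - 1))) with hN
  have hN1 : 1 ≤ N := le_max_left _ _
  have hN0 : 0 < N := by linarith
  have hNp : B * N + A ≤ N ^ p := by
    have h1 : B + A ≤ N ^ (p - 1) := by
      have := rpow_le_rpow (by positivity) (le_max_right 1 ((B + A) ^ (1 / (p - 1)))) hp1.le
      rwa [← rpow_mul (by positivity), one_div_mul_cancel hp1.ne', rpow_one, ← hN] at this
    have h2 : N ^ p = N * N ^ (p - 1) := by
      rw [mul_comm, ← rpow_add_one hN0.ne']; ring_nf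
    rw [h2]
    nlinarith
  set cl : ℝ → ℝ := fun τ => max 0 (min N τ) with hcl
  have hclm : ∀ τ, cl τ ∈ Icc 0 N := fun τ =>
    ⟨le_max_left _ _, max_le hN0.le (min_le_left _ _)⟩
  have hclc : Continuous cl := by simp only [hcl]; fun_prop
  have hclL : ∀ σ τ, |cl σ - cl τ| ≤ |σ - τ| := abs_clamp_sub_le N
  have hcla : ∀ τ, |cl τ| ≤ N := fun τ => by rw [abs_of_nonneg (hclm τ).1]; exact (hclm τ).2
  have hclp : ∀ τ, |cl τ ^ p| ≤ N ^ p := fun τ => by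
    rw [abs_of_nonneg (rpow_nonneg (hclm τ).1 _)]
    exact rpow_le_rpow (hclm τ).1 (hclm τ).2 (by linarith)
  set χ : Euc d → ℝ := fun x => ramp (L + 1 - ‖x‖) with hχ
  have hχ1 : ∀ x, |χ x| ≤ 1 := fun x => abs_ramp_le_one _
  have hχc : Continuous χ := by simp only [hχ]; fun_prop
  set G : Euc d × ℝ → ℝ → ℝ := fun y τ => b y.1 * cl τ - χ y.1 * cl τ ^ p + s y with hG
  have hrc : Continuous fun τ => cl τ ^ p := hclc.rpow_const fun _ => Or.inr (by linarith)
  have hGc : Continuous fun z : (Euc d × ℝ) × ℝ => G z.1 z.2 := by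
    simp only [hG]
    have h1 : Continuous fun z : (Euc d × ℝ) × ℝ => cl z.2 ^ p := hrc.comp continuous_snd
    fun_prop
  have hGB : ∀ y τ, |G y τ| ≤ B * N + N ^ p + A := fun y τ => by
    have h1 : |b y.1 * cl τ| ≤ B * N := by
      rw [abs_mul]; exact mul_le_mul (hbB _) (hcla τ) (abs_nonneg _) hB0
    have h2 : |χ y.1 * cl τ ^ p| ≤ N ^ p := by
      rw [abs_mul]
      exact (mul_le_of_le_one_left (abs_nonneg _) (hχ1 _)).trans (hclp τ)
    rw [abs_le] at *
    have := hs0 y; have := hsA y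
    constructor <;> simp only [hG] <;> linarith
  have hGL : ∀ y σ τ, |G y σ - G y τ| ≤ (B + p * N ^ (p - 1)) * |σ - τ| := fun y σ τ => by
    have h1 : |b y.1 * (cl σ - cl τ)| ≤ B * |σ - τ| := by
      rw [abs_mul]; exact mul_le_mul (hbB _) (hclL σ τ) (abs_nonneg _) hB0
    have h2 : |χ y.1 * (cl σ ^ p - cl τ ^ p)| ≤ p * N ^ (p - 1) * |σ - τ| := by
      rw [abs_mul]
      refine (mul_le_of_le_one_left (abs_nonneg _) (hχ1 _)).trans
        ((abs_rpow_sub_rpow_le hp.le (hclm σ) (hclm τ)).trans ?_)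
      exact mul_le_mul_of_nonneg_left (hclL σ τ) (by positivity)
    have h3 : G y σ - G y τ = b y.1 * (cl σ - cl τ) - χ y.1 * (cl σ ^ p - cl τ ^ p) := by
      simp only [hG]; ring
    rw [h3, add_mul]
    exact (abs_sub _ _).trans (add_le_add h1 h2)
  have hcl0 : cl 0 = 0 := max_eq_left (min_le_right _ _)
  have hG0 : ∀ x t, t ≤ 0 → G (x, t) 0 = 0 := fun x t ht => by
    simp [hG, hcl0, hst x t ht, zero_rpow (by linarith : p ≠ 0)]
  obtain ⟨u, huc, hu0, hu⟩ := exists_eq_cv_heatKernel hGc hGB (by positivity) hGL hG0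
  set f : Euc d × ℝ → ℝ := fun y => G y (u y) with hf
  have hfc : Continuous f := hGc.comp (f := fun y : Euc d × ℝ => (y, u y)) (by fun_prop)
  have hfB : ∀ y, |f y| ≤ B * N + N ^ p + A := fun y => hGB y _
  have hf0 : ∀ x t, t ≤ 0 → f (x, t) = 0 := fun x t ht => by
    simp only [hf]; rw [hu0 x t ht]; exact hG0 x t ht
  have hχ0 : ∀ x, L + 1 ≤ ‖x‖ → χ x = 0 := fun x hx => ramp_of_nonpos (by linarith)
  have hfL : ∀ x t, L + 1 ≤ ‖x‖ → f (x, t) = 0 := fun x t hx => by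
    simp [hf, hG, hχ0 x hx, hbL x (by linarith), hsL x t (by linarith)]
  have hχH : ∀ x y, |χ x - χ y| ≤ (1 + 2) * ‖x - y‖ ^ α := fun x y => by
    refine le_mul_rpow_of_le ((abs_sub _ _).trans ?_) ?_ (norm_nonneg _) (by norm_num)
      (by norm_num) hα hα1
    · linarith [hχ1 x, hχ1 y]
    · refine (abs_ramp_sub_le _ _).trans ?_
      rw [one_mul, sub_sub_sub_cancel_left, norm_sub_rev x y]
      exact abs_norm_sub_norm_le _ _
  have hfH : ∀ T, ∃ C, ∀ x y t, t ≤ T → |f (x, t) - f (y, t)| ≤ C * ‖x - y‖ ^ α := fun T => by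
    obtain ⟨C, hC0, hC⟩ := cv_heatKernel_lipschitz hfc.measurable hfB hf0 hfL (by linarith)
      (max (L + 1) T)
    simp only [← hu] at hC
    set K : Set (Euc d) := Metric.closedBall 0 (L + 1)
    have hxK : ∀ x ∈ K, ‖x‖ ≤ max (L + 1) T := fun x hx =>
      le_max_of_le_left (mem_closedBall_zero_iff.1 hx)
    have hKx : ∀ x ∉ K, L + 1 ≤ ‖x‖ := fun x hx => by
      by_contra h; exact hx (mem_closedBall_zero_iff.2 (by linarith))
    refine ⟨(B * (C + 2 * N) + N * H) + (1 * (p * N ^ (p - 1) * C + 2 * N ^ p) +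
      N ^ p * (1 + 2)) + Cs, fun x y t ht => ?_⟩
    have hd : ∀ x ∈ K, ∀ y ∈ K, |cl (u (x, t)) - cl (u (y, t))| ≤ C * ‖x - y‖ :=
      fun x hx y hy => (hclL _ _).trans (hC x y t (hxK x hx) (hxK y hy) (le_max_of_le_right ht))
    have h1 := abs_mul_sub_mul_le_rpow (w := fun x => cl (u (x, t))) (K := K) hbB hbH
      (fun x hx => hbL x (by linarith [hKx x hx])) (fun x _ => hcla _)
      (fun x hx y hy => le_mul_rpow_of_le (M := 2 * N) (c := C) ((abs_sub _ _).trans (by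
        linarith [hcla (u (x, t)), hcla (u (y, t))])) (hd x hx y hy) (norm_nonneg _)
        (by positivity) hC0 hα hα1) hN0.le (by positivity) x y
    have h2 := abs_mul_sub_mul_le_rpow (w := fun x => cl (u (x, t)) ^ p) (K := K) hχ1 hχH
      (fun x hx => hχ0 x (hKx x hx)) (fun x _ => hclp _)
      (fun x hx y hy => le_mul_rpow_of_le (M := 2 * N ^ p) (c := p * N ^ (p - 1) * C)
        ((abs_sub _ _).trans (by linarith [hclp (u (x, t)), hclp (u (y, t))]))
        ((abs_rpow_sub_rpow_le hp.le (hclm _) (hclm _)).trans (by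
          rw [mul_assoc _ C]
          exact mul_le_mul_of_nonneg_left (hd x hx y hy) (by positivity))) (norm_nonneg _)
        (by positivity) (by positivity) hα hα1) (by positivity) (by positivity) x y
    have h3 := hsH x y t
    have h4 : f (x, t) - f (y, t) = (b x * cl (u (x, t)) - b y * cl (u (y, t))) -
        (χ x * cl (u (x, t)) ^ p - χ y * cl (u (y, t)) ^ p) + (s (x, t) - s (y, t)) := by
      simp only [hf, hG]; ring
    rw [h4, add_mul, add_mul]
    exact (abs_add_le _ _).trans (add_le_add ((abs_sub _ _).trans (add_le_add h1 h2)) h3)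
  have hueq : u = cv heatKernel f := funext hu
  have hheat : ∀ q, HeatAt u f q := by
    rw [hueq]
    exact heatAt_cv_heatKernel hα hfc hfB hf0 hfL (by linarith) hfH
  have hbd : ∀ x {t T : ℝ}, t ≤ T → |u (x, t)| ≤ (B * N + N ^ p + A) *
      ∫ y : Euc d × ℝ, |truncKer T y| := fun x t T ht => by
    rw [hueq]; exact abs_cv_heatKernel_le hfB hf0 ht
  have hunn : ∀ y, 0 ≤ u y := fun ⟨x, t⟩ => by
    rcases le_or_gt t 0 with ht | ht
    · exact (hu0 x t ht).ge
    · have := heat_max_principle_of_le (T := t) (D := fun y => -u y) (F := fun y => -f y)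
        huc.neg.continuousOn (fun x => by simp [hu0 x 0 le_rfl])
        (fun x s hs => (neg_le_abs _).trans (hbd x hs.2)) (fun x r _ hD => ⟨(hheat _).neg, by
          have : cl (u (x, r)) = 0 := max_eq_left ((min_le_right _ _).trans (by linarith))
          simpa [hf, hG, this, zero_rpow (by linarith : p ≠ 0)] using hs0 (x, r)⟩)
        x t ⟨ht.le, le_rfl⟩
      linarith
  have huN : ∀ y, u y ≤ N := fun ⟨x, t⟩ => by
    rcases le_or_gt t 0 with ht | ht
    · exact (hu0 x t ht).le.trans hN0.le
    · have := heat_max_principle_of_le (T := t) (D := fun y => u y - N) (F := f)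
        (huc.sub continuous_const).continuousOn (fun x => by simp [hu0 x 0 le_rfl, hN0.le])
        (fun x s hs => (sub_le_self _ hN0.le).trans ((le_abs_self _).trans (hbd x hs.2)))
        (fun x r _ hD => ⟨(hheat _).sub_const N, by
          have h1 : cl (u (x, r)) = N := by
            simp only [hcl]
            rw [min_eq_left (by linarith), max_eq_right hN0.le]
          simp only [hf, hG, h1]
          rcases le_or_gt ‖x‖ L with hx | hx
          · have : χ x = 1 := ramp_of_one_le (by linarith)
            rw [this]
            have := mul_le_mul_of_nonneg_right ((le_abs_self _).trans (hbB x)) hN0.le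
            linarith [hsA (x, r)]
          · rw [hbL x hx.le, hsL x r hx.le]
            have : 0 ≤ χ x * N ^ p := mul_nonneg (ramp_nonneg _) (by positivity)
            linarith⟩)
        x t ⟨ht.le, le_rfl⟩
      linarith
  have hfe : f = fun y => b y.1 * u y - ramp (L + 1 - ‖y.1‖) * u y ^ p + s y := by
    funext y
    have : cl (u y) = u y := by
      simp only [hcl]
      rw [min_eq_right (huN y), max_eq_right (hunn y)]
    simp only [hf, hG, this, hχ]
  refine ⟨u, hunn, ⟨N, huN⟩, ?_⟩
  rw [← hfe]
  exact ⟨huc, hfc, ⟨_, hfB⟩, hf0, hu0, hu, hheat⟩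

lemma heatAt_radial {h h₁ g : ℝ → ℝ} {h₂ g' t : ℝ} (a x : Euc d)
    (hc : ContDiffAt ℝ 2 h (‖x - a‖ ^ 2))
    (hh : ∀ᶠ s in 𝓝 (‖x - a‖ ^ 2), HasDerivAt h (h₁ s) s)
    (hh₁ : HasDerivAt h₁ h₂ (‖x - a‖ ^ 2)) (hg : ContDiffAt ℝ 1 g t) (hg' : HasDerivAt g g' t) :
    HeatAt (fun y => h (‖y.1 - a‖ ^ 2) - g y.2)
      (fun _ => -g' - (2 * ‖x - a‖ ^ 2 * h₂ + d * h₁ (‖x - a‖ ^ 2))) (x, t) := by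
  have hn : ContDiffAt ℝ 2 (fun y : Euc d => ‖y - a‖ ^ 2) x :=
    ((contDiff_id.sub contDiff_const).norm_sq ℝ).contDiffAt
  refine ⟨?_, ContDiffAt.sub (f := fun _ => h (‖x - a‖ ^ 2)) contDiffAt_const hg, ?_⟩
  · exact ContDiffAt.sub (g := fun _ => g t)
      (hc.comp (f := fun y : Euc d => ‖y - a‖ ^ 2) x hn) contDiffAt_const
  · have h1 := sum_pd_pd_radial (a := a) (x := x) (h := fun s => h s - g t) (h₁ := h₁)
      (hh.mono fun s hs => hs.sub_const _) hh₁
    simp only at h1 ⊢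
    rw [h1, (hg'.const_sub _).deriv]
    ring

lemma heatAt_radial_rpow {g : ℝ → ℝ} {c α σ m g' t : ℝ} (a x : Euc d)
    (hpos : 0 < α + σ * ‖x - a‖ ^ 2) (hg : ContDiffAt ℝ 1 g t) (hg' : HasDerivAt g g' t) :
    HeatAt (fun y => c * (α + σ * ‖y.1 - a‖ ^ 2) ^ (-m) - g y.2)
      (fun _ => -g' - c * (2 * σ ^ 2 * m * (m + 1) * ‖x - a‖ ^ 2 *
          (α + σ * ‖x - a‖ ^ 2) ^ (-m - 2) -
        d * σ * m * (α + σ * ‖x - a‖ ^ 2) ^ (-m - 1))) (x, t) := by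
  have hlin : ∀ s, HasDerivAt (fun s : ℝ => α + σ * s) σ s := fun s => by
    simpa using ((hasDerivAt_id s).const_mul σ).const_add α
  have hev : ∀ᶠ s in 𝓝 (‖x - a‖ ^ 2), 0 < α + σ * s :=
    ((hlin _).continuousAt.eventually (lt_mem_nhds hpos))
  have hd : ∀ e s, 0 < α + σ * s →
      HasDerivAt (fun s : ℝ => (α + σ * s) ^ e) (σ * e * (α + σ * s) ^ (e - 1)) s :=
    fun e s hs => (hlin s).rpow_const (Or.inl hs.ne')
  have h1 := (hd (-m - 1) _ hpos).const_mul (c * (-(σ * m)))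
  refine (heatAt_radial (h := fun s => c * (α + σ * s) ^ (-m))
    (h₁ := fun s => c * (-(σ * m)) * (α + σ * s) ^ (-m - 1)) a x ?_ ?_ h1 hg hg').congr
    (Eventually.of_forall fun _ => rfl) ?_
  · exact contDiffAt_const.mul (ContDiffAt.rpow_const_of_ne
      (contDiffAt_const.add (contDiffAt_const.mul contDiffAt_id)) hpos.ne')
  · filter_upwards [hev] with s hs
    exact ((hd (-m) s hs).const_mul c).congr_deriv (by ring)
  · rw [show -m - 1 - 1 = -m - 2 by ring]
    ring

/-- Interior bound for the reaction-diffusion equation, independent of the data. -/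
lemma exists_interior_bound (d : ℕ) {p b R : ℝ} (hp : 1 < p) (hb : 0 ≤ b) (hR : 0 < R) :
    ∃ M, ∀ (u f : Euc d × ℝ → ℝ) (x₀ : Euc d) (N : ℝ), Continuous u → (∀ y, u y ≤ N) →
      (∀ x t, t ≤ 0 → u (x, t) = 0) → (∀ q, HeatAt u f q) →
      (∀ x t, ‖x - x₀‖ < R → 0 < u (x, t) → f (x, t) ≤ b * u (x, t) - u (x, t) ^ p) →
      ∀ x t, ‖x - x₀‖ ≤ R / 2 → u (x, t) ≤ M := by
  have hp1 : 0 < p - 1 := by linarith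
  set q := 2 / (p - 1) with hq
  have hq0 : 0 < q := by positivity
  have hqp : -q * p = -q - 2 := by rw [hq]; field_simp; ring
  set Q := 2 * q * (q + 1) * R ^ 2 + d * q * R ^ 2 + b * R ^ 4 with hQ
  have hQ0 : 0 < Q := by positivity
  set C := Q ^ (1 / (p - 1)) with hC
  have hC0 : 0 < C := by positivity
  have hCp : C ^ p = C * Q := by
    rw [hC, ← rpow_mul hQ0.le, ← rpow_add_one hQ0.ne']
    congr 1
    field_simp
    ring
  refine ⟨C * (R ^ 2 - (R / 2) ^ 2) ^ (-q), fun u f x₀ N huc huN hu0 hH hf x t hx => ?_⟩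
  have hbar0 : 0 < R ^ 2 - (R / 2) ^ 2 := by nlinarith
  rcases le_or_gt t 0 with ht | ht
  · rw [hu0 x t ht]; positivity
  set U : Euc d → ℝ := fun x => C * (R ^ 2 + -1 * ‖x - x₀‖ ^ 2) ^ (-q) with hU
  have hφ : ∀ x ∈ Metric.ball x₀ R, 0 < R ^ 2 + -1 * ‖x - x₀‖ ^ 2 := fun x hx => by
    rw [mem_ball_iff_norm] at hx
    nlinarith [norm_nonneg (x - x₀)]
  have hcont : ContinuousOn (fun y : Euc d × ℝ => u y - U y.1) (Metric.ball x₀ R ×ˢ Icc 0 t) := by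
    refine huc.continuousOn.sub (ContinuousOn.mul continuousOn_const
      (ContinuousOn.rpow_const (by fun_prop) fun y hy => Or.inl (hφ _ hy.1).ne'))
  have hmax := heat_max_principle (b := b) (F := fun y => f y - (0 - C * (2 * (-1) ^ 2 * q *
      (q + 1) * ‖y.1 - x₀‖ ^ 2 * (R ^ 2 + -1 * ‖y.1 - x₀‖ ^ 2) ^ (-q - 2) -
      d * (-1) * q * (R ^ 2 + -1 * ‖y.1 - x₀‖ ^ 2) ^ (-q - 1)))) Metric.isOpen_ball hcont
    (fun x hx => ?_) (fun m hm => ?_) (fun x hx s hs hD => ⟨?_, ?_⟩) x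
    (by rw [mem_ball_iff_norm]; linarith) t ⟨ht.le, le_rfl⟩
  · simp only [hU] at hmax
    refine (sub_nonpos.1 hmax).trans (mul_le_mul_of_nonneg_left
      (rpow_le_rpow_of_nonpos hbar0 ?_ (by linarith)) hC0.le)
    have := pow_le_pow_left₀ (norm_nonneg _) hx 2
    linarith
  · simp only [hu0 x 0 le_rfl, zero_sub, hU]
    have := hφ x hx
    have : 0 ≤ C * (R ^ 2 + -1 * ‖x - x₀‖ ^ 2) ^ (-q) := by positivity
    linarith
  · set N' := max N 1
    have hN' : 0 < N' := lt_max_of_lt_right one_pos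
    set δ := (N' / C) ^ (-1 / q) with hδ
    have hδ0 : 0 < δ := by positivity
    have hδq : δ ^ (-q) = N' / C := by
      rw [hδ, ← rpow_mul (by positivity), show -1 / q * -q = 1 by field_simp, rpow_one]
    refine ⟨{x | ‖x - x₀‖ ^ 2 ≤ R ^ 2 - δ}, fun x hx => ?_, ?_, fun x hx s hs hD => ?_⟩
    · rw [mem_ofPred_eq] at hx
      rw [mem_ball_iff_norm]
      exact lt_of_pow_lt_pow_left₀ 2 hR.le (by linarith)
    · refine Metric.isCompact_of_isClosed_isBounded
        (isClosed_le (by fun_prop) continuous_const) ?_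
      refine (Metric.isBounded_closedBall (x := x₀) (r := R)).subset fun x hx => ?_
      rw [mem_ofPred_eq] at hx
      rw [mem_closedBall_iff_norm]
      exact le_of_sq_le_sq (by linarith) hR.le
    · rw [mem_ofPred_eq]
      by_contra hlt
      have h1 : N' / C < (R ^ 2 + -1 * ‖x - x₀‖ ^ 2) ^ (-q) := by
        rw [← hδq]
        exact rpow_lt_rpow_of_neg (hφ x hx) (by linarith) (by linarith)
      rw [div_lt_iff₀ hC0] at h1
      simp only [hU] at hD
      linarith [huN (x, s), le_max_left N 1]
  · refine ((hH (x, s)).sub (heatAt_radial_rpow (c := C) (m := q) (g := fun _ => 0) x₀ x (hφ x hx)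
      contDiffAt_const (hasDerivAt_const s 0))).congr
      (Eventually.of_forall fun y => by simp [hU]) (by simp)
  · have hP := hφ x hx
    set P := R ^ 2 + -1 * ‖x - x₀‖ ^ 2 with hPdef
    have hxR : ‖x - x₀‖ ^ 2 ≤ R ^ 2 := by linarith
    have hPR : P ≤ R ^ 2 := by nlinarith [sq_nonneg ‖x - x₀‖]
    have hUx : U x = C * P ^ (-q) := rfl
    have hU0 : 0 < U x := by rw [hUx]; positivity
    have hu : U x < u (x, s) := by simpa using hD
    have h1 := hf x s (mem_ball_iff_norm.1 hx) (hU0.trans hu)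
    have h2 : U x ^ p ≤ u (x, s) ^ p := rpow_le_rpow hU0.le hu.le (by linarith)
    have h3 : U x ^ p = C * Q * P ^ (-q - 2) := by
      rw [hUx, mul_rpow hC0.le (by positivity), ← rpow_mul hP.le, hqp, hCp]
    have h4 : P ^ (-q - 1) = P * P ^ (-q - 2) := by
      rw [mul_comm, ← rpow_add_one hP.ne']; congr 1; ring
    have h5 : U x = C * (P ^ 2 * P ^ (-q - 2)) := by
      rw [hUx, ← rpow_natCast P 2, ← rpow_add hP]; congr 2; push_cast; ring
    have h6 : 2 * q * (q + 1) * ‖x - x₀‖ ^ 2 + d * q * P + b * P ^ 2 ≤ Q := by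
      have e1 := mul_le_mul_of_nonneg_left hxR (by positivity : 0 ≤ 2 * q * (q + 1))
      have e2 := mul_le_mul_of_nonneg_left hPR (by positivity : 0 ≤ d * q)
      have e3 := mul_le_mul_of_nonneg_left (pow_le_pow_left₀ hP.le hPR 2) hb
      rw [hQ]
      linarith [show b * (R ^ 2) ^ 2 = b * R ^ 4 by ring]
    have h7 := mul_le_mul_of_nonneg_left h6 (by positivity : 0 ≤ C * P ^ (-q - 2))
    simp only
    rw [h4]
    have h8 : b * (u (x, s) - U x) = b * u (x, s) - b * (C * (P ^ 2 * P ^ (-q - 2))) := by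
      rw [mul_sub, ← h5]
    rw [h8]
    nlinarith

lemma subsolution_inequality {b κ e m ε n r S t a z Y : ℝ} (hb : 0 ≤ b)
    (he : 0 ≤ e) (hm : 0 < m) (hε : 0 < ε) (hr : 0 < r) (hn : 1 ≤ n * r) (hS : S = r + ε)
    (ha : 0 < a) (haκ : 2 * m ≤ κ * a) (ht : a * S ≤ t) (hεn : ε * n * (b + e) ≤ κ / 4)
    (hz : 0 ≤ z) (hY : 0 ≤ Y) :
    m * Y / t - (z + Y) / S * (b + κ - e * ε / S) ≤ -b / r * z - z * (κ / (4 * S)) := by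
  have hS0 : 0 < S := by rw [hS]; positivity
  have ht0 : 0 < t := (mul_pos ha hS0).trans_le ht
  have hκ : 0 < κ := by
    by_contra h
    nlinarith
  have hn0 : 0 < n := by
    by_contra h
    nlinarith
  have h1 : m * Y / t ≤ κ / 2 * Y / S := by
    rw [div_le_div_iff₀ ht0 hS0]
    nlinarith [mul_le_mul_of_nonneg_left ht (mul_nonneg hκ.le hY),
      mul_le_mul_of_nonneg_right haκ (mul_nonneg hY hS0.le)]
  have hS1 : 1 / S ≤ n := by
    rw [div_le_iff₀ hS0, hS]; nlinarith [mul_pos hn0 hε]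
  have h2 : e * ε / S ≤ e * (ε * n) := by
    rw [mul_div_assoc, div_eq_mul_one_div]
    exact mul_le_mul_of_nonneg_left (mul_le_mul_of_nonneg_left hS1 hε.le) he
  have h3 : b / r ≤ (b + b * (ε * n)) / S := by
    rw [div_le_div_iff₀ hr hS0, hS]
    nlinarith [mul_nonneg hb hε.le]
  have h4 : (z + Y) / S * (b + κ - e * ε / S) ≥ (z + Y) / S * (b + κ - e * (ε * n)) :=
    mul_le_mul_of_nonneg_left (by linarith) (by positivity)
  have h5 : b / r * z ≤ (b + b * (ε * n)) / S * z := mul_le_mul_of_nonneg_right h3 hz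
  have h6 : κ / 2 * Y / S - (z + Y) / S * (b + κ - e * (ε * n)) +
      (b + b * (ε * n)) / S * z + z * (κ / (4 * S)) =
      (Y * (κ / 2 - b - κ + e * (ε * n)) + z * (e * (ε * n) + b * (ε * n) + κ / 4 - κ)) / S := by
    field_simp
    ring
  have h7 : (Y * (κ / 2 - b - κ + e * (ε * n)) +
      z * (e * (ε * n) + b * (ε * n) + κ / 4 - κ)) / S ≤ 0 := by
    refine div_nonpos_of_nonpos_of_nonneg ?_ hS0.le
    have e1 : e * (ε * n) + b * (ε * n) ≤ κ / 4 := by linarith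
    have e2 : 0 ≤ b * (ε * n) := by positivity
    nlinarith [mul_nonneg hY (by linarith : 0 ≤ -(κ / 2 - b - κ + e * (ε * n))),
      mul_nonneg hz (by linarith : 0 ≤ -(e * (ε * n) + b * (ε * n) + κ / 4 - κ))]
  have h8 : -b / r * z = -(b / r * z) := by ring
  linarith

/-- Lower bound for solutions of the reaction-diffusion equation with a source near the origin. -/
lemma le_of_source {p b κ m ε n a c B : ℝ} (hp : 1 < p) (hm : m = 1 / (p - 1)) (hb : 0 ≤ b)
    (hbκ : b + κ = m * (2 * m + 2 - d)) (hκ : 0 < κ) (hε : 0 < ε) (ha : 0 < a)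
    (haκ : 2 * m ≤ κ * a) (hεn : ε * n * (b + 2 * m * (m + 1)) ≤ κ / 4) (hc : 0 < c)
    (hcκ : c ^ (p - 1) = κ / 4) (hB0 : 0 ≤ B)
    {u f s : Euc d × ℝ → ℝ} {β : Euc d → ℝ} (hu : Continuous u) (hunn : ∀ y, 0 ≤ u y)
    (hH : ∀ y, HeatAt u f y) (hf : ∀ x t, β x * u (x, t) - u (x, t) ^ p + s (x, t) ≤ f (x, t))
    (hβB : ∀ x, |β x| ≤ B) (hβb : ∀ x, x ≠ 0 → -b / ‖x‖ ^ 2 ≤ β x) (hs0 : ∀ y, 0 ≤ s y)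
    (hs : ∀ x t, n * ‖x‖ ^ 2 < 1 → a * ε ≤ t →
      c * ε ^ (-m) * (m / (a * ε) + 2 * m * (m + 1) / ε + B) + (c * ε ^ (-m)) ^ p ≤ s (x, t))
    (x : Euc d) {t : ℝ} (ht : 0 < t) :
    c * (‖x‖ ^ 2 + ε) ^ (-m) - c * (t / a) ^ (-m) ≤ u (x, t) := by
  have hp1 : 0 < p - 1 := by linarith
  have hm0 : 0 < m := by rw [hm]; positivity
  have haε : 0 < a * ε := by positivity
  set g : ℝ → ℝ := fun t => c * (max t (a * ε) / a) ^ (-m) with hg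
  set W : Euc d → ℝ := fun x => c * (ε + 1 * ‖x - 0‖ ^ 2) ^ (-m) with hW
  have hSpos : ∀ x : Euc d, 0 < ε + 1 * ‖x - 0‖ ^ 2 := fun x => by positivity
  have hmaxpos : ∀ t : ℝ, 0 < max t (a * ε) / a := fun t =>
    div_pos (lt_max_of_lt_right haε) ha
  have hWle : ∀ x, W x ≤ c * ε ^ (-m) := fun x =>
    mul_le_mul_of_nonneg_left (rpow_le_rpow_of_nonpos hε (by
      have : 0 ≤ ‖x - 0‖ ^ 2 := by positivity
      linarith) (by linarith)) hc.le
  have hgε : ∀ t, t ≤ a * ε → g t = c * ε ^ (-m) := fun t ht => by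
    simp only [hg]
    rw [max_eq_right ht, mul_div_cancel_left₀ _ ha.ne']
  have hgt : ∀ t, a * ε ≤ t → g t = c * (t / a) ^ (-m) := fun t ht => by
    simp only [hg]
    rw [max_eq_left ht]
  have hpos_iff : ∀ x t, 0 < W x - g t → a * (ε + 1 * ‖x - 0‖ ^ 2) < t := fun x t h => by
    have h1 : (max t (a * ε) / a) ^ (-m) < (ε + 1 * ‖x - 0‖ ^ 2) ^ (-m) :=
      lt_of_mul_lt_mul_left (sub_pos.1 h) hc.le
    have h2 : ε + 1 * ‖x - 0‖ ^ 2 < max t (a * ε) / a := by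
      by_contra h3
      exact absurd h1 (not_lt.2 (rpow_le_rpow_of_nonpos (hmaxpos t) (not_lt.1 h3) (by linarith)))
    rw [lt_div_iff₀ ha, lt_max_iff] at h2
    rcases h2 with h2 | h2
    · linarith
    · have : 0 ≤ a * ‖x - 0‖ ^ 2 := by positivity
      linarith
  have hgc : Continuous g := by
    simp only [hg]
    exact continuous_const.mul (Continuous.rpow_const (by fun_prop)
      fun t => Or.inl (hmaxpos t).ne')
  have hWc : Continuous W := by
    simp only [hW]
    exact continuous_const.mul (Continuous.rpow_const (by fun_prop)
      fun x => Or.inl (hSpos x).ne')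
  set FZ : Euc d × ℝ → ℝ := fun y => m * g y.2 / y.2 - W y.1 / (ε + 1 * ‖y.1 - 0‖ ^ 2) *
    (b + κ - 2 * m * (m + 1) * ε / (ε + 1 * ‖y.1 - 0‖ ^ 2)) with hFZ
  have hZ : ∀ x t, a * ε < t → HeatAt (fun y => W y.1 - g y.2) FZ (x, t) := fun x t ht => by
    have ht0 : 0 < t := haε.trans ht
    have hta : 0 < t / a := by positivity
    have hd : HasDerivAt (fun t => c * (t / a) ^ (-m)) (-(m * g t / t)) t := by
      have h1 : HasDerivAt (fun t => c * (t / a) ^ (-m)) _ t :=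
        (((hasDerivAt_id t).div_const a).rpow_const (p := -m) (Or.inl hta.ne')).const_mul c
      refine h1.congr_deriv ?_
      simp only [id]
      rw [hgt t ht.le, rpow_sub_one hta.ne']
      field_simp
    have hev : g =ᶠ[𝓝 t] fun t => c * (t / a) ^ (-m) := by
      filter_upwards [lt_mem_nhds ht] with r hr using hgt r (le_of_lt hr)
    have hcd : ContDiffAt ℝ 1 (fun t => c * (t / a) ^ (-m)) t :=
      contDiffAt_const.mul ((contDiffAt_id.div_const a).rpow_const_of_ne hta.ne')
    refine (heatAt_radial_rpow (c := c) (m := m) 0 x (hSpos x) (hcd.congr_of_eventuallyEq hev)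
      (hd.congr_of_eventuallyEq hev)).congr (Eventually.of_forall fun y => rfl) ?_
    simp only [hFZ, hW]
    have hS := hSpos x
    have hSr : ‖x - 0‖ ^ 2 = (ε + 1 * ‖x - 0‖ ^ 2) - ε := by ring
    generalize ε + 1 * ‖x - 0‖ ^ 2 = S at hS hSr ⊢
    rw [hSr, rpow_sub_one hS.ne', show -m - 2 = -m - 1 - 1 by ring, rpow_sub_one hS.ne',
      rpow_sub_one hS.ne', hbκ]
    field_simp
    ring
  have key := heat_max_principle (O := univ) (T := t) (b := B) (D := fun y => (W y.1 - g y.2) - u y)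
    (F := fun y => FZ y - f y) isOpen_univ
    (((hWc.comp continuous_fst).sub (hgc.comp continuous_snd)).sub hu).continuousOn
    (fun x _ => ?_) (fun M hM => ?_) (fun x _ r hr hD => ?_) x (mem_univ _) t ⟨ht.le, le_rfl⟩
  · have h1 : g t ≤ c * (t / a) ^ (-m) :=
      mul_le_mul_of_nonneg_left (rpow_le_rpow_of_nonpos (by positivity)
        (by gcongr; exact le_max_left _ _) (by linarith)) hc.le
    have h2 : W x = c * (‖x‖ ^ 2 + ε) ^ (-m) := by
      simp only [hW, sub_zero, one_mul, add_comm]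
    rw [← h2]
    simp only at key
    linarith
  · simp only
    rw [hgε 0 haε.le]
    linarith [hWle x, hunn (x, 0)]
  · refine ⟨Metric.closedBall 0 √(t / a), subset_univ _, isCompact_closedBall _ _,
      fun x _ r hr hD => ?_⟩
    have h1 := hpos_iff x r (by linarith [hunn (x, r)])
    rw [mem_closedBall_iff_norm]
    refine Real.le_sqrt_of_sq_le ?_
    rw [le_div_iff₀ ha]
    nlinarith [hr.2]
  · have hz : 0 < W x - g r := by
      simp only at hD
      linarith [hunn (x, r)]
    have htr := hpos_iff x r hz
    have hr0 : a * ε < r :=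
      (mul_le_mul_of_nonneg_left (by linarith [sq_nonneg ‖x - 0‖]) ha.le).trans_lt htr
    refine ⟨(hZ x r hr0).sub (hH (x, r)), ?_⟩
    simp only
    have hg0 : 0 < g r := mul_pos hc (rpow_pos_of_pos (hmaxpos r) _)
    have hW0 : 0 < W x := by linarith
    have hzp : u (x, r) ^ p ≤ (W x - g r) ^ p :=
      rpow_le_rpow (hunn _) (by simp only at hD; linarith) (by linarith)
    have hβD : β x * (W x - g r - u (x, r)) ≤ B * (W x - g r - u (x, r)) :=
      mul_le_mul_of_nonneg_right ((le_abs_self _).trans (hβB x)) hD.le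
    suffices h : FZ (x, r) ≤ β x * (W x - g r) - (W x - g r) ^ p + s (x, r) by
      have h1 := hf x r
      have h2 : β x * (W x - g r - u (x, r)) = β x * (W x - g r) - β x * u (x, r) := by ring
      linarith
    have hS := hSpos x
    have hSr : ε + 1 * ‖x - 0‖ ^ 2 = ‖x‖ ^ 2 + ε := by rw [sub_zero]; ring
    rcases lt_or_ge (n * ‖x‖ ^ 2) 1 with hx | hx
    · have h1 := hs x r hx hr0.le
      set W₀ := c * ε ^ (-m) with hW₀
      have hW₀0 : 0 < W₀ := by positivity
      have e1 : (W x - g r) ^ p ≤ W₀ ^ p :=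
        rpow_le_rpow hz.le (by linarith [hWle x]) (by linarith)
      have e2 : -(B * W₀) ≤ β x * (W x - g r) := by
        have e3 : |β x * (W x - g r)| ≤ B * W₀ := by
          rw [abs_mul, abs_of_pos hz]
          exact mul_le_mul (hβB x) (by linarith [hWle x]) hz.le hB0
        exact (abs_le.1 e3).1
      have e4 : m * g r / r ≤ W₀ * (m / (a * ε)) := by
        rw [mul_comm m, mul_div_assoc]
        exact mul_le_mul (by linarith [hWle x]) (by gcongr) (div_nonneg hm0.le (haε.trans hr0).le)
          hW₀0.le
      have e5 : W x / (ε + 1 * ‖x - 0‖ ^ 2) * (2 * m * (m + 1) * ε / (ε + 1 * ‖x - 0‖ ^ 2)) ≤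
          W₀ * (2 * m * (m + 1) / ε) := by
        have hεS : ε ≤ ε + 1 * ‖x - 0‖ ^ 2 := by nlinarith [sq_nonneg ‖x - 0‖]
        have e6 : 2 * m * (m + 1) * ε / (ε + 1 * ‖x - 0‖ ^ 2) ≤ 2 * m * (m + 1) := by
          rw [div_le_iff₀ hS]; gcongr
        calc _ ≤ W₀ / ε * (2 * m * (m + 1)) := by
              gcongr
              exact hWle x
          _ = _ := by ring
      have e7 : 0 ≤ W x / (ε + 1 * ‖x - 0‖ ^ 2) * (b + κ) := by positivity
      simp only [hFZ]
      have h2 : W₀ * (m / (a * ε) + 2 * m * (m + 1) / ε + B) =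
          W₀ * (m / (a * ε)) + W₀ * (2 * m * (m + 1) / ε) + B * W₀ := by ring
      rw [mul_sub]
      linarith
    · have hx0 : x ≠ 0 := by
        rintro rfl
        norm_num at hx
      have hr2 : 0 < ‖x‖ ^ 2 := by positivity
      have h1 := subsolution_inequality (e := 2 * m * (m + 1)) hb (by positivity) hm0 hε hr2 hx hSr
        ha haκ htr.le hεn hz.le hg0.le
      rw [sub_add_cancel] at h1
      have h2 : -b / ‖x‖ ^ 2 * (W x - g r) ≤ β x * (W x - g r) :=
        mul_le_mul_of_nonneg_right (hβb x hx0) hz.le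
      have h3 : (W x - g r) ^ p ≤ (W x - g r) * (κ / (4 * (ε + 1 * ‖x - 0‖ ^ 2))) := by
        have h4 : (W x - g r) ^ p = (W x - g r) * (W x - g r) ^ (p - 1) := by
          rw [mul_comm, ← rpow_add_one hz.ne', sub_add_cancel]
        have h5 : W x ^ (p - 1) = κ / (4 * (ε + 1 * ‖x - 0‖ ^ 2)) := by
          simp only [hW]
          rw [mul_rpow hc.le (by positivity), hcκ, ← rpow_mul hS.le,
            show -m * (p - 1) = -1 by rw [hm]; field_simp, rpow_neg_one]
          field_simp
        rw [h4, ← h5]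
        exact mul_le_mul_of_nonneg_left (rpow_le_rpow hz.le (by linarith) hp1.le) hz.le
      have := hs0 (x, r)
      simp only [hFZ]
      linarith

lemma continuous_of_abs_sub_le_rpow {E : Type*} [SeminormedAddCommGroup E] {g : E → ℝ} {H α : ℝ}
    (hα : 0 < α) (hg : ∀ x y, |g x - g y| ≤ H * ‖x - y‖ ^ α) : Continuous g := by
  refine continuous_iff_continuousAt.2 fun x => tendsto_iff_norm_sub_tendsto_zero.2 ?_
  refine squeeze_zero (fun y => norm_nonneg _) (fun y => hg y x) ?_
  have h : Continuous fun y : E => H * ‖y - x‖ ^ α :=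
    continuous_const.mul (Continuous.rpow_const (by fun_prop) fun _ => Or.inr hα.le)
  simpa [zero_rpow hα.ne'] using h.tendsto x

lemma LocHolderOn.exists_bound {β : Euc d → ℝ} {S K : Set (Euc d)} (hβ : LocHolderOn β S)
    (hK : IsCompact K) (hKS : K ⊆ S) : ∃ W, 0 ≤ W ∧ ∀ x ∈ K, |β x| ≤ W := by
  obtain ⟨α, C, hα, -, hC, hH⟩ := hβ K hKS hK
  rcases K.eq_empty_or_nonempty with rfl | ⟨z, hz⟩
  · exact ⟨0, le_rfl, by simp⟩
  refine ⟨|β z| + C * Metric.diam K ^ α, by positivity, fun x hx => ?_⟩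
  have h1 : ‖x - z‖ ≤ Metric.diam K := by
    rw [← dist_eq_norm]; exact Metric.dist_le_diam_of_mem hK.isBounded hx hz
  have h2 := (hH x hx z hz).trans
    (mul_le_mul_of_nonneg_left (rpow_le_rpow (norm_nonneg _) h1 hα.le) hC)
  linarith [abs_sub_abs_le_abs_sub (β x) (β z)]

/-- A Lipschitz cutoff of a locally Hölder function is bounded and Hölder. -/
lemma LocHolderOn.exists_holder_mul {β θ : Euc d → ℝ} {S K : Set (Euc d)} {c : ℝ}
    (hβ : LocHolderOn β S) (hK : IsCompact K) (hKS : K ⊆ S) (hc : 0 ≤ c)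
    (hθ1 : ∀ x, |θ x| ≤ 1) (hθL : ∀ x y, |θ x - θ y| ≤ c * ‖x - y‖) (hθ0 : ∀ x ∉ K, θ x = 0) :
    ∃ α H B : ℝ, 0 < α ∧ α ≤ 1 ∧ 0 ≤ H ∧ 0 ≤ B ∧ (∀ x, |θ x * β x| ≤ B) ∧
      ∀ x y, |θ x * β x - θ y * β y| ≤ H * ‖x - y‖ ^ α := by
  obtain ⟨α, C, hα, hα1, hC, hH⟩ := hβ K hKS hK
  obtain ⟨W, hW, hβW⟩ := hβ.exists_bound hK hKS
  refine ⟨α, 1 * C + W * (c + 2), W, hα, hα1, by positivity, hW, fun x => ?_, fun x y => ?_⟩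
  · by_cases hx : x ∈ K
    · rw [abs_mul]
      nlinarith [hθ1 x, hβW x hx, abs_nonneg (θ x), abs_nonneg (β x)]
    · simp [hθ0 x hx, hW]
  · exact abs_mul_sub_mul_le_rpow hθ1 (fun x y => le_mul_rpow_of_le (M := 2)
      ((abs_sub _ _).trans (by linarith [hθ1 x, hθ1 y])) (hθL x y) (norm_nonneg _) (by norm_num)
      hc hα hα1) hθ0 hβW hH hW hC x y

/-- Cutoff to the annulus between the radii `1 / n` and `n + 1`. -/
noncomputable def annulusCutoff (n : ℝ) (x : Euc d) : ℝ :=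
  ramp (n * ‖x‖ - 1) * ramp (n + 1 - ‖x‖)

lemma annulusCutoff_nonneg (n : ℝ) (x : Euc d) : 0 ≤ annulusCutoff n x :=
  mul_nonneg (ramp_nonneg _) (ramp_nonneg _)

lemma annulusCutoff_le_one (n : ℝ) (x : Euc d) : annulusCutoff n x ≤ 1 :=
  mul_le_one₀ (ramp_le_one _) (ramp_nonneg _) (ramp_le_one _)

lemma abs_annulusCutoff_sub_le {n : ℝ} (hn : 0 ≤ n) (x y : Euc d) :
    |annulusCutoff n x - annulusCutoff n y| ≤ (n + 1) * ‖x - y‖ := by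
  have h0 := abs_norm_sub_norm_le x y
  have h1 : |ramp (n * ‖x‖ - 1) - ramp (n * ‖y‖ - 1)| ≤ n * ‖x - y‖ := by
    refine (abs_ramp_sub_le _ _).trans ?_
    rw [show n * ‖x‖ - 1 - (n * ‖y‖ - 1) = n * (‖x‖ - ‖y‖) by ring, abs_mul, abs_of_nonneg hn]
    gcongr
  have h2 : |ramp (n + 1 - ‖x‖) - ramp (n + 1 - ‖y‖)| ≤ ‖x - y‖ := by
    refine (abs_ramp_sub_le _ _).trans ?_
    rw [show n + 1 - ‖x‖ - (n + 1 - ‖y‖) = -(‖x‖ - ‖y‖) by ring, abs_neg]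
    exact h0
  have h3 : annulusCutoff n x - annulusCutoff n y =
      (ramp (n * ‖x‖ - 1) - ramp (n * ‖y‖ - 1)) * ramp (n + 1 - ‖x‖) +
      ramp (n * ‖y‖ - 1) * (ramp (n + 1 - ‖x‖) - ramp (n + 1 - ‖y‖)) := by
    simp only [annulusCutoff]; ring
  rw [h3]
  refine (abs_add_le _ _).trans ?_
  rw [abs_mul, abs_mul]
  have h4 := abs_ramp_le_one (n + 1 - ‖x‖)
  have h5 := abs_ramp_le_one (n * ‖y‖ - 1)
  nlinarith [abs_nonneg (ramp (n * ‖x‖ - 1) - ramp (n * ‖y‖ - 1)),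
    abs_nonneg (ramp (n + 1 - ‖x‖) - ramp (n + 1 - ‖y‖))]

/-- Approximate solutions that stay bounded away from zero at a fixed point. -/
lemma exists_approximation {p b κ m : ℝ} {β : Euc d → ℝ} {x₁ : Euc d} (hp : 1 < p)
    (hm : m = 1 / (p - 1)) (hb : 0 ≤ b) (hbκ : b + κ = m * (2 * m + 2 - d)) (hκ : 0 < κ)
    (hβ : LocHolderOn β {0}ᶜ) (hβb : ∀ x, x ≠ 0 → -b / ‖x‖ ^ 2 ≤ β x) (hx₁ : ‖x₁‖ = 1) :
    ∃ t₁ η : ℝ, 0 < t₁ ∧ 0 < η ∧ ∀ n : ℝ, 1 ≤ n → ∃ u f : Euc d × ℝ → ℝ, (∀ y, 0 ≤ u y) ∧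
      (∃ N, ∀ y, u y ≤ N) ∧ IsHeatPotential f u ∧
      (∀ x t, 2 ≤ n * ‖x‖ → ‖x‖ ≤ n → f (x, t) = β x * u (x, t) - u (x, t) ^ p) ∧
      η ≤ u (x₁, t₁) := by
  have hp1 : 0 < p - 1 := by linarith
  have hm0 : 0 < m := by rw [hm]; positivity
  set a := 2 * m / κ with ha_def
  have ha : 0 < a := by positivity
  have haκ : 2 * m ≤ κ * a := by rw [ha_def]; field_simp; rfl
  set c := (κ / 4) ^ (1 / (p - 1)) with hc_def
  have hc : 0 < c := by positivity
  have hcκ : c ^ (p - 1) = κ / 4 := by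
    rw [hc_def, ← rpow_mul (by positivity), one_div_mul_cancel hp1.ne', rpow_one]
  set E := κ / (4 * (b + 2 * m * (m + 1))) with hE_def
  have hE : 0 < E := by positivity
  refine ⟨a * (2 + E), c * (1 + E) ^ (-m) - c * (2 + E) ^ (-m), by positivity, ?_, fun n hn => ?_⟩
  · rw [sub_pos]
    exact mul_lt_mul_of_pos_left
      (rpow_lt_rpow_of_neg (by positivity) (by linarith) (by linarith)) hc
  have hn0 : 0 < n := by linarith
  set ε := E / n ^ 2 with hε_def
  have hε : 0 < ε := by positivity
  have hεE : ε ≤ E := div_le_self hE.le (one_le_pow₀ hn)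
  have hεn : ε * n ^ 2 * (b + 2 * m * (m + 1)) ≤ κ / 4 := by
    rw [hε_def, hE_def]; field_simp; rfl
  have hχK : ∀ x ∉ Metric.closedBall (0 : Euc d) (n + 1) \ Metric.ball 0 (1 / n),
      annulusCutoff n x = 0 := fun x hx => by
    rw [Set.mem_sdiff, mem_closedBall_zero_iff, mem_ball_zero_iff, not_and_or, not_le,
      not_not] at hx
    rcases hx with hx | hx
    · rw [annulusCutoff, ramp_of_nonpos (r := n + 1 - ‖x‖) (by linarith), mul_zero]
    · rw [lt_div_iff₀ hn0] at hx
      rw [annulusCutoff, ramp_of_nonpos (r := n * ‖x‖ - 1) (by linarith), zero_mul]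
  obtain ⟨α, H, B, hα, hα1, hH0, hB0, hB, hH⟩ := hβ.exists_holder_mul (θ := annulusCutoff n)
    ((isCompact_closedBall (0 : Euc d) (n + 1)).diff Metric.isOpen_ball)
    (fun x hx h0 => hx.2 (by rw [h0]; exact Metric.mem_ball_self (by positivity)))
    (by positivity) (fun x => abs_le.2
      ⟨by linarith [annulusCutoff_nonneg n x], annulusCutoff_le_one n x⟩)
    (abs_annulusCutoff_sub_le hn0.le) hχK
  set A := c * ε ^ (-m) * (m / (a * ε) + 2 * m * (m + 1) / ε + B) + (c * ε ^ (-m)) ^ p with hA_def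
  have hA : 0 ≤ A := by positivity
  set s : Euc d × ℝ → ℝ := fun y => A * (ramp (2 - n * ‖y.1‖) * ramp (y.2 / (a * ε))) with hs_def
  have hs0 : ∀ y, 0 ≤ s y := fun y => mul_nonneg hA (mul_nonneg (ramp_nonneg _) (ramp_nonneg _))
  have hsx : ∀ x t, 2 ≤ n * ‖x‖ → s (x, t) = 0 := fun x t hx => by
    simp only [hs_def]
    rw [ramp_of_nonpos (by linarith), zero_mul, mul_zero]
  have hex := exists_isHeatPotential (L := n + 1) (s := s) (A := A)
    (Cs := A * (n + 1)) hp (by positivity) hα hα1 (continuous_of_abs_sub_le_rpow hα hH) hB hH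
    (fun x hx => ?_) (by simp only [hs_def]; fun_prop) hs0 (fun y => ?_) (fun x y t => ?_)
    (fun x t ht => ?_) (fun x t hx => hsx x t (by nlinarith))
  · obtain ⟨u, hu0, huN, hu⟩ := hex
    refine ⟨u, _, hu0, huN, hu, fun x t h1 h2 => ?_, ?_⟩
    · rw [hsx x t h1, annulusCutoff, ramp_of_one_le (r := n * ‖x‖ - 1) (by linarith),
        ramp_of_one_le (r := n + 1 - ‖x‖) (by linarith), ramp_of_one_le (by linarith)]
      ring
    · have h1 := le_of_source hp hm hb hbκ hκ hε ha haκ hεn hc hcκ hB0 hu.continuous_u hu0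
        hu.heatAt (fun x t => ?_) hB (fun x hx => ?_) hs0 (fun x t hx ht => ?_) x₁
        (t := a * (2 + E)) (by positivity)
      · rw [hx₁, mul_div_cancel_left₀ _ ha.ne', one_pow] at h1
        have h2 : (1 + E) ^ (-m) ≤ (1 + ε) ^ (-m) :=
          rpow_le_rpow_of_nonpos (by positivity) (by linarith) (by linarith)
        nlinarith
      · have h2 : 0 ≤ u (x, t) ^ p := rpow_nonneg (hu0 _) _
        nlinarith [ramp_le_one (n + 1 + 1 - ‖x‖)]
      · have h2 : -b / ‖x‖ ^ 2 ≤ 0 :=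
          div_nonpos_of_nonpos_of_nonneg (by linarith) (by positivity)
        nlinarith [hβb x hx, annulusCutoff_nonneg n x, annulusCutoff_le_one n x]
      · have h2 : n * ‖x‖ < 1 := by
          by_contra h
          nlinarith [not_lt.1 h]
        simp only [hs_def]
        rw [ramp_of_one_le (by linarith), ramp_of_one_le ((one_le_div (by positivity)).2 ht),
          mul_one, mul_one]
  · rw [annulusCutoff, ramp_of_nonpos (r := n + 1 - ‖x‖) (by linarith), mul_zero, zero_mul]
  · exact mul_le_of_le_one_right hA (mul_le_one₀ (ramp_le_one _) (ramp_nonneg _) (ramp_le_one _))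
  · simp only [hs_def]
    rw [← mul_sub, ← sub_mul, abs_mul, abs_of_nonneg hA, mul_assoc, abs_mul]
    refine mul_le_mul_of_nonneg_left ?_ hA
    refine (mul_le_of_le_one_right (abs_nonneg _) (abs_ramp_le_one _)).trans ?_
    refine le_mul_rpow_of_le (c := n) ?_ ?_ (norm_nonneg _) zero_le_one hn0.le hα hα1
    · exact abs_le.2 ⟨by linarith [ramp_nonneg (2 - n * ‖x‖), ramp_le_one (2 - n * ‖y‖)],
        by linarith [ramp_nonneg (2 - n * ‖y‖), ramp_le_one (2 - n * ‖x‖)]⟩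
    · refine (abs_ramp_sub_le _ _).trans ?_
      rw [show 2 - n * ‖x‖ - (2 - n * ‖y‖) = -(n * (‖x‖ - ‖y‖)) by ring, abs_neg, abs_mul,
        abs_of_pos hn0]
      exact mul_le_mul_of_nonneg_left (abs_norm_sub_norm_le x y) hn0.le
  · simp only [hs_def]
    rw [ramp_of_nonpos (r := t / (a * ε)) (div_nonpos_of_nonpos_of_nonneg ht (by positivity)),
      mul_zero, mul_zero]

/-- A pointwise bounded and equicontinuous sequence on an open subset of a separable space has a
pointwise convergent subsequence. -/
lemma exists_subseq_tendsto {X : Type*} [PseudoMetricSpace X] [TopologicalSpace.SeparableSpace X]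
    {v : ℕ → X → ℝ} {O : Set X} (hO : IsOpen O)
    (hb : ∀ q ∈ O, ∃ M, ∀ᶠ n in atTop, |v n q| ≤ M)
    (he : ∀ q ∈ O, ∀ ε > 0, ∃ δ > 0, ∀ᶠ n in atTop, ∀ q', dist q' q < δ →
      |v n q' - v n q| < ε) :
    ∃ φ : ℕ → ℕ, StrictMono φ ∧ ∀ q ∈ O, ∃ l, Tendsto (fun n => v (φ n) q) atTop (𝓝 l) := by
  obtain ⟨D, hDc, hD⟩ := TopologicalSpace.exists_countable_dense X
  have hb' : ∀ q ∈ O, ∃ M, ∀ n, |v n q| ≤ M := fun q hq => by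
    obtain ⟨M, hM⟩ := hb q hq
    obtain ⟨M', hM'⟩ := (isBoundedUnder_of_eventually_le hM).bddAbove_range
    exact ⟨M', fun n => hM' (mem_range_self n)⟩
  choose! M hM using hb'
  have : Countable ↥(D ∩ O) := (hDc.mono inter_subset_left).to_subtype
  have hc : IsCompact (pi univ fun q : ↥(D ∩ O) => Icc (-M q) (M q)) :=
    isCompact_univ_pi fun _ => isCompact_Icc
  obtain ⟨g, -, φ, hφ, hlim⟩ := hc.tendsto_subseq (x := fun n (q : ↥(D ∩ O)) => v n q)
    fun n q _ => abs_le.1 (hM q q.2.2 n)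
  refine ⟨φ, hφ, fun q hq => cauchySeq_tendsto_of_complete (Metric.cauchySeq_iff'.2 fun ε hε => ?_)⟩
  obtain ⟨δ, hδ, h1⟩ := he q hq (ε / 4) (by positivity)
  obtain ⟨z, hzD, hzq, hzO⟩ := hD.exists_mem_open (Metric.isOpen_ball.inter hO)
    ⟨q, Metric.mem_ball_self hδ, hq⟩
  have h2 := (Metric.tendsto_atTop.1 ((tendsto_pi_nhds.1 hlim) ⟨z, hzD, hzO⟩)) (ε / 4)
    (by positivity)
  obtain ⟨N₁, hN₁⟩ := h2
  obtain ⟨N₂, hN₂⟩ := eventually_atTop.1 (hφ.tendsto_atTop.eventually h1)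
  refine ⟨max N₁ N₂, fun n hn => ?_⟩
  have a1 := abs_lt.1 (hN₁ n ((le_max_left _ _).trans hn))
  have a2 := abs_lt.1 (hN₁ _ (le_max_left N₁ N₂))
  have a3 := abs_lt.1 (hN₂ n ((le_max_right _ _).trans hn) z hzq)
  have a4 := abs_lt.1 (hN₂ _ (le_max_right N₁ N₂) z hzq)
  simp only [Function.comp] at a1 a2
  rw [Real.dist_eq, abs_lt]
  constructor <;> linarith

/-- The cylinder over the closed ball of radius `r` around `x₀`. -/
def cyl (x₀ : Euc d) (r : ℝ) : Set (Euc d × ℝ) := {q | ‖q.1 - x₀‖ ≤ r}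

lemma mem_cyl {x₀ : Euc d} {r : ℝ} {q : Euc d × ℝ} : q ∈ cyl x₀ r ↔ ‖q.1 - x₀‖ ≤ r := Iff.rfl

lemma measurableSet_cyl (x₀ : Euc d) (r : ℝ) : MeasurableSet (cyl x₀ r) :=
  (isClosed_le (by fun_prop) continuous_const).measurableSet

lemma cv_congr_of_norm_sub_le {K f g : Euc d × ℝ → ℝ} {r : ℝ} {q : Euc d × ℝ}
    (hK : ∀ y, r < ‖y‖ → K y = 0) (hfg : ∀ y, ‖y - q‖ ≤ r → f y = g y) :
    cv K f q = cv K g q := by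
  refine integral_congr_ae (Eventually.of_forall fun y => ?_)
  beta_reduce
  rcases lt_or_ge r ‖y‖ with h | h
  · rw [hK y h, zero_mul, zero_mul]
  · rw [hfg _ (by simpa using h)]

/-- Local representation of a solution `U` of the heat equation with right-hand side `F` in the
cylinder of radius `r` around `x₀`. -/
structure IsLocalPotential (F U : Euc d × ℝ → ℝ) (x₀ : Euc d) (r : ℝ) : Prop where
  eq_add : ∀ ρ : ContDiffBump (0 : Euc d × ℝ), ρ.rOut ≤ r → ∀ q ∈ cyl x₀ r,
    U q = cv (locKer ρ) F q + cv (defKer ρ) U q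
  cv_defKer : ∀ ρ : ContDiffBump (0 : Euc d × ℝ), ρ.rOut ≤ r → ∀ q ∈ cyl x₀ r,
    cv (defKer ρ) F q = cv (heatOp (defKer ρ)) U q

lemma heatOp_defKer_of_rOut_lt (ρ : ContDiffBump (0 : Euc d × ℝ)) {q : Euc d × ℝ}
    (hq : ρ.rOut < ‖q‖) : heatOp (defKer ρ) q = 0 := by
  have h : defKer ρ =ᶠ[𝓝 q] fun _ => 0 := by
    filter_upwards [(isOpen_lt continuous_const continuous_norm).mem_nhds hq] with y hy
    exact defKer_of_rOut_lt ρ hy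
  rw [heatOp_congr h, heatOp_zero]

lemma integrable_heatOp_defKer (ρ : ContDiffBump (0 : Euc d × ℝ)) :
    Integrable (heatOp (defKer ρ)) :=
  (contDiff_heatOp (contDiff_defKer ρ)).continuous.integrable_of_hasCompactSupport
    (hasCompactSupport_heatOp (hasCompactSupport_defKer ρ))

lemma IsHeatPotential.isLocalPotential {f u : Euc d × ℝ → ℝ} (h : IsHeatPotential f u)
    (x₀ : Euc d) (r : ℝ) :
    IsLocalPotential ((cyl x₀ (2 * r)).indicator f) ((cyl x₀ (2 * r)).indicator u) x₀ r := by
  obtain ⟨B, hB⟩ := h.bdd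
  have hu : u = cv heatKernel f := funext h.eq_cv
  have hloc : ∀ {K g : Euc d × ℝ → ℝ} {q : Euc d × ℝ}, (∀ y, r < ‖y‖ → K y = 0) → q ∈ cyl x₀ r →
      cv K ((cyl x₀ (2 * r)).indicator g) q = cv K g q := fun {_ _ q} hK hq =>
    cv_congr_of_norm_sub_le hK fun y hy => indicator_of_mem (by
      have h1 : ‖y.1 - q.1‖ ≤ r := (norm_fst_le _).trans hy
      change ‖y.1 - x₀‖ ≤ 2 * r
      linarith [norm_sub_le_norm_sub_add_norm_sub y.1 q.1 x₀, mem_cyl.1 hq]) _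
  refine ⟨fun ρ hρ q hq => ?_, fun ρ hρ q hq => ?_⟩
  · have hq' : q ∈ cyl x₀ (2 * r) := by
      have h1 : ‖q.1 - x₀‖ ≤ r := hq
      have h2 := norm_nonneg (q.1 - x₀)
      change ‖q.1 - x₀‖ ≤ 2 * r
      linarith
    rw [hloc (fun y hy => locKer_of_rOut_le ρ (hρ.trans hy.le)) hq,
      hloc (fun y hy => defKer_of_rOut_lt ρ (hρ.trans_lt hy)) hq, indicator_of_mem hq', hu]
    exact cv_heatKernel_eq_add ρ h.continuous_f.measurable hB h.f_zero q
  · rw [hloc (fun y hy => defKer_of_rOut_lt ρ (hρ.trans_lt hy)) hq,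
      hloc (fun y hy => heatOp_defKer_of_rOut_lt ρ (hρ.trans_lt hy)) hq, hu]
    exact cv_defKer_eq_cv_heatOp ρ h.continuous_f.measurable hB h.f_zero q

lemma tendsto_cv {K f : Euc d × ℝ → ℝ} {g : ℕ → Euc d × ℝ → ℝ} {B : ℝ} (hK : Integrable K)
    (hg : ∀ n, Measurable (g n)) (hB : ∀ n y, |g n y| ≤ B)
    (hlim : ∀ y, Tendsto (fun n => g n y) atTop (𝓝 (f y))) (q : Euc d × ℝ) :
    Tendsto (fun n => cv K (g n) q) atTop (𝓝 (cv K f q)) := by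
  refine tendsto_integral_of_dominated_convergence (fun y => |K y| * B)
    (fun n => (integrable_mul_comp_sub hK (hg n) (hB n) q).aestronglyMeasurable)
    (hK.abs.mul_const B) (fun n => Eventually.of_forall fun y => ?_)
    (Eventually.of_forall fun y => (hlim _).const_mul _)
  rw [Real.norm_eq_abs, abs_mul]
  exact mul_le_mul_of_nonneg_left (hB n _) (abs_nonneg _)

lemma IsLocalPotential.of_tendsto {F U : Euc d × ℝ → ℝ} {f u : ℕ → Euc d × ℝ → ℝ} {B : ℝ}
    {x₀ : Euc d} {r : ℝ} (h : ∀ n, IsLocalPotential (f n) (u n) x₀ r)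
    (hf : ∀ n, Measurable (f n)) (hu : ∀ n, Measurable (u n)) (hfB : ∀ n y, |f n y| ≤ B)
    (huB : ∀ n y, |u n y| ≤ B) (hF : ∀ y, Tendsto (fun n => f n y) atTop (𝓝 (F y)))
    (hU : ∀ y, Tendsto (fun n => u n y) atTop (𝓝 (U y))) : IsLocalPotential F U x₀ r := by
  refine ⟨fun ρ hρ q hq => ?_, fun ρ hρ q hq => ?_⟩
  · refine tendsto_nhds_unique (hU q) ?_
    simp only [fun n => (h n).eq_add ρ hρ q hq]
    exact (tendsto_cv (integrable_locKer ρ) hf hfB hF q).add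
      (tendsto_cv (integrable_defKer ρ) hu huB hU q)
  · refine tendsto_nhds_unique (tendsto_cv (integrable_defKer ρ) hf hfB hF q) ?_
    simp only [fun n => (h n).cv_defKer ρ hρ q hq]
    exact tendsto_cv (integrable_heatOp_defKer ρ) hu huB hU q

lemma exists_contDiffBump_rOut_eq {r : ℝ} (hr : 0 < r) :
    ∃ ρ : ContDiffBump (0 : Euc d × ℝ), ρ.rOut = r :=
  ⟨⟨r / 2, r, by positivity, by linarith⟩, rfl⟩

/-- Local potentials of bounded densities are equicontinuous. -/
lemma exists_abs_sub_lt_of_isLocalPotential (x₀ : Euc d) {r B ε : ℝ} (hr : 0 < r) (hε : 0 < ε) :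
    ∃ δ > 0, ∀ F U : Euc d × ℝ → ℝ, IsLocalPotential F U x₀ r → Measurable F → Measurable U →
      (∀ y, |F y| ≤ B) → (∀ y, |U y| ≤ B) → ∀ q ∈ cyl x₀ r, ∀ q' ∈ cyl x₀ r, dist q q' < δ →
        |U q - U q'| < ε := by
  obtain ⟨ρ, hρ⟩ := exists_contDiffBump_rOut_eq (d := d) hr
  obtain ⟨δ₁, hδ₁, h₁⟩ := exists_abs_cv_sub_lt (integrable_locKer ρ) B (half_pos hε)
  obtain ⟨δ₂, hδ₂, h₂⟩ := exists_abs_cv_sub_lt (integrable_defKer ρ) B (half_pos hε)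
  refine ⟨min δ₁ δ₂, lt_min hδ₁ hδ₂, fun F U h hF hU hFB hUB q hq q' hq' hd => ?_⟩
  have a1 := abs_lt.1 (h₁ F hF hFB q q' (hd.trans_le (min_le_left _ _)))
  have a2 := abs_lt.1 (h₂ U hU hUB q q' (hd.trans_le (min_le_right _ _)))
  rw [h.eq_add ρ hρ.le q hq, h.eq_add ρ hρ.le q' hq', abs_lt]
  constructor <;> linarith

lemma exists_cv_lipschitz {K f : Euc d × ℝ → ℝ} {B : ℝ} (hK : ContDiff ℝ 1 K)
    (hKc : HasCompactSupport K) (hf : Measurable f) (hB : ∀ y, |f y| ≤ B) :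
    ∃ C, 0 ≤ C ∧ ∀ q q', |cv K f q - cv K f q'| ≤ C * ‖q - q'‖ := by
  have hB0 : 0 ≤ B := (abs_nonneg _).trans (hB 0)
  have hcont : Continuous (fderiv ℝ K) := hK.continuous_fderiv one_ne_zero
  have hint : Integrable fun y => ‖fderiv ℝ K y‖ :=
    (hcont.integrable_of_hasCompactSupport (hKc.fderiv (𝕜 := ℝ))).norm
  have hC0 : 0 ≤ ∫ y, ‖fderiv ℝ K y‖ := integral_nonneg fun y => norm_nonneg _
  refine ⟨B * ∫ y, ‖fderiv ℝ K y‖, by positivity, fun q q' => ?_⟩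
  have hd : Differentiable ℝ (cv K f) :=
    (contDiff_cv (n := 1) hK hKc hf hB).differentiable one_ne_zero
  refine convex_univ.norm_image_sub_le_of_norm_fderiv_le (𝕜 := ℝ) (fun z _ => hd z)
    (fun z _ => ContinuousLinearMap.opNorm_le_bound _ (by positivity) fun e => ?_)
    (mem_univ q') (mem_univ q)
  rw [fderiv_cv_apply hK hKc hf hB, Real.norm_eq_abs]
  have hint' : Integrable fun y => fderiv ℝ K y e :=
    (hcont.clm_apply continuous_const).integrable_of_hasCompactSupport
      (hKc.fderiv_apply (𝕜 := ℝ) e)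
  refine (abs_cv_le hint' hB z).trans ?_
  rw [mul_assoc, ← integral_mul_const]
  refine mul_le_mul_of_nonneg_left (integral_mono hint'.abs (hint.mul_const _) fun y => ?_) hB0
  exact (fderiv ℝ K y).le_opNorm e

lemma IsLocalPotential.exists_lipschitz {F U : Euc d × ℝ → ℝ} {x₀ : Euc d} {r B : ℝ}
    (h : IsLocalPotential F U x₀ r) (hr : 0 < r) (hF : Measurable F) (hU : Measurable U)
    (hFB : ∀ y, |F y| ≤ B) (hUB : ∀ y, |U y| ≤ B) :
    ∃ C, 0 ≤ C ∧ ∀ x y t, ‖x - x₀‖ ≤ r → ‖y - x₀‖ ≤ r →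
      |U (x, t) - U (y, t)| ≤ C * ‖x - y‖ := by
  obtain ⟨ρ, hρ⟩ := exists_contDiffBump_rOut_eq (d := d) hr
  obtain ⟨C, hC, hL⟩ := exists_cv_lipschitz (contDiff_infty.1 (contDiff_defKer ρ) 1)
    (hasCompactSupport_defKer ρ) hU hUB
  have hB0 : 0 ≤ B := (abs_nonneg _).trans (hUB 0)
  refine ⟨B * (∑ i, ∫ q, |locKerD ρ i q|) + C, ?_, fun x y t hx hy => ?_⟩
  · have : 0 ≤ ∑ i, ∫ q, |locKerD ρ i q| :=
      Finset.sum_nonneg fun i _ => integral_nonneg fun q => abs_nonneg _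
    positivity
  have a1 := abs_le.1 (cv_locKer_lipschitz ρ hF hFB x y t)
  have a2 := abs_le.1 (hL (x, t) (y, t))
  have a3 : ‖((x, t) : Euc d × ℝ) - (y, t)‖ = ‖x - y‖ := by
    rw [Prod.mk_sub_mk, sub_self, Prod.norm_mk, norm_zero, max_eq_left (norm_nonneg _)]
  rw [a3] at a2
  rw [h.eq_add ρ hρ.le (x, t) hx, h.eq_add ρ hρ.le (y, t) hy, add_mul, abs_le]
  constructor <;> linarith

/-- The cutoff to the ball of radius `3 * r / 4` around `a`, equal to `1` at distance `r / 2`. -/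
noncomputable def ballCutoff {E : Type*} [SeminormedAddCommGroup E] (a : E) (r : ℝ) (x : E) : ℝ :=
  ramp (3 - 4 / r * ‖x - a‖)

section ballCutoff

variable {E : Type*} [SeminormedAddCommGroup E] {a x : E} {r : ℝ}

lemma ballCutoff_of_le (hr : 0 < r) (hx : ‖x - a‖ ≤ r / 2) : ballCutoff a r x = 1 := by
  refine ramp_of_one_le ?_
  have : 4 / r * ‖x - a‖ ≤ 4 / r * (r / 2) := by gcongr
  have h : 4 / r * (r / 2) = 2 := by field_simp; norm_num
  linarith

lemma ballCutoff_of_lt (hr : 0 < r) (hx : 3 / 4 * r < ‖x - a‖) : ballCutoff a r x = 0 := by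
  refine ramp_of_nonpos ?_
  have : 4 / r * (3 / 4 * r) ≤ 4 / r * ‖x - a‖ := by gcongr
  have h : 4 / r * (3 / 4 * r) = 3 := by field_simp
  linarith

lemma continuous_ballCutoff : Continuous (ballCutoff a r) := by
  unfold ballCutoff; fun_prop

lemma abs_ballCutoff_sub_le (hr : 0 < r) (x y : E) :
    |ballCutoff a r x - ballCutoff a r y| ≤ 4 / r * ‖x - y‖ := by
  refine (abs_ramp_sub_le _ _).trans ?_
  rw [show 3 - 4 / r * ‖x - a‖ - (3 - 4 / r * ‖y - a‖) = -(4 / r * (‖x - a‖ - ‖y - a‖)) by ring,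
    abs_neg, abs_mul, abs_of_pos (by positivity)]
  have h := abs_norm_sub_norm_le (x - a) (y - a)
  rw [sub_sub_sub_cancel_right] at h
  gcongr

end ballCutoff

lemma IsLocalPotential.continuousAt {F U : Euc d × ℝ → ℝ} {x₀ : Euc d} {r B : ℝ}
    (h : IsLocalPotential F U x₀ r) (hr : 0 < r) (hF : Measurable F) (hU : Measurable U)
    (hFB : ∀ y, |F y| ≤ B) (hUB : ∀ y, |U y| ≤ B) {q : Euc d × ℝ} (hq : ‖q.1 - x₀‖ < r) :
    ContinuousAt U q := by
  refine Metric.continuousAt_iff'.2 fun ε hε => ?_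
  obtain ⟨δ, hδ, hd⟩ := exists_abs_sub_lt_of_isLocalPotential x₀ (B := B) hr hε
  filter_upwards [Metric.ball_mem_nhds q hδ,
    (isOpen_lt (f := fun y : Euc d × ℝ => ‖y.1 - x₀‖) (by fun_prop)
      continuous_const).mem_nhds hq] with y hy hyr
  exact hd F U h hF hU hFB hUB y (le_of_lt hyr) q hq.le hy

/-- Local potentials of locally Hölder reaction terms are classical solutions. -/
lemma IsLocalPotential.heatAt {β : Euc d → ℝ} {F U : Euc d × ℝ → ℝ} {x₀ : Euc d} {r B p : ℝ}
    {S : Set (Euc d)} (h : IsLocalPotential F U x₀ r) (hp : 1 < p) (hr : 0 < r)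
    (hF : Measurable F) (hU : Measurable U) (hFB : ∀ y, |F y| ≤ B) (hUB : ∀ y, |U y| ≤ B)
    (hU0 : ∀ y, 0 ≤ U y) (hFU : ∀ q ∈ cyl x₀ r, F q = β q.1 * U q - U q ^ p)
    (hβ : LocHolderOn β S) (hS : Metric.closedBall x₀ r ⊆ S) (t₀ : ℝ) :
    HeatAt U F (x₀, t₀) := by
  have hB0 : 0 ≤ B := (abs_nonneg _).trans (hUB 0)
  have hUI : ∀ y, U y ∈ Icc 0 B := fun y => ⟨hU0 y, (le_abs_self _).trans (hUB y)⟩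
  set θ := ballCutoff x₀ r with hθ
  have hθ1 : ∀ x, |θ x| ≤ 1 := fun x => abs_ramp_le_one _
  have hψ1 : ∀ t, |ballCutoff t₀ r t| ≤ 1 := fun x => abs_ramp_le_one _
  have hθK : ∀ x ∉ Metric.closedBall x₀ r, θ x = 0 := fun x hx => by
    rw [mem_closedBall_iff_norm, not_le] at hx
    exact ballCutoff_of_lt hr (by linarith)
  obtain ⟨α, H, B', hα, hα1, hH0, hB'0, hB', hH⟩ := hβ.exists_holder_mul
    (isCompact_closedBall x₀ r) hS (by positivity) hθ1 (abs_ballCutoff_sub_le hr) hθK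
  obtain ⟨C, hC, hL⟩ := h.exists_lipschitz hr hF hU hFB hUB
  set G : Euc d × ℝ → ℝ := fun y => θ y.1 * β y.1 * U y - θ y.1 * U y ^ p with hG
  set f : Euc d × ℝ → ℝ := fun y => ballCutoff t₀ r y.2 * G y with hf
  have hGH : ∀ x y t, |G (x, t) - G (y, t)| ≤ ((B' * (C + 2 * B) + B * H) +
      (1 * (p * B ^ (p - 1) * C + 2 * B ^ p) + B ^ p * (4 / r + 2))) * ‖x - y‖ ^ α :=
      fun x y t => by
    have hK : ∀ z, z ∈ Metric.closedBall x₀ r → ‖z - x₀‖ ≤ r := fun z hz =>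
      mem_closedBall_iff_norm.1 hz
    have hp0 : ∀ q, |U q ^ p| ≤ B ^ p := fun q => by
      rw [abs_of_nonneg (rpow_nonneg (hU0 q) _)]
      exact rpow_le_rpow (hU0 q) (hUI q).2 (by linarith)
    have h1 := abs_mul_sub_mul_le_rpow (w := fun x => U (x, t)) hB' hH
      (fun x hx => by rw [hθK x hx, zero_mul]) (fun x _ => hUB _)
      (fun x hx y hy => le_mul_rpow_of_le (M := 2 * B) (c := C) ((abs_sub _ _).trans (by
        linarith [hUB (x, t), hUB (y, t)])) (hL x y t (hK x hx) (hK y hy)) (norm_nonneg _)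
        (by positivity) hC hα hα1) hB0 (by positivity) x y
    have h2 := abs_mul_sub_mul_le_rpow (w := fun x => U (x, t) ^ p) hθ1
      (fun x y => le_mul_rpow_of_le (M := 2) ((abs_sub _ _).trans (by linarith [hθ1 x, hθ1 y]))
        (abs_ballCutoff_sub_le hr x y) (norm_nonneg _) (by norm_num) (by positivity) hα hα1)
      hθK (fun x _ => hp0 _)
      (fun x hx y hy => le_mul_rpow_of_le (M := 2 * B ^ p) (c := p * B ^ (p - 1) * C)
        ((abs_sub _ _).trans (by linarith [hp0 (x, t), hp0 (y, t)]))
        ((abs_rpow_sub_rpow_le hp.le (hUI _) (hUI _)).trans (by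
          rw [mul_assoc _ C]
          exact mul_le_mul_of_nonneg_left (hL x y t (hK x hx) (hK y hy)) (by positivity)))
        (norm_nonneg _) (by positivity) (by positivity) hα hα1) (by positivity) (by positivity) x y
    have h4 : G (x, t) - G (y, t) = (θ x * β x * U (x, t) - θ y * β y * U (y, t)) -
        (θ x * U (x, t) ^ p - θ y * U (y, t) ^ p) := by simp only [hG]; ring
    rw [h4, add_mul]
    exact (abs_sub _ _).trans (add_le_add h1 h2)
  have hfH : ∀ x y t, |f (x, t) - f (y, t)| ≤ ((B' * (C + 2 * B) + B * H) +
      (1 * (p * B ^ (p - 1) * C + 2 * B ^ p) + B ^ p * (4 / r + 2))) * ‖x - y‖ ^ α :=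
      fun x y t => by
    refine le_trans ?_ (hGH x y t)
    simp only [hf]
    rw [← mul_sub, abs_mul]
    exact mul_le_of_le_one_left (abs_nonneg _) (hψ1 t)
  have hfc : Continuous f := by
    refine continuous_iff_continuousAt.2 fun q => ?_
    rcases lt_or_ge ‖q.1 - x₀‖ r with hq | hq
    · have c1 : Continuous fun y : Euc d × ℝ => θ y.1 * β y.1 :=
        (continuous_of_abs_sub_le_rpow hα hH).comp continuous_fst
      have c2 : Continuous fun y : Euc d × ℝ => θ y.1 := continuous_ballCutoff.comp continuous_fst
      have c3 : Continuous fun y : Euc d × ℝ => ballCutoff t₀ r y.2 :=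
        continuous_ballCutoff.comp continuous_snd
      exact c3.continuousAt.mul ((c1.continuousAt.mul (h.continuousAt hr hF hU hFB hUB hq)).sub
        (c2.continuousAt.mul
          ((h.continuousAt hr hF hU hFB hUB hq).rpow_const (Or.inr (by linarith)))))
    · have hev : f =ᶠ[𝓝 q] fun _ => 0 := by
        filter_upwards [(isOpen_lt (g := fun y : Euc d × ℝ => ‖y.1 - x₀‖) continuous_const
          (by fun_prop)).mem_nhds (show 3 / 4 * r < ‖q.1 - x₀‖ by linarith)] with y hy
        have : θ y.1 = 0 := ballCutoff_of_lt hr hy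
        simp [hf, hG, this]
      exact continuousAt_const.congr hev.symm
  have hfs : HasCompactSupport f := by
    refine HasCompactSupport.intro (isCompact_closedBall (x₀, t₀) r) fun q hq => ?_
    rw [mem_closedBall_iff_norm, not_le, Prod.norm_def, lt_max_iff] at hq
    rcases hq with hq | hq
    · have : θ q.1 = 0 := ballCutoff_of_lt hr (by
        have : r < ‖q.1 - x₀‖ := hq
        linarith)
      simp [hf, hG, this]
    · have : ballCutoff t₀ r q.2 = 0 := ballCutoff_of_lt hr (by
        have : r < ‖q.2 - t₀‖ := hq
        linarith)
      simp [hf, this]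
  obtain ⟨Bf, -, hBf⟩ := abs_le_of_continuous_of_hasCompactSupport hfc hfs
  have hfF : ∀ y, ‖y - (x₀, t₀)‖ ≤ r / 2 → F y = f y := fun y hy => by
    have h1 : ‖y.1 - x₀‖ ≤ r / 2 := (norm_fst_le _).trans hy
    have h2 : ‖y.2 - t₀‖ ≤ r / 2 := (norm_snd_le _).trans hy
    simp only [hf, hG]
    rw [hFU y (mem_cyl.2 (by linarith)), ballCutoff_of_le hr h2,
      show θ y.1 = 1 from ballCutoff_of_le hr h1, one_mul, one_mul, one_mul]
  obtain ⟨ρ, hρ⟩ := exists_contDiffBump_rOut_eq (d := d) (r := r / 4) (by positivity)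
  have hρr : ρ.rOut ≤ r := by linarith
  have hloc : ∀ {K : Euc d × ℝ → ℝ} {q : Euc d × ℝ}, (∀ y, r / 4 < ‖y‖ → K y = 0) →
      ‖q - (x₀, t₀)‖ ≤ r / 4 → cv K F q = cv K f q := fun {_ q} hK hq =>
    cv_congr_of_norm_sub_le hK fun y hy => hfF y (by
      linarith [norm_sub_le_norm_sub_add_norm_sub y q (x₀, t₀)])
  have hk : ∀ y, r / 4 < ‖y‖ → defKer ρ y = 0 := fun y hy => defKer_of_rOut_lt ρ (hρ.trans_lt hy)
  have hev : U =ᶠ[𝓝 (x₀, t₀)] fun q => cv (locKer ρ) f q + cv (defKer ρ) U q := by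
    filter_upwards [Metric.closedBall_mem_nhds (x₀, t₀) (show 0 < r / 4 by positivity)] with q hq
    rw [mem_closedBall_iff_norm] at hq
    have h1 : ‖q.1 - x₀‖ ≤ r / 4 := (norm_fst_le _).trans hq
    rw [h.eq_add ρ hρr q (mem_cyl.2 (by linarith)),
      hloc (fun y hy => locKer_of_rOut_le ρ (hρ.le.trans hy.le)) hq]
  have hS1 := heatAt_cv_locKer ρ hα (hfs.uniformContinuous_of_continuous hfc) hBf hfH
    (x₀, t₀)
  have hS2 := (contDiff_infty.2 fun n => contDiff_cv (n := n)
    (contDiff_infty.1 (contDiff_defKer ρ) n) (hasCompactSupport_defKer ρ) hU hUB).heatAt (x₀, t₀)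
  refine (hS1.add hS2).congr hev ?_
  have h0 : ‖((x₀, t₀) : Euc d × ℝ) - (x₀, t₀)‖ ≤ r / 4 := by
    rw [sub_self, norm_zero]; positivity
  have h1 := h.cv_defKer ρ hρr (x₀, t₀) (mem_cyl.2 (by simp [hr.le]))
  rw [hloc hk h0] at h1
  rw [heatOp_cv (contDiff_defKer ρ) (hasCompactSupport_defKer ρ) hU hUB, h1,
    hfF _ (h0.trans (by linarith))]
  ring

lemma exists_local_bound {p : ℝ} {β : Euc d → ℝ} {v f : ℕ → Euc d × ℝ → ℝ} (hp : 1 < p)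
    (hβ : LocHolderOn β {0}ᶜ) (hv0 : ∀ n y, 0 ≤ v n y) (hvN : ∀ n, ∃ N, ∀ y, v n y ≤ N)
    (hv : ∀ n, IsHeatPotential (f n) (v n))
    (hf : ∀ (n : ℕ) x t, 2 ≤ ((n : ℝ) + 1) * ‖x‖ → ‖x‖ ≤ n + 1 →
      f n (x, t) = β x * v n (x, t) - v n (x, t) ^ p) {x₀ : Euc d} (hx₀ : x₀ ≠ 0) :
    ∃ r > 0, ∃ B, 0 ≤ B ∧ Metric.closedBall x₀ (2 * r) ⊆ {0}ᶜ ∧ ∀ᶠ n in atTop, ∀ q ∈ cyl x₀ (2 * r),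
      f n q = β q.1 * v n q - v n q ^ p ∧ |f n q| ≤ B ∧ |v n q| ≤ B := by
  have hn : 0 < ‖x₀‖ := norm_pos_iff.2 hx₀
  have hball : ∀ x, ‖x - x₀‖ ≤ ‖x₀‖ / 2 → ‖x₀‖ / 2 ≤ ‖x‖ ∧ ‖x‖ ≤ 2 * ‖x₀‖ := fun x hx => by
    have h1 := abs_le.1 (abs_norm_sub_norm_le x x₀)
    constructor <;> linarith
  have hsub : Metric.closedBall x₀ (‖x₀‖ / 2) ⊆ {0}ᶜ := fun x hx h0 => by
    have := (hball x (mem_closedBall_iff_norm.1 hx)).1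
    rw [h0, norm_zero] at this
    linarith
  obtain ⟨W, hW, hβW⟩ := hβ.exists_bound (isCompact_closedBall x₀ (‖x₀‖ / 2)) hsub
  obtain ⟨M, hM⟩ := exists_interior_bound d hp hW (half_pos hn)
  have hM0 := le_max_right M 0
  refine ⟨‖x₀‖ / 8, by positivity, W * max M 0 + max M 0 ^ p + max M 0, by positivity,
    (Metric.closedBall_subset_closedBall (by linarith)).trans hsub, ?_⟩
  have hn1 : Tendsto (fun n : ℕ => (n : ℝ) + 1) atTop atTop :=
    tendsto_natCast_atTop_atTop.atTop_add tendsto_const_nhds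
  filter_upwards [hn1.eventually_ge_atTop (4 / ‖x₀‖), hn1.eventually_ge_atTop (2 * ‖x₀‖)]
    with n h1 h2
  have hfn : ∀ x t, ‖x - x₀‖ ≤ ‖x₀‖ / 2 → f n (x, t) = β x * v n (x, t) - v n (x, t) ^ p :=
    fun x t hx => by
      refine hf n x t ?_ ((hball x hx).2.trans h2)
      rw [div_le_iff₀ hn] at h1
      nlinarith [(hball x hx).1, norm_nonneg x]
  obtain ⟨N, hN⟩ := hvN n
  have hvM := hM (v n) (f n) x₀ N (hv n).continuous_u hN (hv n).u_zero (hv n).heatAt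
    fun x t hx h0 => by
      rw [hfn x t hx.le]
      have := (le_abs_self _).trans (hβW x (mem_closedBall_iff_norm.2 hx.le))
      linarith [mul_le_mul_of_nonneg_right this h0.le]
  rintro ⟨x, t⟩ hq
  have hx : ‖x - x₀‖ ≤ 2 * (‖x₀‖ / 8) := hq
  have hvx : v n (x, t) ≤ max M 0 := (hvM x t (by linarith)).trans (le_max_left _ _)
  have hWM : 0 ≤ W * max M 0 := mul_nonneg hW hM0
  have hMp : 0 ≤ max M 0 ^ p := rpow_nonneg hM0 _
  have hv' := hv0 n (x, t)
  refine ⟨hfn x t (by linarith), ?_, ?_⟩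
  · rw [hfn x t (by linarith)]
    refine (abs_sub _ _).trans ?_
    rw [abs_mul, abs_of_nonneg hv', abs_of_nonneg (rpow_nonneg hv' p)]
    have a1 : |β x| * v n (x, t) ≤ W * max M 0 :=
      mul_le_mul (hβW x (mem_closedBall_iff_norm.2 (by linarith))) hvx hv' hW
    have a2 : v n (x, t) ^ p ≤ max M 0 ^ p := rpow_le_rpow hv' hvx (by linarith)
    linarith
  · rw [abs_of_nonneg hv']
    linarith

/-- A sequence of approximate solutions has a subsequence converging to a classical solution on
the punctured space. -/
lemma exists_solution_of_approximation {p : ℝ} {β : Euc d → ℝ} {v f : ℕ → Euc d × ℝ → ℝ}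
    (hp : 1 < p) (hβ : LocHolderOn β {0}ᶜ) (hv0 : ∀ n y, 0 ≤ v n y)
    (hvN : ∀ n, ∃ N, ∀ y, v n y ≤ N) (hv : ∀ n, IsHeatPotential (f n) (v n))
    (hf : ∀ (n : ℕ) x t, 2 ≤ ((n : ℝ) + 1) * ‖x‖ → ‖x‖ ≤ n + 1 →
      f n (x, t) = β x * v n (x, t) - v n (x, t) ^ p) :
    ∃ (φ : ℕ → ℕ) (u : Euc d × ℝ → ℝ), ∀ q : Euc d × ℝ, q.1 ≠ 0 →
      Tendsto (fun n => v (φ n) q) atTop (𝓝 (u q)) ∧ ContinuousAt u q ∧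
      HeatAt u (fun y => β y.1 * u y - u y ^ p) q := by
  have hloc := fun x₀ hx₀ => exists_local_bound hp hβ hv0 hvN hv hf (x₀ := x₀) hx₀
  have hcyl : ∀ {x₀ : Euc d} {r : ℝ}, 0 < r → cyl x₀ r ⊆ cyl x₀ (2 * r) := fun hr q hq =>
    (mem_cyl.1 hq).trans (by linarith)
  have hind : ∀ {g : Euc d × ℝ → ℝ} {B : ℝ} {C : Set (Euc d × ℝ)}, 0 ≤ B →
      (∀ q ∈ C, |g q| ≤ B) → ∀ q, |C.indicator g q| ≤ B := fun {g B C} hB hg q => by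
    by_cases hq : q ∈ C
    · rw [indicator_of_mem hq]; exact hg q hq
    · rw [indicator_of_notMem hq, abs_zero]; exact hB
  have hO : IsOpen {q : Euc d × ℝ | q.1 ≠ 0} := isOpen_ne_fun continuous_fst continuous_const
  have hmem : ∀ {q : Euc d × ℝ} {r : ℝ}, 0 < r → q ∈ cyl q.1 r := fun {q r} hr =>
    mem_cyl.2 (by rw [sub_self, norm_zero]; exact hr.le)
  have hb : ∀ q ∈ {q : Euc d × ℝ | q.1 ≠ 0}, ∃ M, ∀ᶠ n in atTop, |v n q| ≤ M := fun q hq => by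
    obtain ⟨r, hr, B, -, -, hB⟩ := hloc q.1 hq
    exact ⟨B, hB.mono fun n hn => (hn q (hmem (by positivity))).2.2⟩
  have he : ∀ q ∈ {q : Euc d × ℝ | q.1 ≠ 0}, ∀ ε > 0, ∃ δ > 0, ∀ᶠ n in atTop, ∀ q',
      dist q' q < δ → |v n q' - v n q| < ε := fun q hq ε hε => by
    obtain ⟨r, hr, B, hB0, -, hB⟩ := hloc q.1 hq
    obtain ⟨δ, hδ, h⟩ := exists_abs_sub_lt_of_isLocalPotential q.1 (B := B) hr hε
    refine ⟨min δ r, lt_min hδ hr, hB.mono fun n hn q' hq' => ?_⟩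
    have hq'r : q' ∈ cyl q.1 r := by
      have h1 : ‖q'.1 - q.1‖ ≤ ‖q' - q‖ := norm_fst_le (q' - q)
      rw [dist_eq_norm] at hq'
      exact h1.trans (hq'.le.trans (min_le_right _ _))
    have := h _ _ ((hv n).isLocalPotential q.1 r)
      ((hv n).continuous_f.measurable.indicator (measurableSet_cyl _ _))
      ((hv n).continuous_u.measurable.indicator (measurableSet_cyl _ _))
      (hind hB0 fun y hy => (hn y hy).2.1) (hind hB0 fun y hy => (hn y hy).2.2)
      q' hq'r q (hmem hr) (hq'.trans_le (min_le_left _ _))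
    rwa [indicator_of_mem (hcyl hr hq'r), indicator_of_mem (hcyl hr (hmem hr))] at this
  obtain ⟨φ, hφ, hlim⟩ := exists_subseq_tendsto hO hb he
  choose! u hu using hlim
  refine ⟨φ, u, fun q hq => ⟨hu q hq, ?_⟩⟩
  obtain ⟨x₀, t₀⟩ := q
  obtain ⟨r, hr, B, hB0, hS, hB⟩ := hloc x₀ hq
  obtain ⟨N, hN⟩ := eventually_atTop.1 (hφ.tendsto_atTop.eventually hB)
  set C := cyl x₀ (2 * r) with hC
  have hCx : ∀ y ∈ C, y.1 ≠ 0 := fun y hy => hS (mem_closedBall_iff_norm.2 hy)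
  set w : Euc d × ℝ → ℝ := fun y => β y.1 * u y - u y ^ p with hw
  have hNn : ∀ n, N ≤ n + N := fun n => Nat.le_add_left _ _
  have hU : ∀ y, Tendsto (fun n => C.indicator (v (φ (n + N))) y) atTop (𝓝 (C.indicator u y)) :=
    fun y => by
      by_cases hy : y ∈ C
      · simp only [indicator_of_mem hy]
        exact (hu y (hCx y hy)).comp (tendsto_add_atTop_nat N)
      · simp only [indicator_of_notMem hy]
        exact tendsto_const_nhds
  have hF : ∀ y, Tendsto (fun n => C.indicator (f (φ (n + N))) y) atTop (𝓝 (C.indicator w y)) :=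
    fun y => by
      by_cases hy : y ∈ C
      · have h1 := (hu y (hCx y hy)).comp (tendsto_add_atTop_nat N)
        simp only [indicator_of_mem hy, fun n => (hN (n + N) (hNn n) y hy).1]
        exact (h1.const_mul _).sub (h1.rpow_const (Or.inr (by linarith)))
      · simp only [indicator_of_notMem hy]
        exact tendsto_const_nhds
  have hvm : ∀ n, Measurable (C.indicator (v (φ (n + N)))) := fun n =>
    (hv _).continuous_u.measurable.indicator (measurableSet_cyl _ _)
  have hfm : ∀ n, Measurable (C.indicator (f (φ (n + N)))) := fun n =>
    (hv _).continuous_f.measurable.indicator (measurableSet_cyl _ _)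
  have hvB : ∀ n y, |C.indicator (v (φ (n + N))) y| ≤ B := fun n =>
    hind hB0 fun y hy => (hN _ (hNn n) y hy).2.2
  have hfB : ∀ n y, |C.indicator (f (φ (n + N))) y| ≤ B := fun n =>
    hind hB0 fun y hy => (hN _ (hNn n) y hy).2.1
  have hUm : Measurable (C.indicator u) :=
    measurable_of_tendsto_metrizable hvm (tendsto_pi_nhds.2 hU)
  have hFm : Measurable (C.indicator w) :=
    measurable_of_tendsto_metrizable hfm (tendsto_pi_nhds.2 hF)
  have hUB : ∀ y, |C.indicator u y| ≤ B := fun y =>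
    le_of_tendsto (hU y).abs (Eventually.of_forall fun n => hvB n y)
  have hFB : ∀ y, |C.indicator w y| ≤ B := fun y =>
    le_of_tendsto (hF y).abs (Eventually.of_forall fun n => hfB n y)
  have hU0 : ∀ y, 0 ≤ C.indicator u y := fun y =>
    ge_of_tendsto' (hU y) fun n => indicator_nonneg (fun z _ => hv0 _ z) y
  have hloc' : IsLocalPotential (C.indicator w) (C.indicator u) x₀ r :=
    IsLocalPotential.of_tendsto (fun n => (hv (φ (n + N))).isLocalPotential x₀ r) hfm hvm hfB hvB
      hF hU
  have hmemC : ∀ y ∈ cyl x₀ r, y ∈ C := fun y hy => hcyl hr hy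
  have hev : u =ᶠ[𝓝 (x₀, t₀)] C.indicator u := by
    filter_upwards [Metric.ball_mem_nhds (x₀, t₀) hr] with y hy
    rw [mem_ball_iff_norm] at hy
    exact (indicator_of_mem (hmemC y (mem_cyl.2 ((norm_fst_le (y - (x₀, t₀))).trans hy.le))) _).symm
  have hq0 : (x₀, t₀) ∈ C := hmemC _ (hmem (q := (x₀, t₀)) hr)
  refine ⟨(hloc'.continuousAt hr hFm hUm hFB hUB (by simpa using hr)).congr hev.symm, ?_⟩
  refine (hloc'.heatAt (β := β) hp hr hFm hUm hFB hUB hU0 (fun y hy => ?_) hβ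
    ((Metric.closedBall_subset_closedBall (by linarith)).trans hS) t₀).congr hev
    (indicator_of_mem hq0 _).symm
  rw [indicator_of_mem (hmemC y hy), indicator_of_mem (hmemC y hy)]

end

/-- Theorem 4, part (1): for `d ≥ 2`, `p > 1` with `d < 2p/(p−1)`,
`β₀ = (d(p−1) − 2p)/(p−1)²`, `κ ∈ (0, −β₀]` and `β(x) ≥ (β₀ + κ)/|x|²`, there is a
nontrivial nonnegative classical solution of `u_t = (1/2)Δu + βu − u^p`
on the punctured space `ℝ^d ∖ {0}` with zero initial data. -/
theorem stmt_16 {d : ℕ} (hd : 2 ≤ d) (p : ℝ) (hp : 1 < p)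
    (hdim : (d : ℝ) < 2 * p / (p - 1))
    (β₀ : ℝ) (hβ₀ : β₀ = ((d : ℝ) * (p - 1) - 2 * p) / (p - 1) ^ 2)
    (κ : ℝ) (hκ0 : 0 < κ) (hκ1 : κ ≤ -β₀)
    (β : EuclideanSpace ℝ (Fin d) → ℝ)
    (hβ_holder : LocHolderOn β ({0}ᶜ : Set (EuclideanSpace ℝ (Fin d))))
    (hβ_lower : ∀ x : EuclideanSpace ℝ (Fin d), x ≠ 0 →
      (β₀ + κ) / ‖x‖ ^ 2 ≤ β x) :
    ∃ u : EuclideanSpace ℝ (Fin d) → ℝ → ℝ,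
      ContinuousOn (fun q : EuclideanSpace ℝ (Fin d) × ℝ => u q.1 q.2)
        (({0}ᶜ : Set (EuclideanSpace ℝ (Fin d))) ×ˢ Ici (0 : ℝ)) ∧
      (∀ x : EuclideanSpace ℝ (Fin d), x ≠ 0 → ∀ t, 0 ≤ t → 0 ≤ u x t) ∧
      (∀ t : ℝ, 0 < t →
        ContDiffOn ℝ 2 (fun x => u x t) ({0}ᶜ : Set (EuclideanSpace ℝ (Fin d)))) ∧
      (∀ x : EuclideanSpace ℝ (Fin d), x ≠ 0 →
        ContDiffOn ℝ 1 (fun s => u x s) (Ioi (0 : ℝ))) ∧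
      (∀ x : EuclideanSpace ℝ (Fin d), x ≠ 0 → ∀ t, 0 < t →
        deriv (fun s => u x s) t =
          (1 / 2) * (∑ i, pd i (pd i (fun y => u y t)) x)
            + β x * u x t - u x t ^ p) ∧
      (∀ x : EuclideanSpace ℝ (Fin d), x ≠ 0 → u x 0 = 0) ∧
      (∃ x : EuclideanSpace ℝ (Fin d), x ≠ 0 ∧ ∃ t, 0 ≤ t ∧ u x t ≠ 0) := by
  have hp1 : 0 < p - 1 := by linarith
  have hβ₀' : -β₀ = 1 / (p - 1) * (2 * (1 / (p - 1)) + 2 - d) := by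
    rw [hβ₀]; field_simp; ring
  have hx₁ : ‖(EuclideanSpace.single ⟨0, by omega⟩ 1 : Euc d)‖ = 1 := by simp
  obtain ⟨t₁, η, ht₁, hη, happ⟩ := exists_approximation (b := -(β₀ + κ)) hp rfl (by linarith)
    (by linarith) hκ0 hβ_holder (by simpa using hβ_lower) hx₁
  choose v f hv0 hvN hv hf hvη using fun n : ℕ =>
    happ ((n : ℝ) + 1) (by linarith [Nat.cast_nonneg (α := ℝ) n])
  obtain ⟨φ, u, hu⟩ := exists_solution_of_approximation hp hβ_holder hv0 hvN hv hf
  have hx₁0 : (EuclideanSpace.single ⟨0, by omega⟩ 1 : Euc d) ≠ 0 := by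
    rw [← norm_pos_iff, hx₁]; exact one_pos
  refine ⟨fun x t => u (x, t), fun q hq => (hu q hq.1).2.1.continuousWithinAt,
    fun x hx t _ => ge_of_tendsto' (hu (x, t) hx).1 fun n => hv0 _ _,
    fun t _ x hx => ((hu (x, t) hx).2.2.1).contDiffWithinAt,
    fun x hx t _ => ((hu (x, t) hx).2.2.2.1).contDiffWithinAt, fun x hx t _ => ?_, fun x hx => ?_,
    _, hx₁0, t₁, ht₁.le, ?_⟩
  · rw [(hu (x, t) hx).2.2.2.2, add_sub_assoc]
  · refine tendsto_nhds_unique (hu (x, 0) hx).1 ?_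
    simp only [(hv _).u_zero x 0 le_rfl]
    exact tendsto_const_nhds
  · exact (hη.trans_le (ge_of_tendsto' (hu _ hx₁0).1 fun n => hvη _)).ne'
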